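/- For all integers δ and L, N_δ(L) = Σ C(L − L(w) + ρ(w) − 1, ρ(w) − 1), where the (finite) sum runs over all classes [w] ∈ 𝒢 that are represented by a motif w with δ(w) = δ and L(w) ≤ L (under the stated binomial convention, the terms with L(w) > L would vanish, so this agrees with the sum over all motif classes of defect δ). -/

import Mathlib

open scoped Classical

abbrev SL2Z := Matrix.SpecialLinearGroup (Fin 2) ℤ

def Amat : SL2Z := ⟨!![1, 2; 0, 1], by norm_num [Matrix.det_fin_two_of]⟩
def Bmat : SL2Z := ⟨!![1, 0; -2, 1], by norm_num [Matrix.det_fin_two_of]⟩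
def Cmat : SL2Z := (Amat * Bmat)⁻¹

def Gamma : Subgroup SL2Z := Subgroup.closure {Amat, Bmat}

/-- The real entry `i j` of a matrix in `SL₂(ℤ)`. -/
def entry (g : SL2Z) (i j : Fin 2) : ℝ := ((g : Matrix (Fin 2) (Fin 2) ℤ) i j : ℤ)

/-- The Möbius action of `SL₂(ℤ)` on the circle `ℝ ∪ {∞}`. -/
noncomputable def mobius (g : SL2Z) (p : OnePoint ℝ) : OnePoint ℝ :=
  Option.rec (motive := fun _ => OnePoint ℝ)
    (if entry g 1 0 = 0 then OnePoint.infty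
     else OnePoint.some (entry g 0 0 / entry g 1 0))
    (fun x => if entry g 1 0 * x + entry g 1 1 = 0 then OnePoint.infty
      else OnePoint.some ((entry g 0 0 * x + entry g 0 1) / (entry g 1 0 * x + entry g 1 1)))
    p

/-- The fixed-point set of `g` acting on the circle `ℝ ∪ {∞}`. -/
noncomputable def fixedSet (g : SL2Z) : Set (OnePoint ℝ) := {p | mobius g p = p}

/-- `g` is hyperbolic if `|trace g| > 2`. -/
def Hyperbolic (g : SL2Z) : Prop := 2 < |Matrix.trace (g : Matrix (Fin 2) (Fin 2) ℤ)|

/-- Two two-element subsets of the circle are linked if the two points of `Q` lie in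
different connected components of the complement of `P`. -/
def Linked (P Q : Set (OnePoint ℝ)) : Prop :=
  ∃ q₁ q₂ : OnePoint ℝ, q₁ ≠ q₂ ∧ Q = {q₁, q₂} ∧
    connectedComponentIn Pᶜ q₁ ≠ connectedComponentIn Pᶜ q₂

/-- `h` contributes to the count `s(v)`: `v` and `h * v * h⁻¹` are hyperbolic with
linked fixed-point sets. -/
def GoodConj (v h : Gamma) : Prop :=
  Hyperbolic (v : SL2Z) ∧ Hyperbolic ((h * v * h⁻¹ : Gamma) : SL2Z) ∧
    Linked (fixedSet (v : SL2Z)) (fixedSet ((h * v * h⁻¹ : Gamma) : SL2Z))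

/-- Twice `s(v)`: the number of double cosets `⟨v⟩ h ⟨v⟩` in `Γ` such that `v` and
`h * v * h⁻¹` are hyperbolic with linked fixed-point sets. -/
noncomputable def sTwo (v : Gamma) : ℕ :=
  Nat.card (Quot (fun h h' : {h : Gamma // GoodConj v h} =>
    ∃ m k : ℤ, (h' : Gamma) = v ^ m * (h : Gamma) * v ^ k))

/-- `v` is not a proper power in `Γ`. -/
def NotProperPower (v : Gamma) : Prop := ¬ ∃ u : Gamma, ∃ k : ℕ, 2 ≤ k ∧ v = u ^ k

/-- The self-intersection number `I(g) = n² s(v) + n - 1`, where `g = vⁿ` with `v` not a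
proper power and `n ≥ 1`, and `s(v)` is half the number of good double cosets. -/
noncomputable def Iγ (g : Gamma) : ℤ :=
  if h : ∃ p : Gamma × ℕ, 1 ≤ p.2 ∧ NotProperPower p.1 ∧ g = p.1 ^ p.2 then
    (h.choose.2 : ℤ) ^ 2 * ((sTwo h.choose.1 / 2 : ℕ) : ℤ) + (h.choose.2 : ℤ) - 1
  else 0
/-- The three-letter alphabet `{x, y, z}`. -/
inductive Letter | x | y | z
deriving DecidableEq

/-- The letter of `w` at cyclic position `i`. -/
def cget (w : List Letter) (i : ℕ) : Letter := w.getD (i % w.length) Letter.x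

/-- `w` is cyclically reduced: nonempty, and any two cyclically consecutive letters differ. -/
def CyclRed (w : List Letter) : Prop :=
  w ≠ [] ∧ ∀ i : ℕ, i < w.length → cget w i ≠ cget w (i + 1)

/-- The matrix assigned to a consecutive pair of letters:
`xy ↦ A`, `yx ↦ A⁻¹`, `yz ↦ B`, `zy ↦ B⁻¹`, `zx ↦ C`, `xz ↦ C⁻¹`. -/
def pairM : Letter → Letter → SL2Z
  | .x, .y => Amat
  | .y, .x => Amat⁻¹
  | .y, .z => Bmat
  | .z, .y => Bmat⁻¹
  | .z, .x => Cmat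
  | .x, .z => Cmat⁻¹
  | _, _ => 1

/-- `φ(w)`: group the letters of `w` into consecutive pairs and multiply the matrices. -/
def phiM : List Letter → SL2Z
  | [] => 1
  | [_] => 1
  | a :: b :: t => pairM a b * phiM t

lemma pairM_mem (a b : Letter) : pairM a b ∈ Gamma := by
  have hA : Amat ∈ Gamma := Subgroup.subset_closure (by simp)
  have hB : Bmat ∈ Gamma := Subgroup.subset_closure (by simp)
  have hC : Cmat ∈ Gamma := inv_mem (mul_mem hA hB)
  cases a <;> cases b <;>
    simp only [pairM] <;>
    first
      | exact hA | exact hB | exact hC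
      | exact inv_mem hA | exact inv_mem hB | exact inv_mem hC
      | exact one_mem _

lemma phiM_mem : ∀ w : List Letter, phiM w ∈ Gamma
  | [] => one_mem _
  | [_] => one_mem _
  | _ :: b :: t => mul_mem (pairM_mem _ b) (phiM_mem t)

/-- The self-intersection number of the word `w`. -/
noncomputable def Iw (w : List Letter) : ℤ := Iγ ⟨phiM w, phiM_mem w⟩

/-- The combinatorial length `L(w)` (half the number of letters). -/
def Lw (w : List Letter) : ℤ := (w.length : ℤ) / 2
/-- `w` is primitive: as a cyclic word it is not a `k`-fold concatenation of a
shorter word for any `k ≥ 2`. -/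
def Primitive (w : List Letter) : Prop :=
  ¬ ∃ u : List Letter, ∃ k : ℕ, 2 ≤ k ∧ u.length < w.length ∧
      ∃ j : ℕ, w.rotate j = (List.replicate k u).flatten

/-- `w` represents a class of `𝒢`: primitive, cyclically reduced, of even length at least 4. -/
def InG (w : List Letter) : Prop :=
  CyclRed w ∧ Primitive w ∧ 2 ∣ w.length ∧ 4 ≤ w.length

/-- Words representing classes of `𝒢`. -/
def GWord := {w : List Letter // InG w}

/-- `v` is obtained from `u`, or from its reversal, by a cyclic rotation through an
even number of places. -/
def WordEquiv (u v : List Letter) : Prop :=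
  ∃ k : ℕ, 2 ∣ k ∧ (v = u.rotate k ∨ v = u.reverse.rotate k)

def GEquiv (u v : GWord) : Prop := WordEquiv u.1 v.1

/-- The set `𝒢` of equivalence classes. -/
def GClass := Quot GEquiv

/-- The defect `δ(w) = I(w) - L(w)`. -/
noncomputable def deltaW (w : List Letter) : ℤ := Iw w - Lw w

/-- `N_δ(L)`: the number of classes `[w] ∈ 𝒢` with `L(w) = L` and `δ(w) = δ`. -/
noncomputable def Ncount (d L : ℤ) : ℕ :=
  Nat.card {c : GClass // ∃ w : GWord, Quot.mk GEquiv w = c ∧ Lw w.1 = L ∧ deltaW w.1 = d}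
/-- The positions `i, i+1, …, i+len-1` (cyclically) form a run of `w`: a maximal cyclic
interval whose letters lie in a two-element subset of `{x, y, z}`. -/
def RunAt (w : List Letter) (i len : ℕ) : Prop :=
  i < w.length ∧ 2 ≤ len ∧ len < w.length ∧
  (∃ T : Finset Letter, T.card = 2 ∧ ∀ j, j < len → cget w (i + j) ∈ T) ∧
  ¬ (∃ T : Finset Letter, T.card = 2 ∧ ∀ j, j < len + 1 → cget w (i + j) ∈ T) ∧
  ¬ (∃ T : Finset Letter, T.card = 2 ∧ ∀ j, j < len + 1 → cget w (i + w.length - 1 + j) ∈ T)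

/-- The type of the run starting at position `i`: the two-element subset of letters it uses. -/
def runType (w : List Letter) (i : ℕ) : Finset Letter := {cget w i, cget w (i + 1)}

/-- The expansion `w⁺[r]` of `w` at the run starting at position `i`: repeat the
first two letters of the run. -/
def expandAt (w : List Letter) (i : ℕ) : List Letter :=
  w.take i ++ [cget w i, cget w (i + 1)] ++ w.drop i

/-- The contraction `w⁻[r]` of `w` at the run starting at position `i`: delete the
first two letters of the run. -/
def contractAt (w : List Letter) (i : ℕ) : List Letter :=
  if i + 1 < w.length then w.take i ++ w.drop (i + 2)
  else (w.drop 1).dropLast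

/-- The run at `(i, len)` is distinguished: strictly longer than every other run of the
same type. -/
def DistinguishedRun (w : List Letter) (i len : ℕ) : Prop :=
  RunAt w i len ∧
    ∀ i' len', RunAt w i' len' → runType w i' = runType w i → i' ≠ i → len' < len

/-- The rank `ρ(w)`: the number of distinguished runs of `w`. -/
noncomputable def rank (w : List Letter) : ℕ :=
  Nat.card {p : ℕ × ℕ // DistinguishedRun w p.1 p.2}

/-- The motif condition: every run `r` with `ℓ(r) ≥ 4` admits another run `s` of the same
type with `ℓ(r) ≤ ℓ(s) + 2`. -/
def MotifCond (w : List Letter) : Prop :=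
  ∀ i len, RunAt w i len → 4 ≤ len →
    ∃ i' len', RunAt w i' len' ∧ runType w i' = runType w i ∧ i' ≠ i ∧ len ≤ len' + 2

/-- The binomial coefficient `C(n, k)` with the convention that it vanishes when `n` or `k`
is negative, except `C(-1, -1) = 1`. -/
def binC (n k : ℤ) : ℤ :=
  if n = -1 ∧ k = -1 then 1
  else if 0 ≤ n ∧ 0 ≤ k then (n.toNat.choose k.toNat : ℤ)
  else 0

/-- The word-level descendants of `w`: the smallest collection containing `w` and closed
under expansion at distinguished runs. -/
inductive Desc (w : List Letter) : List Letter → Prop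
  | base : Desc w w
  | step (v : List Letter) (i len : ℕ) :
      Desc w v → DistinguishedRun v i len → Desc w (expandAt v i)

/-- A choice of representative for each class in `𝒢`. -/
noncomputable def crep (c : GClass) : GWord := (Quot.exists_rep c).choose

namespace Pants

section

instance : Fintype Letter := ⟨{.x, .y, .z}, fun a => by cases a <;> simp⟩

/-- The linear action of an integral matrix on the real plane. -/
def act (g : GL (Fin 2) ℤ) (v : ℝ × ℝ) : ℝ × ℝ :=
  ((g.val 0 0 : ℝ) * v.1 + (g.val 0 1 : ℝ) * v.2, (g.val 1 0 : ℝ) * v.1 + (g.val 1 1 : ℝ) * v.2)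

/-- The determinant as a real number. -/
def dt (g : GL (Fin 2) ℤ) : ℝ := (g.val.det : ℝ)

/-- The area form on the real plane. -/
def wedge (u v : ℝ × ℝ) : ℝ := u.1 * v.2 - v.1 * u.2

lemma act_mul (g h : GL (Fin 2) ℤ) (v : ℝ × ℝ) : act (g * h) v = act g (act h v) := by
  simp [act, Matrix.mul_apply, Fin.sum_univ_two]
  constructor <;> ring

lemma act_one (v : ℝ × ℝ) : act 1 v = v := by
  simp [act]

lemma act_inv_act (g : GL (Fin 2) ℤ) (v : ℝ × ℝ) : act g⁻¹ (act g v) = v := by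
  rw [← act_mul, inv_mul_cancel, act_one]

lemma act_act_inv (g : GL (Fin 2) ℤ) (v : ℝ × ℝ) : act g (act g⁻¹ v) = v := by
  rw [← act_mul, mul_inv_cancel, act_one]

lemma act_smul (g : GL (Fin 2) ℤ) (c : ℝ) (v : ℝ × ℝ) : act g (c • v) = c • act g v := by
  simp [act]
  constructor <;> ring

lemma wedge_act (g : GL (Fin 2) ℤ) (u v : ℝ × ℝ) :
    wedge (act g u) (act g v) = dt g * wedge u v := by
  simp [act, wedge, dt, Matrix.det_fin_two]
  ring

lemma dt_mul (g h : GL (Fin 2) ℤ) : dt (g * h) = dt g * dt h := by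
  simp [dt]

lemma dt_one : dt 1 = 1 := by simp [dt]

lemma dt_eq (g : GL (Fin 2) ℤ) : dt g = 1 ∨ dt g = -1 := by
  have h : IsUnit g.val.det := (Matrix.isUnit_iff_isUnit_det _).1 g.isUnit
  rcases Int.isUnit_iff.1 h with h | h <;> simp [dt, h]

lemma dt_sq (g : GL (Fin 2) ℤ) : dt g * dt g = 1 := by
  rcases dt_eq g with h | h <;> simp [h]

/-- The quadratic form of a letter, positive on the open arc cut off by the side of the ideal
triangle `(0, 1, ∞)` with that label. -/
def quad : Letter → ℝ × ℝ → ℝ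
  | .x, v => v.2 * (v.1 - v.2)
  | .y, v => -(v.1 * v.2)
  | .z, v => v.1 * (v.2 - v.1)

/-- The reflection in the side of the ideal triangle `(0, 1, ∞)` labelled by a letter. -/
def refl : Letter → GL (Fin 2) ℤ
  | .x => ⟨!![1, -2; 0, -1], !![1, -2; 0, -1], by simp [Matrix.one_fin_two], by
      simp [Matrix.one_fin_two]⟩
  | .y => ⟨!![1, 0; 0, -1], !![1, 0; 0, -1], by simp [Matrix.one_fin_two], by
      simp [Matrix.one_fin_two]⟩
  | .z => ⟨!![1, 0; 2, -1], !![1, 0; 2, -1], by simp [Matrix.one_fin_two], by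
      simp [Matrix.one_fin_two]⟩

lemma refl_mul_self (a : Letter) : refl a * refl a = 1 := by
  cases a <;> ext i j <;> fin_cases i <;> fin_cases j <;> simp [refl]

lemma refl_inv (a : Letter) : (refl a)⁻¹ = refl a :=
  inv_eq_of_mul_eq_one_left (refl_mul_self a)

lemma dt_refl (a : Letter) : dt (refl a) = -1 := by
  cases a <;> simp [dt, refl, Matrix.det_fin_two]

lemma quad_refl (a : Letter) (v : ℝ × ℝ) : quad a (act (refl a) v) = -quad a v := by
  cases a <;> simp [quad, act, refl]
  · left; ring
  · ring

lemma quad_smul (a : Letter) (c : ℝ) (v : ℝ × ℝ) : quad a (c • v) = c ^ 2 * quad a v := by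
  cases a <;> simp [quad] <;> ring

lemma quad_neg_of_pos {a b : Letter} (hab : a ≠ b) {v : ℝ × ℝ} (h : 0 < quad b v) :
    quad a v < 0 := by
  cases a <;> cases b <;> simp_all [quad] <;>
    nlinarith [sq_nonneg v.1, sq_nonneg v.2, sq_nonneg (v.1 - v.2)]

lemma eq_of_quad_pos {a b : Letter} {v : ℝ × ℝ} (ha : 0 < quad a v) (hb : 0 < quad b v) :
    a = b := by
  by_contra hab
  exact absurd (quad_neg_of_pos hab hb) ha.le.not_gt

lemma quad_refl_pos {a b : Letter} (hab : a ≠ b) {v : ℝ × ℝ} (h : 0 < quad b v) :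
    0 < quad a (act (refl a) v) := by
  rw [quad_refl]
  linarith [quad_neg_of_pos hab h]

lemma snd_ne_zero_of_quad_pos {a : Letter} {v : ℝ × ℝ} (h : 0 < quad a v) : v.2 ≠ 0 := by
  intro h0
  cases a <;> simp [quad, h0] at h
  nlinarith [sq_nonneg v.1]

lemma wedge_ne_zero_of_quad_pos {a b : Letter} (hab : a ≠ b) {u v : ℝ × ℝ}
    (hu : 0 < quad a u) (hv : 0 < quad b v) : wedge u v ≠ 0 := by
  intro h
  have h1 := snd_ne_zero_of_quad_pos hu
  have h2 := snd_ne_zero_of_quad_pos hv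
  have e : v = (v.2 / u.2) • u := by
    ext
    · simp only [wedge] at h
      simp
      field_simp
      linarith
    · simp
      field_simp
  rw [e, quad_smul] at hv
  have : 0 < quad b u := by
    by_contra hc
    nlinarith [sq_nonneg (v.2 / u.2)]
  exact hab (eq_of_quad_pos hu this)

/-- The product of the four mutual wedges of two pairs of vectors; it is negative exactly when
the two pairs of lines separate each other. -/
def crossSign (e₁ e₂ e₃ e₄ : ℝ × ℝ) : ℝ :=
  wedge e₁ e₃ * wedge e₁ e₄ * (wedge e₂ e₃ * wedge e₂ e₄)

lemma crossSign_act (g : GL (Fin 2) ℤ) (e₁ e₂ e₃ e₄ : ℝ × ℝ) :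
    crossSign (act g e₁) (act g e₂) (act g e₃) (act g e₄) = crossSign e₁ e₂ e₃ e₄ := by
  simp only [crossSign, wedge_act]
  linear_combination (dt g * dt g + 1) * (wedge e₁ e₃ * wedge e₁ e₄ * (wedge e₂ e₃ * wedge e₂ e₄))
    * dt_sq g

lemma crossSign_swap (e₁ e₂ e₃ e₄ : ℝ × ℝ) :
    crossSign e₁ e₂ e₄ e₃ = crossSign e₁ e₂ e₃ e₄ := by
  simp only [crossSign]
  ring

/-- The orientation form of three vectors. -/
def orient (u v w : ℝ × ℝ) : ℝ := wedge u v * wedge v w * wedge w u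

lemma orient_act (g : GL (Fin 2) ℤ) (u v w : ℝ × ℝ) :
    orient (act g u) (act g v) (act g w) = dt g * orient u v w := by
  simp only [orient, wedge_act]
  linear_combination (dt g * wedge u v * wedge v w * wedge w u) * dt_sq g

lemma orient_mul_orient (a₁ b₁ a₂ b₂ : ℝ × ℝ) :
    orient b₁ b₂ a₁ * orient a₁ a₂ b₁ = -(wedge a₁ b₁) ^ 2 * crossSign a₁ b₁ a₂ b₂ := by
  simp only [orient, crossSign, wedge]
  ring

/-- The cyclic successor `x → y → z → x`. -/
def nxt : Letter → Letter
  | .x => .y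
  | .y => .z
  | .z => .x

/-- The sign of an ordered pair of distinct letters with respect to the cyclic order. -/
def sgn (a b : Letter) : ℝ := if nxt a = b then 1 else -1

lemma sgn_swap {a b : Letter} (h : a ≠ b) : sgn a b = -sgn b a := by
  cases a <;> cases b <;> simp_all [sgn, nxt]

/-- The arc of the affine line cut off by a side of the ideal triangle. -/
def arc : Letter → Set ℝ
  | .x => Set.Ioi 1
  | .y => Set.Iio 0
  | .z => Set.Ioo 0 1

lemma exists_ratio {a : Letter} {v : ℝ × ℝ} (h : 0 < quad a v) :
    ∃ s p : ℝ, s ≠ 0 ∧ v = (p * s, s) ∧ p ∈ arc a := by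
  have h2 := snd_ne_zero_of_quad_pos h
  refine ⟨v.2, v.1 / v.2, h2, by ext <;> simp [h2], ?_⟩
  have hs : 0 < v.2 * v.2 := mul_self_pos.2 h2
  obtain ⟨p, hp⟩ : ∃ p, p = v.1 / v.2 := ⟨_, rfl⟩
  have hv : v.1 = p * v.2 := by rw [hp]; field_simp
  rw [← hp]
  cases a <;> simp only [quad, hv] at h <;> simp only [arc, Set.mem_Ioi, Set.mem_Iio, Set.mem_Ioo]
  · nlinarith
  · nlinarith
  · have : 0 < (p * (1 - p)) * (v.2 * v.2) := by linarith
    have h3 : 0 < p * (1 - p) := by nlinarith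
    constructor <;> nlinarith

lemma arc_mul_pos {a b : Letter} (hab : a ≠ b) {p q r : ℝ} (hp : p ∈ arc a) (hq : q ∈ arc a)
    (hr : r ∈ arc b) : 0 < (r - p) * (r - q) := by
  cases a <;> cases b <;> simp_all only [arc, Set.mem_Ioi, Set.mem_Iio, Set.mem_Ioo, ne_eq,
    not_true_eq_false] <;>
  first
    | exact mul_pos (by linarith) (by linarith)
    | exact mul_pos_of_neg_of_neg (by linarith) (by linarith)

lemma crossSign_pos_of_arc {a b c : Letter} {u v w w' : ℝ × ℝ} (hab : a ≠ b) (hac : a ≠ c)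
    (hu : 0 < quad a u) (hv : 0 < quad a v) (hw : 0 < quad b w) (hw' : 0 < quad c w') :
    0 < crossSign w w' u v := by
  obtain ⟨s₁, p₁, hs₁, rfl, hp₁⟩ := exists_ratio hu
  obtain ⟨s₂, p₂, hs₂, rfl, hp₂⟩ := exists_ratio hv
  obtain ⟨s₃, p₃, hs₃, rfl, hp₃⟩ := exists_ratio hw
  obtain ⟨s₄, p₄, hs₄, rfl, hp₄⟩ := exists_ratio hw'
  have e : crossSign (p₃ * s₃, s₃) (p₄ * s₄, s₄) (p₁ * s₁, s₁) (p₂ * s₂, s₂) =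
      (s₁ * s₂ * s₃ * s₄) ^ 2 * (((p₃ - p₁) * (p₃ - p₂)) * ((p₄ - p₁) * (p₄ - p₂))) := by
    simp only [crossSign, wedge]; ring
  rw [e]
  exact mul_pos (by positivity)
    (mul_pos (arc_mul_pos hab hp₁ hp₂ hp₃) (arc_mul_pos hac hp₁ hp₂ hp₄))

lemma orient_xyz_pos {u v w : ℝ × ℝ} (hu : 0 < quad .x u) (hv : 0 < quad .y v)
    (hw : 0 < quad .z w) : 0 < orient u v w := by
  obtain ⟨s₁, p₁, hs₁, rfl, hp₁⟩ := exists_ratio hu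
  obtain ⟨s₂, p₂, hs₂, rfl, hp₂⟩ := exists_ratio hv
  obtain ⟨s₃, p₃, hs₃, rfl, hp₃⟩ := exists_ratio hw
  have e : orient (p₁ * s₁, s₁) (p₂ * s₂, s₂) (p₃ * s₃, s₃) =
      (s₁ * s₂ * s₃) ^ 2 * ((p₁ - p₂) * ((p₃ - p₂) * (p₁ - p₃))) := by
    simp only [orient, wedge]; ring
  rw [e]
  simp only [arc, Set.mem_Ioi, Set.mem_Iio, Set.mem_Ioo] at hp₁ hp₂ hp₃
  exact mul_pos (by positivity) (mul_pos (by linarith) (mul_pos (by linarith) (by linarith)))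

lemma orient_rotate (u v w : ℝ × ℝ) : orient v w u = orient u v w := by
  simp only [orient]; ring

lemma orient_swap (u v w : ℝ × ℝ) : orient v u w = -orient u v w := by
  simp only [orient, wedge]; ring

/-- The orientation of three vectors in the three arcs is determined by the cyclic order of the
labels. -/
lemma orient_mul_sgn_neg {a b c : Letter} {u v w : ℝ × ℝ} (hab : a ≠ b) (hbc : b ≠ c)
    (hac : a ≠ c) (hu : 0 < quad a u) (hv : 0 < quad b v) (hw : 0 < quad c w) :
    orient u v w * sgn a c < 0 := by
  have r₁ : orient v w u = orient u v w := orient_rotate u v w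
  have r₂ : orient w u v = orient u v w := by simp only [orient]; ring
  have r₃ : orient v u w = -orient u v w := orient_swap u v w
  have r₄ : orient u w v = -orient u v w := by simp only [orient, wedge]; ring
  have r₅ : orient w v u = -orient u v w := by simp only [orient, wedge]; ring
  cases a <;> cases b <;> cases c <;> simp_all only [ne_eq, not_true_eq_false] <;>
    simp only [sgn, nxt] <;> simp
  · linarith [orient_xyz_pos hu hv hw]
  · linarith [orient_xyz_pos hu hw hv]
  · linarith [orient_xyz_pos hv hu hw]
  · linarith [orient_xyz_pos hw hu hv]
  · linarith [orient_xyz_pos hv hw hu]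
  · linarith [orient_xyz_pos hw hv hu]

end

section

lemma connectedComponentIn_eq_of_mem {X : Type*} [TopologicalSpace X] {F S : Set X} {p q : X}
    (hS : IsPreconnected S) (hSF : S ⊆ F) (hp : p ∈ S) (hq : q ∈ S) :
    connectedComponentIn F p = connectedComponentIn F q :=
  connectedComponentIn_eq (hS.subset_connectedComponentIn hp hSF hq)

lemma isPreconnected_outside {a b : ℝ} :
    IsPreconnected ((fun x : ℝ => (x : OnePoint ℝ)) '' (Set.Icc a b)ᶜ ∪ {OnePoint.infty}) := by
  have hc : Continuous (fun x : ℝ => (x : OnePoint ℝ)) := OnePoint.continuous_coe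
  have key : ∀ S : Set ℝ, IsPreconnected S → ¬ Bornology.IsBounded S →
      IsPreconnected ((fun x : ℝ => (x : OnePoint ℝ)) '' S ∪ {OnePoint.infty}) := by
    intro S hS hb
    refine (hS.image _ hc.continuousOn).subset_closure Set.subset_union_left ?_
    refine Set.union_subset subset_closure ?_
    rw [Set.singleton_subset_iff, mem_closure_iff]
    intro o ho hinf
    rw [OnePoint.isOpen_iff_of_mem hinf] at ho
    by_contra hne
    apply hb
    refine (ho.2.isBounded).subset ?_
    intro x hx hxo
    exact hne ⟨x, hxo, x, hx, rfl⟩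
  have h1 := key (Set.Iio a) isPreconnected_Iio (fun h => by
    exact (not_bddBelow_Iio a) h.bddBelow)
  have h2 := key (Set.Ioi b) isPreconnected_Ioi (fun h => by
    exact (not_bddAbove_Ioi b) h.bddAbove)
  have h3 := h1.union OnePoint.infty (by simp) (by simp) h2
  convert h3 using 1
  have : (Set.Icc a b)ᶜ = Set.Iio a ∪ Set.Ioi b := by
    ext x; simp [Set.mem_Icc]; constructor
    · intro h; by_cases hx : x < a
      · exact Or.inl hx
      · exact Or.inr (h (not_lt.1 hx))
    · rintro (h | h) h'
      · linarith
      · exact h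
  rw [this, Set.image_union]
  ext x; simp only [Set.mem_union]; tauto

lemma component_ne_of_separated {a b c d : ℝ} (hc : c ∈ Set.Ioo a b) (hd : d ∉ Set.Icc a b) :
    connectedComponentIn ({(a : OnePoint ℝ), (b : OnePoint ℝ)}ᶜ) (c : OnePoint ℝ) ≠
      connectedComponentIn ({(a : OnePoint ℝ), (b : OnePoint ℝ)}ᶜ) (d : OnePoint ℝ) := by
  intro h
  have hcP : (c : OnePoint ℝ) ∈ ({(a : OnePoint ℝ), (b : OnePoint ℝ)} : Set _)ᶜ := by
    simp only [Set.mem_compl_iff, Set.mem_insert_iff, OnePoint.coe_eq_coe, Set.mem_singleton_iff]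
    rintro (h | h) <;> simp [h] at hc
  have hdP : (d : OnePoint ℝ) ∈ ({(a : OnePoint ℝ), (b : OnePoint ℝ)} : Set _)ᶜ := by
    simp only [Set.mem_compl_iff, Set.mem_insert_iff, OnePoint.coe_eq_coe, Set.mem_singleton_iff]
    rintro (h | h)
    · subst h; exact hd ⟨le_rfl, (hc.1.trans hc.2).le⟩
    · subst h; exact hd ⟨(hc.1.trans hc.2).le, le_rfl⟩
  have hpre : IsPreconnected (connectedComponentIn
    ({(a : OnePoint ℝ), (b : OnePoint ℝ)}ᶜ) (c : OnePoint ℝ)) := isPreconnected_connectedComponentIn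
  have hU : IsOpen ((fun x : ℝ => (x : OnePoint ℝ)) '' Set.Ioo a b) :=
    OnePoint.isOpenEmbedding_coe.isOpenMap _ isOpen_Ioo
  have hV : IsOpen (((fun x : ℝ => (x : OnePoint ℝ)) '' Set.Icc a b)ᶜ) :=
    (isCompact_Icc.image OnePoint.continuous_coe).isClosed.isOpen_compl
  have hsub : connectedComponentIn ({(a : OnePoint ℝ), (b : OnePoint ℝ)}ᶜ) (c : OnePoint ℝ) ⊆
      ((fun x : ℝ => (x : OnePoint ℝ)) '' Set.Ioo a b) ∪
        ((fun x : ℝ => (x : OnePoint ℝ)) '' Set.Icc a b)ᶜ := by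
    intro p hp
    have hp' := connectedComponentIn_subset _ _ hp
    by_cases hpi : p ∈ (fun x : ℝ => (x : OnePoint ℝ)) '' Set.Icc a b
    · obtain ⟨x, hx, rfl⟩ := hpi
      left
      refine ⟨x, ⟨lt_of_le_of_ne hx.1 ?_, lt_of_le_of_ne hx.2 ?_⟩, rfl⟩
      · rintro rfl; simp at hp'
      · rintro rfl; simp at hp'
    · exact Or.inr hpi
  obtain ⟨p, hp, ⟨x, hx, rfl⟩, hp2⟩ := hpre _ _ hU hV hsub
    ⟨c, mem_connectedComponentIn hcP, c, hc, rfl⟩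
    ⟨d, h ▸ mem_connectedComponentIn hdP, by
      rintro ⟨x, hx, hxd⟩
      rw [OnePoint.coe_eq_coe] at hxd
      exact hd (hxd ▸ hx)⟩
  exact hp2 ⟨x, Set.Ioo_subset_Icc_self hx, rfl⟩

lemma component_ne_iff {a b c d : ℝ} (hab : a < b) (hca : c ≠ a) (hcb : c ≠ b) (hda : d ≠ a)
    (hdb : d ≠ b) :
    connectedComponentIn ({(a : OnePoint ℝ), (b : OnePoint ℝ)}ᶜ) (c : OnePoint ℝ) ≠
      connectedComponentIn ({(a : OnePoint ℝ), (b : OnePoint ℝ)}ᶜ) (d : OnePoint ℝ) ↔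
    ¬ (c ∈ Set.Ioo a b ↔ d ∈ Set.Ioo a b) := by
  have out : ∀ x : ℝ, x ≠ a → x ≠ b → x ∉ Set.Ioo a b → x ∉ Set.Icc a b := by
    intro x h1 h2 h3 h4
    exact h3 ⟨lt_of_le_of_ne h4.1 h1.symm, lt_of_le_of_ne h4.2 h2⟩
  constructor
  · intro h hiff
    apply h
    by_cases hc : c ∈ Set.Ioo a b
    · refine connectedComponentIn_eq_of_mem
        (isPreconnected_Ioo.image _ OnePoint.continuous_coe.continuousOn) ?_
        ⟨c, hc, rfl⟩ ⟨d, hiff.1 hc, rfl⟩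
      rintro _ ⟨x, hx, rfl⟩
      simp only [Set.mem_compl_iff, Set.mem_insert_iff, OnePoint.coe_eq_coe,
        Set.mem_singleton_iff]
      rintro (h | h) <;> simp [h] at hx
    · refine connectedComponentIn_eq_of_mem (isPreconnected_outside (a := a) (b := b)) ?_
        (Or.inl ⟨c, out c hca hcb hc, rfl⟩)
        (Or.inl ⟨d, out d hda hdb (fun h => hc (hiff.2 h)), rfl⟩)
      rintro _ (⟨x, hx, rfl⟩ | hx)
      · simp only [Set.mem_compl_iff, Set.mem_insert_iff, OnePoint.coe_eq_coe,
          Set.mem_singleton_iff]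
        rintro (h | h)
        · subst h; exact hx ⟨le_rfl, hab.le⟩
        · subst h; exact hx ⟨hab.le, le_rfl⟩
      · rw [Set.mem_singleton_iff] at hx
        subst hx
        simp
  · intro h
    by_cases hc : c ∈ Set.Ioo a b
    · exact component_ne_of_separated hc (out d hda hdb (fun hd => h ⟨fun _ => hd, fun _ => hc⟩))
    · have hd : d ∈ Set.Ioo a b := by
        by_contra hd
        exact h ⟨fun h' => absurd h' hc, fun h' => absurd h' hd⟩
      exact (component_ne_of_separated hd (out c hca hcb hc)).symm

lemma not_iff_mem_Ioo {a b c d : ℝ} (hab : a < b) (hca : c ≠ a) (hcb : c ≠ b) (hda : d ≠ a)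
    (hdb : d ≠ b) : ¬ (c ∈ Set.Ioo a b ↔ d ∈ Set.Ioo a b) ↔
      (c - a) * (d - a) * ((c - b) * (d - b)) < 0 := by
  have key : ∀ x : ℝ, x ≠ a → x ≠ b → (x ∈ Set.Ioo a b ∧ (x - a) * (x - b) < 0) ∨
      (x ∉ Set.Ioo a b ∧ 0 < (x - a) * (x - b)) := by
    intro x h1 h2
    rcases lt_or_gt_of_ne h1 with h1 | h1
    · right
      exact ⟨fun h => absurd h.1 h1.not_gt, mul_pos_of_neg_of_neg (by linarith) (by linarith)⟩
    · rcases lt_or_gt_of_ne h2 with h2 | h2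
      · left
        exact ⟨⟨h1, h2⟩, mul_neg_of_pos_of_neg (by linarith) (by linarith)⟩
      · right
        exact ⟨fun h => absurd h.2 h2.not_gt, mul_pos (by linarith) (by linarith)⟩
  have e : (c - a) * (d - a) * ((c - b) * (d - b)) =
    ((c - a) * (c - b)) * ((d - a) * (d - b)) := by ring
  rw [e]
  rcases key c hca hcb with ⟨h1, h2⟩ | ⟨h1, h2⟩ <;> rcases key d hda hdb with ⟨h3, h4⟩ | ⟨h3, h4⟩
  · simp only [h1, h3, not_true_eq_false, false_iff, not_lt]
    exact (mul_pos_of_neg_of_neg h2 h4).le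
  · simp only [h1, h3, true_iff]
    simp
    exact mul_neg_of_neg_of_pos h2 h4
  · simp only [h1, h3]
    simp
    exact mul_neg_of_pos_of_neg h2 h4
  · simp only [h1, h3, not_true_eq_false, false_iff, not_lt]
    exact (mul_pos h2 h4).le

lemma linked_iff_lt {a b c d : ℝ} (hab : a < b) (hcd : c ≠ d) (hca : c ≠ a) (hcb : c ≠ b)
    (hda : d ≠ a) (hdb : d ≠ b) :
    Linked {(a : OnePoint ℝ), (b : OnePoint ℝ)} {(c : OnePoint ℝ), (d : OnePoint ℝ)} ↔
      (c - a) * (d - a) * ((c - b) * (d - b)) < 0 := by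
  rw [← not_iff_mem_Ioo hab hca hcb hda hdb, ← component_ne_iff hab hca hcb hda hdb]
  constructor
  · rintro ⟨q₁, q₂, hne, hQ, hcomp⟩
    have h1 : q₁ ∈ ({(c : OnePoint ℝ), (d : OnePoint ℝ)} : Set _) := by rw [hQ]; simp
    have h2 : q₂ ∈ ({(c : OnePoint ℝ), (d : OnePoint ℝ)} : Set _) := by rw [hQ]; simp
    rcases h1 with h1 | h1 <;> rcases h2 with h2 | h2
    · exact absurd (h1.trans h2.symm) hne
    · rw [h1, h2] at hcomp; exact hcomp
    · rw [h1, h2] at hcomp; exact hcomp.symm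
    · exact absurd (h1.trans h2.symm) hne
  · intro h
    exact ⟨c, d, by simpa using hcd, rfl, h⟩

lemma linked_iff {a b c d : ℝ} (hab : a ≠ b) (hcd : c ≠ d) (hca : c ≠ a) (hcb : c ≠ b)
    (hda : d ≠ a) (hdb : d ≠ b) :
    Linked {(a : OnePoint ℝ), (b : OnePoint ℝ)} {(c : OnePoint ℝ), (d : OnePoint ℝ)} ↔
      (c - a) * (d - a) * ((c - b) * (d - b)) < 0 := by
  rcases lt_or_gt_of_ne hab with h | h
  · exact linked_iff_lt h hcd hca hcb hda hdb
  · rw [Set.pair_comm, linked_iff_lt h hcd hcb hca hdb hda, mul_comm]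

lemma not_linked_self (P : Set (OnePoint ℝ)) : ¬ Linked P P := by
  rintro ⟨q₁, q₂, -, hQ, h⟩
  apply h
  rw [connectedComponentIn_eq_empty (by simp [hQ]), connectedComponentIn_eq_empty (by simp [hQ])]

lemma linked_iff_crossSign {e₁ e₂ e₃ e₄ : ℝ × ℝ} (h₁ : e₁.2 ≠ 0) (h₂ : e₂.2 ≠ 0) (h₃ : e₃.2 ≠ 0)
    (h₄ : e₄.2 ≠ 0) (h₁₂ : wedge e₁ e₂ ≠ 0) (h₃₄ : wedge e₃ e₄ ≠ 0)
    (h : crossSign e₁ e₂ e₃ e₄ ≠ 0) :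
    Linked {((e₁.1 / e₁.2 : ℝ) : OnePoint ℝ), ((e₂.1 / e₂.2 : ℝ) : OnePoint ℝ)}
      {((e₃.1 / e₃.2 : ℝ) : OnePoint ℝ), ((e₄.1 / e₄.2 : ℝ) : OnePoint ℝ)} ↔
      crossSign e₁ e₂ e₃ e₄ < 0 := by
  have key : ∀ u v : ℝ × ℝ, u.2 ≠ 0 → v.2 ≠ 0 → wedge u v =
      -(u.2 * v.2) * (v.1 / v.2 - u.1 / u.2) := by
    intro u v hu hv
    simp only [wedge]
    field_simp
    ring
  have key' : ∀ u v : ℝ × ℝ, u.2 ≠ 0 → v.2 ≠ 0 → wedge u v ≠ 0 → v.1 / v.2 ≠ u.1 / u.2 := by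
    intro u v hu hv h h'
    rw [key u v hu hv, h'] at h
    simp at h
  simp only [crossSign, ne_eq, mul_eq_zero, not_or] at h
  obtain ⟨⟨h13, h14⟩, h23, h24⟩ := h
  rw [linked_iff (key' _ _ h₁ h₂ h₁₂).symm (key' _ _ h₃ h₄ h₃₄).symm (key' _ _ h₁ h₃ h13)
    (key' _ _ h₂ h₃ h23) (key' _ _ h₁ h₄ h14) (key' _ _ h₂ h₄ h24)]
  have e : crossSign e₁ e₂ e₃ e₄ = (e₁.2 * e₂.2 * e₃.2 * e₄.2) ^ 2 *
      ((e₃.1 / e₃.2 - e₁.1 / e₁.2) * (e₄.1 / e₄.2 - e₁.1 / e₁.2) *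
        ((e₃.1 / e₃.2 - e₂.1 / e₂.2) * (e₄.1 / e₄.2 - e₂.1 / e₂.2))) := by
    simp only [crossSign, key _ _ h₁ h₃, key _ _ h₁ h₄, key _ _ h₂ h₃, key _ _ h₂ h₄]
    ring
  have hpos : 0 < (e₁.2 * e₂.2 * e₃.2 * e₄.2) ^ 2 := by positivity
  rw [e]
  constructor
  · intro h; exact mul_neg_of_pos_of_neg hpos h
  · intro h; exact (pos_iff_neg_of_mul_neg h).1 hpos

/-- The image of an element of `SL₂(ℤ)` in `GL₂(ℤ)`. -/
def toG : SL2Z →* GL (Fin 2) ℤ := Matrix.SpecialLinearGroup.toGL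

lemma toG_val (g : SL2Z) : (toG g).val = (g : Matrix (Fin 2) (Fin 2) ℤ) := rfl

lemma toG_injective : Function.Injective toG := by
  intro g h hgh
  ext i j
  have := congrArg (fun x : GL (Fin 2) ℤ => x.val i j) hgh
  exact this

lemma dt_toG (g : SL2Z) : dt (toG g) = 1 := by
  simp [dt, toG_val]

lemma wedge_smul_right (c : ℝ) (u v : ℝ × ℝ) : wedge u (c • v) = c * wedge u v := by
  simp [wedge]; ring

lemma wedge_smul_left (c : ℝ) (u v : ℝ × ℝ) : wedge (c • u) v = c * wedge u v := by
  simp [wedge]; ring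

/-- `v` spans an invariant line of `g`. -/
def IsEigen (g : GL (Fin 2) ℤ) (v : ℝ × ℝ) : Prop := wedge (act g v) v = 0

lemma mobius_coe_eq_iff (g : SL2Z) (p : ℝ) :
    mobius g (p : OnePoint ℝ) = p ↔ IsEigen (toG g) (p, 1) := by
  have hm : mobius g (p : OnePoint ℝ) = if entry g 1 0 * p + entry g 1 1 = 0 then OnePoint.infty
      else OnePoint.some ((entry g 0 0 * p + entry g 0 1) / (entry g 1 0 * p + entry g 1 1)) := rfl
  have he : IsEigen (toG g) (p, 1) ↔
      entry g 0 0 * p + entry g 0 1 = p * (entry g 1 0 * p + entry g 1 1) := by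
    simp only [IsEigen, act, wedge, toG_val, entry]
    constructor <;> intro h <;> linarith
  have hd : entry g 0 0 * entry g 1 1 - entry g 0 1 * entry g 1 0 = 1 := by
    have := g.2
    rw [Matrix.det_fin_two] at this
    simp only [entry]
    exact_mod_cast this
  rw [hm, he]
  split_ifs with h
  · simp only [OnePoint.infty_ne_coe, false_iff]
    intro h'
    rw [h, mul_zero] at h'
    have : entry g 1 1 * (entry g 0 0 * p + entry g 0 1) -
      entry g 0 1 * (entry g 1 0 * p + entry g 1 1) = p := by linear_combination p * hd
    rw [h, h'] at this
    have h3 : entry g 0 0 * (entry g 1 0 * p + entry g 1 1) -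
      entry g 1 0 * (entry g 0 0 * p + entry g 0 1) = 1 := by linear_combination hd
    rw [h, h'] at h3
    simp at h3
  · have : (OnePoint.some ((entry g 0 0 * p + entry g 0 1) / (entry g 1 0 * p + entry g 1 1)) :
      OnePoint ℝ) = p ↔ (entry g 0 0 * p + entry g 0 1) / (entry g 1 0 * p + entry g 1 1) = p :=
      OnePoint.coe_eq_coe
    rw [this, div_eq_iff h]

lemma hyperbolic_entry_ne_zero {g : SL2Z} (h : Hyperbolic g) : entry g 1 0 ≠ 0 := by
  intro h0
  have h0' : (g : Matrix (Fin 2) (Fin 2) ℤ) 1 0 = 0 := by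
    simpa [entry] using h0
  have hd := g.2
  rw [Matrix.det_fin_two, h0', mul_zero, sub_zero] at hd
  rw [Hyperbolic, Matrix.trace_fin_two] at h
  rcases Int.eq_one_or_neg_one_of_mul_eq_one' hd with ⟨h1, h2⟩ | ⟨h1, h2⟩ <;> rw [h1, h2] at h <;>
    norm_num at h

lemma fixedSet_eq {g : SL2Z} (hg : Hyperbolic g) {u v : ℝ × ℝ} (hu : u.2 ≠ 0) (hv : v.2 ≠ 0)
    (huv : wedge u v ≠ 0) (hu' : IsEigen (toG g) u) (hv' : IsEigen (toG g) v) :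
    fixedSet g = {((u.1 / u.2 : ℝ) : OnePoint ℝ), ((v.1 / v.2 : ℝ) : OnePoint ℝ)} := by
  have hc := hyperbolic_entry_ne_zero hg
  have scale : ∀ w : ℝ × ℝ, w.2 ≠ 0 → IsEigen (toG g) w → IsEigen (toG g) (w.1 / w.2, 1) := by
    intro w hw h
    have : ((w.1 / w.2, 1) : ℝ × ℝ) = (w.2)⁻¹ • w := by
      ext <;> simp [hw]; field_simp
    rw [this, IsEigen, act_smul, wedge_smul_left, wedge_smul_right]
    rw [IsEigen] at h
    rw [h]; simp
  have he : ∀ p : ℝ, IsEigen (toG g) (p, 1) ↔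
      entry g 0 0 * p + entry g 0 1 = p * (entry g 1 0 * p + entry g 1 1) := by
    intro p
    simp only [IsEigen, act, wedge, toG_val, entry]
    constructor <;> intro h <;> linarith
  have hne : u.1 / u.2 ≠ v.1 / v.2 := by
    intro h
    apply huv
    rw [div_eq_div_iff hu hv] at h
    simp only [wedge]; linarith
  have h1 := scale u hu hu'
  have h2 := scale v hv hv'
  ext p
  simp only [fixedSet, Set.mem_ofPred_eq, Set.mem_insert_iff, Set.mem_singleton_iff]
  induction p using OnePoint.rec with
  | infty =>
    have : mobius g OnePoint.infty = if entry g 1 0 = 0 then OnePoint.infty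
     else OnePoint.some (entry g 0 0 / entry g 1 0) := rfl
    rw [this, if_neg hc]
    simp
  | coe p =>
    rw [mobius_coe_eq_iff, OnePoint.coe_eq_coe, OnePoint.coe_eq_coe]
    constructor
    · intro h
      rw [he] at h h1 h2
      have s1 : entry g 1 0 * (u.1 / u.2 + v.1 / v.2) = entry g 0 0 - entry g 1 1 := by
        have : (u.1 / u.2 - v.1 / v.2) * (entry g 1 0 * (u.1 / u.2 + v.1 / v.2) -
          (entry g 0 0 - entry g 1 1)) = 0 := by linear_combination h2 - h1
        rcases mul_eq_zero.1 this with h | h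
        · exact absurd (sub_eq_zero.1 h) hne
        · linarith
      have s2 : entry g 1 0 * ((p - u.1 / u.2) * (p - v.1 / v.2)) = 0 := by
        linear_combination h1 - h + (u.1 / u.2 - p) * s1
      rcases mul_eq_zero.1 s2 with h | h
      · exact absurd h hc
      · rcases mul_eq_zero.1 h with h | h
        · left; linarith
        · right; linarith
    · rintro (h | h)
      · rw [h]; exact h1
      · rw [h]; exact h2

end

section

/-- The vertex of the ideal triangle `(0, 1, ∞)` opposite to the side with the given label. -/
def cusp : Letter → ℝ × ℝ
  | .x => (0, 1)
  | .y => (1, 1)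
  | .z => (1, 0)

lemma act_neg (g : GL (Fin 2) ℤ) (v : ℝ × ℝ) : act g (-v) = -act g v := by
  have := act_smul g (-1) v
  simpa using this

lemma quad_neg (a : Letter) (v : ℝ × ℝ) : quad a (-v) = quad a v := by
  have := quad_smul a (-1) v
  simpa using this

lemma act_refl_cusp {a c : Letter} (h : a ≠ c) :
    act (refl a) (cusp c) = cusp c ∨ act (refl a) (cusp c) = -cusp c := by
  cases a <;> cases c <;> simp [act, refl, cusp] at h ⊢ <;> norm_num

lemma quad_act_refl_cusp (c : Letter) : 0 < quad c (act (refl c) (cusp c)) := by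
  cases c <;> simp [act, refl, cusp, quad]

/-- A reduced bi-infinite sequence of letters together with a path of reflections following it. -/
structure Path (f : ℤ → Letter) (p : ℤ → GL (Fin 2) ℤ) : Prop where
  red : ∀ k, f k ≠ f (k + 1)
  step : ∀ k, p (k + 1) = p k * refl (f k)

variable {f : ℤ → Letter} {p : ℤ → GL (Fin 2) ℤ}

lemma Path.step' (h : Path f p) (k : ℤ) : p k = p (k + 1) * refl (f k) := by
  rw [h.step, mul_assoc, refl_mul_self, mul_one]

lemma Path.inv_step (h : Path f p) (k : ℤ) : (p k)⁻¹ = refl (f k) * (p (k + 1))⁻¹ := by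
  rw [h.step, mul_inv_rev, ← mul_assoc, refl_inv, refl_mul_self, one_mul]

lemma Path.reverse (h : Path f p) : Path (fun k => f (-1 - k)) (fun k => p (-k)) where
  red k := by
    have := h.red (-1 - (k + 1))
    rw [show -1 - (k + 1) + 1 = -1 - k by ring] at this
    exact this.symm
  step k := by
    have := h.step' (-1 - k)
    rw [show -1 - k + 1 = -k by ring] at this
    rw [show -(k + 1) = -1 - k by ring]
    exact this

lemma Path.translate (h : Path f p) (g : GL (Fin 2) ℤ) : Path f (fun k => g * p k) where
  red := h.red
  step k := by rw [h.step, mul_assoc]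

lemma Path.shift (h : Path f p) (c : ℤ) : Path (fun k => f (k + c)) (fun k => p (k + c)) where
  red k := by
    have := h.red (k + c)
    rwa [show k + c + 1 = k + 1 + c by ring] at this
  step k := by
    have := h.step (k + c)
    rwa [show k + c + 1 = k + 1 + c by ring] at this

lemma Path.unique {p' : ℤ → GL (Fin 2) ℤ} (h : Path f p) (h' : Path f p') {k₀ : ℤ}
    (h0 : p k₀ = p' k₀) (k : ℤ) : p k = p' k := by
  induction k using Int.inductionOn' (b := k₀) with
  | zero => exact h0
  | succ k _ ih => rw [h.step, h'.step, ih]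
  | pred k _ ih =>
    have e1 := h.step' (k - 1)
    have e2 := h'.step' (k - 1)
    rw [sub_add_cancel] at e1 e2
    rw [e1, e2, ih]

lemma Path.periodic (h : Path f p) (h0 : p 0 = 1) {n : ℤ} (hn : ∀ k, f (k + n) = f k) (k : ℤ) :
    p (k + n) = p n * p k := by
  have h1 := h.shift n
  simp only [hn] at h1
  refine h1.unique (h.translate (p n)) (k₀ := 0) ?_ k
  simp [h0]

lemma Path.periodic_zpow (h : Path f p) (h0 : p 0 = 1) {n : ℤ} (hn : ∀ k, f (k + n) = f k)
    (m : ℤ) (k : ℤ) : p (k + m * n) = p n ^ m * p k := by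
  induction m using Int.inductionOn' (b := 0) with
  | zero => simp
  | succ m _ ih =>
    rw [show k + (m + 1) * n = (k + m * n) + n by ring, h.periodic h0 hn, ih, ← mul_assoc,
      zpow_add, zpow_one]
    rw [(Commute.refl (p n)).zpow_right m]
  | pred m _ ih =>
    have := h.periodic h0 hn (k + (m - 1) * n)
    rw [show k + (m - 1) * n + n = k + m * n by ring, ih] at this
    rw [← mul_right_inj (p n), ← this, zpow_sub_one, ← mul_assoc]
    group

lemma Path.cusp_alternative (h : Path f p) (c : Letter) (N : ℤ) (d : ℕ) :
    ((∀ j, N - d ≤ j → j < N → f j ≠ c) ∧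
      (act ((p (N - d))⁻¹ * p N) (cusp c) = cusp c ∨
        act ((p (N - d))⁻¹ * p N) (cusp c) = -cusp c)) ∨
    0 < quad (f (N - d)) (act ((p (N - d))⁻¹ * p N) (cusp c)) := by
  induction d with
  | zero =>
    left
    refine ⟨fun j h1 h2 => by simp at h1; omega, Or.inl ?_⟩
    simp [act_one]
  | succ d ih =>
    have e : N - ((d + 1 : ℕ) : ℤ) + 1 = N - d := by push_cast; ring
    set k := N - ((d + 1 : ℕ) : ℤ) with hk
    rw [← e] at ih
    rw [h.inv_step k, mul_assoc, act_mul]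
    rcases ih with ⟨h1, h2⟩ | h2
    · by_cases hc : f k = c
      · right
        rcases h2 with h2 | h2 <;> rw [h2, hc]
        · exact quad_act_refl_cusp c
        · rw [act_neg, quad_neg]; exact quad_act_refl_cusp c
      · left
        refine ⟨fun j h3 h4 => ?_, ?_⟩
        · rcases eq_or_lt_of_le h3 with h5 | h5
          · rw [← h5]; exact hc
          · exact h1 j (by omega) h4
        · rcases h2 with h2 | h2 <;> rw [h2] <;> rcases act_refl_cusp hc with h3 | h3
          · exact Or.inl h3
          · exact Or.inr h3
          · rw [act_neg, h3]; exact Or.inr rfl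
          · rw [act_neg, h3, neg_neg]; exact Or.inl rfl
    · right
      exact quad_refl_pos (h.red k) h2

lemma Path.quad_cusp_pos (h : Path f p) (h0 : p 0 = 1) {n : ℕ} {c : Letter} {j : ℤ} (hj : 0 ≤ j)
    (hjn : j < n) (hc : f j = c) : 0 < quad (f 0) (act (p n) (cusp c)) := by
  rcases h.cusp_alternative c n n with ⟨h1, -⟩ | h1
  · exact absurd hc (h1 j (by simpa using hj) hjn)
  · simpa [h0] using h1

lemma Path.quad_pos_of_le (h : Path f p) {u : ℝ × ℝ} {k : ℤ}
    (hk : 0 < quad (f k) (act (p k)⁻¹ u)) (d : ℕ) :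
    0 < quad (f (k - d)) (act (p (k - d))⁻¹ u) := by
  induction d with
  | zero => simpa using hk
  | succ d ih =>
    have e : k - ((d + 1 : ℕ) : ℤ) + 1 = k - d := by push_cast; ring
    rw [← e] at ih
    rw [h.inv_step, act_mul]
    exact quad_refl_pos (h.red _) ih

lemma hyperbolic_core {A B C D : ℤ} (h1 : 0 < A * B) (h2 : 0 < C * D) (hdet : A * D - B * C = 1)
    (hpp : ∀ s t : ℝ, 0 < s * t → 0 < (A * s + C * t) * (B * s + D * t)) :
    2 < |A + D| ∧ ∃ s : ℝ, 0 < s ∧ A * s + C = (B * s + D) * s := by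
  have hAC : 0 < A * C := by
    by_contra hAC
    have hA : A ≠ 0 := by rintro rfl; simp at h1
    have hC : C ≠ 0 := by rintro rfl; simp at h2
    have hAC' : A * C < 0 := lt_of_le_of_ne (not_lt.1 hAC) (mul_ne_zero hA hC)
    have := hpp (-C) A (by
      have : ((A * C : ℤ) : ℝ) < 0 := by exact_mod_cast hAC'
      push_cast at this
      nlinarith)
    have e : (A : ℝ) * -C + C * A = 0 := by ring
    rw [e] at this
    simp at this
  have hBC : 0 < B * C := by
    have : 0 < (A * A) * (B * C) := by nlinarith
    exact pos_of_mul_pos_right this (mul_self_nonneg A)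
  have hAD : 2 ≤ A * D := by omega
  refine ⟨?_, ?_⟩
  · rcases abs_cases (A + D) with ⟨h, _⟩ | ⟨h, _⟩ <;> rw [h] <;> nlinarith [sq_nonneg (A - D)]
  · have hBC' : (0 : ℝ) < B * C := by exact_mod_cast hBC
    set Δ : ℝ := (A - D) ^ 2 + 4 * (B * C) with hΔ
    have hs : Real.sqrt Δ ^ 2 = Δ := Real.sq_sqrt (by positivity)
    have habs : |(A : ℝ) - D| < Real.sqrt Δ := by
      rw [← Real.sqrt_sq_eq_abs]
      exact Real.sqrt_lt_sqrt (by positivity) (by rw [hΔ]; linarith)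
    rw [abs_lt] at habs
    have hB : (B : ℝ) ≠ 0 := by rintro h; simp [h] at hBC'
    rcases lt_or_gt_of_ne hB with hB' | hB'
    · refine ⟨(A - D - Real.sqrt Δ) / (2 * B), div_pos_of_neg_of_neg (by linarith) (by linarith),
      ?_⟩
      field_simp
      nlinarith
    · refine ⟨(A - D + Real.sqrt Δ) / (2 * B), div_pos (by linarith) (by linarith), ?_⟩
      field_simp
      nlinarith

lemma exists_eigen {v : SL2Z} (a : Letter) (hcusp : ∀ c, 0 < quad a (act (toG v) (cusp c)))
    (hpp : ∀ u, 0 < quad a u → 0 < quad a (act (toG v) u)) :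
    Hyperbolic v ∧ ∃ (α : ℝ × ℝ) (l : ℝ), l ≠ 0 ∧ 0 < quad a α ∧ act (toG v) α = l • α := by
  have hd := v.2
  rw [Matrix.det_fin_two] at hd
  have hx := hcusp .x
  have hy := hcusp .y
  have hz := hcusp .z
  simp only [Hyperbolic, Matrix.trace_fin_two]
  simp only [act, toG_val] at hx hy hz hpp ⊢
  generalize (v : Matrix (Fin 2) (Fin 2) ℤ) 0 0 = p at *
  generalize (v : Matrix (Fin 2) (Fin 2) ℤ) 0 1 = q at *
  generalize (v : Matrix (Fin 2) (Fin 2) ℤ) 1 0 = r at *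
  generalize (v : Matrix (Fin 2) (Fin 2) ℤ) 1 1 = s at *
  have hd' : (p : ℝ) * s - q * r = 1 := by exact_mod_cast hd
  have hl : ∀ α₁ α₂ l : ℝ, (α₁ ≠ 0 ∨ α₂ ≠ 0) → p * α₁ + q * α₂ = l * α₁ → r * α₁ + s * α₂ = l * α₂ →
      l ≠ 0 := by
    rintro α₁ α₂ l h h1 h2 rfl
    have e1 : α₁ = 0 := by linear_combination s * h1 - q * h2 - α₁ * hd'
    have e2 : α₂ = 0 := by linear_combination p * h2 - r * h1 - α₂ * hd'
    simp [e1, e2] at h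
  cases a
  · simp only [quad, cusp, mul_one, mul_zero, add_zero, zero_add] at hx hy hz hpp ⊢
    have hy' : 0 < (r + s) * (p + q - (r + s)) := by exact_mod_cast hy
    have hz' : 0 < r * (p - r) := by exact_mod_cast hz
    obtain ⟨h1, t, ht, h2⟩ := hyperbolic_core (A := p - r) (B := r) (C := p + q - r - s)
      (D := r + s) (by linarith) (by linarith) (by linarith) (by
        intro u t hut
        have := hpp (u + t, t) (by simp; linarith)
        push_cast; simp only at this
        linarith)
    push_cast at h2
    refine ⟨by rwa [show p + s = p - r + (r + s) by ring], (t + 1, 1), r * t + (r + s), ?_, ?_, ?_⟩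
    · exact hl (t + 1) 1 _ (by simp) (by linarith) (by linarith)
    · simpa using ht
    · ext <;> (simp; linarith)
  · simp only [quad, cusp, mul_one, mul_zero, add_zero, zero_add] at hx hy hz hpp ⊢
    have hx' : 0 < -(q * s) := by exact_mod_cast hx
    have hz' : 0 < -(p * r) := by exact_mod_cast hz
    obtain ⟨h1, t, ht, h2⟩ := hyperbolic_core (A := s) (B := -q) (C := -r)
      (D := p) (by linarith) (by linarith) (by linarith) (by
        intro u t hut
        have := hpp (-t, u) (by simp; linarith)
        push_cast; simp only at this
        linarith)
    push_cast at h2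
    refine ⟨by rwa [show p + s = s + p by ring], (-1, t), -q * t + p, ?_, ?_, ?_⟩
    · exact hl (-1) t _ (by simp) (by linarith) (by linarith)
    · simpa using ht
    · ext <;> simp <;> linarith
  · simp only [quad, cusp, mul_one, mul_zero, add_zero, zero_add] at hx hy hz hpp ⊢
    have hy' : 0 < (p + q) * (r + s - (p + q)) := by exact_mod_cast hy
    have hx' : 0 < q * (s - q) := by exact_mod_cast hx
    obtain ⟨h1, t, ht, h2⟩ := hyperbolic_core (A := s - q) (B := q) (C := r + s - p - q)
      (D := p + q) (by linarith) (by linarith) (by linarith) (by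
        intro u t hut
        have := hpp (t, u + t) (by simp; linarith)
        push_cast; simp only at this
        linarith)
    push_cast at h2
    refine ⟨by rwa [show p + s = s - q + (p + q) by ring], (1, t + 1), q * t + (p + q), ?_, ?_, ?_⟩
    · exact hl 1 (t + 1) _ (by simp) (by linarith) (by linarith)
    · simpa using ht
    · ext <;> simp <;> linarith

/-- The path `p` follows the geodesic with forward end `α` and backward end `β`. -/
structure Axis (f : ℤ → Letter) (p : ℤ → GL (Fin 2) ℤ) (α β : ℝ × ℝ) : Prop extends Path f p where
  fwd : ∀ k, 0 < quad (f k) (act (p k)⁻¹ α)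
  bwd : ∀ k, 0 < quad (f (k - 1)) (act (p k)⁻¹ β)

lemma act_inv_zpow_eigen {g : GL (Fin 2) ℤ} {α : ℝ × ℝ} {l : ℝ} (hl : l ≠ 0)
    (h : act g α = l • α) (m : ℕ) : ∃ l' : ℝ, l' ≠ 0 ∧ act (g ^ m)⁻¹ α = l' • α := by
  induction m with
  | zero => exact ⟨1, one_ne_zero, by simp [act_one]⟩
  | succ m ih =>
    obtain ⟨l', hl', h'⟩ := ih
    refine ⟨l⁻¹ * l', by positivity, ?_⟩
    have h1 : act g⁻¹ α = l⁻¹ • α := by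
      have : α = l⁻¹ • act g α := by rw [h, smul_smul, inv_mul_cancel₀ hl, one_smul]
      conv_lhs => rw [this, act_smul, act_inv_act]
    rw [pow_succ, mul_inv_rev, act_mul, h', act_smul, h1, smul_smul, mul_comm]

lemma Path.exists_fwd (h : Path f p) (h0 : p 0 = 1) {n : ℕ} (hn0 : 0 < n)
    (hn : ∀ k, f (k + n) = f k) {v : SL2Z} (hv : toG v = p n)
    (hall : ∀ c, ∃ j : ℤ, 0 ≤ j ∧ j < n ∧ f j = c) :
    Hyperbolic v ∧ ∃ α : ℝ × ℝ, IsEigen (toG v) α ∧ ∀ k, 0 < quad (f k) (act (p k)⁻¹ α) := by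
  obtain ⟨h1, α, l, hl, h2, h3⟩ := exists_eigen (v := v) (f 0)
    (fun c => by
      obtain ⟨j, hj0, hjn, hj⟩ := hall c
      rw [hv]
      exact h.quad_cusp_pos h0 hj0 hjn hj)
    (fun u hu => by
      have := h.quad_pos_of_le (u := act (p n) u) (k := n) (by
        rw [act_inv_act, ← zero_add (n : ℤ), hn]; exact hu) n
      rw [sub_self, h0, inv_one, act_one] at this
      rwa [hv])
  refine ⟨h1, α, ?_, fun k => ?_⟩
  · rw [IsEigen, h3, wedge_smul_left]
    simp [wedge]
  · obtain ⟨m, hm⟩ : ∃ m : ℕ, k ≤ m * n := ⟨k.toNat, by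
      have h1 : k ≤ k.toNat := Int.self_le_toNat k
      have h2 : (1 : ℤ) ≤ n := by exact_mod_cast hn0
      nlinarith [Int.natCast_nonneg k.toNat]⟩
    obtain ⟨l', hl', h4⟩ := act_inv_zpow_eigen hl h3 m
    have := h.quad_pos_of_le (u := α) (k := m * n) (by
      have e := h.periodic_zpow h0 hn m 0
      have e2 : ∀ m : ℕ, f (0 + m * n) = f 0 := by
        intro m
        induction m with
        | zero => simp
        | succ m ih => rw [← ih, ← hn (0 + m * n)]; congr 1; push_cast; ring
      rw [zero_add, h0, mul_one] at e
      rw [← zero_add ((m : ℤ) * n), e2, zero_add, e, zpow_natCast, ← hv, h4, quad_smul]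
      positivity) (m * n - k).toNat
    rw [Int.toNat_of_nonneg (by omega)] at this
    simpa using this

lemma Path.exists_axis (h : Path f p) (h0 : p 0 = 1) {n : ℕ} (hn0 : 0 < n)
    (hn : ∀ k, f (k + n) = f k) {v : SL2Z} (hv : toG v = p n)
    (hall : ∀ c, ∃ j : ℤ, 0 ≤ j ∧ j < n ∧ f j = c) :
    Hyperbolic v ∧ ∃ α β : ℝ × ℝ, IsEigen (toG v) α ∧ IsEigen (toG v) β ∧ Axis f p α β := by
  obtain ⟨h1, α, h2, h3⟩ := h.exists_fwd h0 hn0 hn hv hall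
  have hn' : ∀ k, f (-1 - (k + n)) = f (-1 - k) := by
    intro k
    rw [← hn (-1 - (k + n))]
    congr 1
    ring
  obtain ⟨-, β, h4, h5⟩ := h.reverse.exists_fwd (n := n) (v := v⁻¹) (by simpa using h0) hn0 hn'
    (by
      have := h.periodic h0 hn (-n)
      rw [neg_add_cancel, h0] at this
      rw [map_inv, hv]
      exact inv_eq_of_mul_eq_one_right this.symm)
    (fun c => by
      obtain ⟨j, hj0, hjn, hj⟩ := hall c
      refine ⟨n - 1 - j, by omega, by omega, ?_⟩
      rw [← hj, ← hn]
      congr 1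
      ring)
  refine ⟨h1, α, β, h2, ?_, h, h3, fun k => ?_⟩
  · rw [IsEigen, map_inv] at h4
    have := wedge_act (toG v) (act (toG v)⁻¹ β) β
    rw [act_act_inv, h4, mul_zero] at this
    simp only [IsEigen, wedge] at this ⊢
    linarith
  · have := h5 (-k)
    rw [show -1 - -k = k - 1 by ring, neg_neg] at this
    exact this

end

section

variable {f f' : ℤ → Letter} {p q : ℤ → GL (Fin 2) ℤ} {α β α' β' : ℝ × ℝ}

lemma exists_quad_pos (a : Letter) : ∃ v, 0 < quad a v := by
  cases a
  · exact ⟨(2, 1), by norm_num [quad]⟩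
  · exact ⟨(-1, 1), by norm_num [quad]⟩
  · exact ⟨(1, 2), by norm_num [quad]⟩

lemma exists_ne_ne (a b : Letter) : ∃ c, c ≠ a ∧ c ≠ b := by
  revert a b; decide

lemma eq_of_ne {a b c d : Letter} (hab : a ≠ b) (hca : c ≠ a) (hcb : c ≠ b) (hda : d ≠ a)
    (hdb : d ≠ b) : c = d := by
  revert a b c d; decide

lemma Path.quad_pos_of_ne (h : Path f p) {u : ℝ × ℝ} {k : ℤ} {b : Letter} (hb : b ≠ f (k - 1))
    (hk : 0 < quad b (act (p k)⁻¹ u)) {j : ℤ} (hj : j < k) :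
    0 < quad (f j) (act (p j)⁻¹ u) := by
  have h1 : 0 < quad (f (k - 1)) (act (p (k - 1))⁻¹ u) := by
    rw [h.inv_step, sub_add_cancel, act_mul]
    exact quad_refl_pos hb.symm hk
  have := h.quad_pos_of_le h1 (k - 1 - j).toNat
  rw [Int.toNat_of_nonneg (by omega)] at this
  simpa using this

lemma Path.letter_eq (h : Path f p) (h' : Path f' q) {i j : ℤ} {m : ℕ} (hm : 1 ≤ m)
    (h0 : p i = q j) (h1 : p (i + m) = q (j + m)) : f i = f' j := by
  obtain ⟨c, hc, hc'⟩ := exists_ne_ne (f (i + m - 1)) (f' (j + m - 1))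
  obtain ⟨v, hv⟩ := exists_quad_pos c
  have e1 := h.quad_pos_of_ne (u := act (p (i + m)) v) hc (by rwa [act_inv_act]) (j := i)
    (by omega)
  have e2 := h'.quad_pos_of_ne (u := act (p (i + m)) v) hc' (by rwa [h1, act_inv_act]) (j := j)
    (by omega)
  rw [h0] at e1
  exact eq_of_quad_pos e1 e2

lemma Path.injective (h : Path f p) : Function.Injective p := by
  have key : ∀ i k : ℤ, i < k → p i ≠ p k := by
    intro i k hik e
    obtain ⟨c, hc, hc'⟩ := exists_ne_ne (f (k - 1)) (f i)
    obtain ⟨v, hv⟩ := exists_quad_pos c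
    have e1 := h.quad_pos_of_ne (u := act (p k) v) hc (by rwa [act_inv_act]) hik
    rw [e, act_inv_act] at e1
    exact hc' (eq_of_quad_pos hv e1)
  intro i k e
  rcases lt_trichotomy i k with h1 | h1 | h1
  · exact absurd e (key _ _ h1)
  · exact h1
  · exact absurd e.symm (key _ _ h1)

lemma Axis.translate (h : Axis f p α β) (g : GL (Fin 2) ℤ) :
    Axis f (fun k => g * p k) (act g α) (act g β) where
  toPath := h.toPath.translate g
  fwd k := by rw [mul_inv_rev, act_mul, act_inv_act]; exact h.fwd k
  bwd k := by rw [mul_inv_rev, act_mul, act_inv_act]; exact h.bwd k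

lemma Axis.reverse (h : Axis f p α β) :
    Axis (fun k => f (-1 - k)) (fun k => p (-k)) β α where
  toPath := h.toPath.reverse
  fwd k := by
    have := h.bwd (-k)
    rwa [show -k - 1 = -1 - k by ring] at this
  bwd k := by
    have := h.fwd (-k)
    rwa [show -1 - (k - 1) = -k by ring]

lemma Axis.ne (h : Axis f p α β) (k : ℤ) : f (k - 1) ≠ f k := by
  have := h.red (k - 1)
  rwa [sub_add_cancel] at this

lemma dt_inv (g : GL (Fin 2) ℤ) : dt g⁻¹ = dt g := by
  have : dt g * dt g⁻¹ = 1 := by rw [← dt_mul, mul_inv_cancel, dt_one]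
  rcases dt_eq g with h | h <;> rw [h] at this ⊢ <;> linarith

lemma Axis.wedge_ne_zero (h : Axis f p α β) : wedge α β ≠ 0 := by
  have h1 := wedge_ne_zero_of_quad_pos (h.ne 0).symm (h.fwd 0) (h.bwd 0)
  rw [wedge_act] at h1
  exact right_ne_zero_of_mul h1

lemma ne_zero_sq_pos {x : ℝ} (h : x ≠ 0) : 0 < x ^ 2 := by positivity

/-- The side towards which the path turns at a vertex. -/
def side (f : ℤ → Letter) (p : ℤ → GL (Fin 2) ℤ) (k : ℤ) : ℝ := dt (p k) * sgn (f (k - 1)) (f k)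

lemma Axis.crossSign_side (h : Axis f p α β) (h' : Axis f' q α' β') {i j : ℤ} {m : ℕ}
    (hm : 1 ≤ m) (h0 : p i = q j) (hstart : f (i - 1) ≠ f' (j - 1))
    (hmid : ∀ k : ℕ, k < m → f (i + k) = f' (j + k)) (hend : f (i + m) ≠ f' (j + m)) :
    0 < side f p i * side f p (i + m) * crossSign α β α' β' := by
  have hp : ∀ k : ℕ, k ≤ m → p (i + k) = q (j + k) := by
    intro k hk
    induction k with
    | zero => simpa using h0
    | succ k ih =>
      push_cast
      rw [← add_assoc, ← add_assoc, h.step, h'.step, ih (by omega), hmid k (by omega)]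
  have hi : f i = f' j := by simpa using hmid 0 (by omega)
  have hl : f (i + m - 1) = f' (j + m - 1) := by
    have := hmid (m - 1) (by omega)
    rw [Nat.cast_sub hm, Nat.cast_one] at this
    rwa [add_sub_assoc, add_sub_assoc]
  have b1 := h'.bwd j
  rw [← h0] at b1
  have a1 := h'.fwd (j + m)
  rw [← hp m le_rfl] at a1
  have s1 := orient_mul_sgn_neg hstart (hi ▸ h'.ne j) (h.ne i) (h.bwd i) b1 (h.fwd i)
  have s2 := orient_mul_sgn_neg hend (hl ▸ (h'.ne (j + m)).symm) (h.ne (i + m)).symm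
    (h.fwd (i + m)) a1 (h.bwd (i + m))
  rw [orient_act, dt_inv] at s1 s2
  rw [sgn_swap (h.ne (i + m)).symm] at s2
  have key := orient_mul_orient α β α' β'
  have hw := ne_zero_sq_pos h.wedge_ne_zero
  have := mul_pos_of_neg_of_neg s1 s2
  have e : dt (p i) * orient β β' α * sgn (f (i - 1)) (f i) * (dt (p (i + m)) * orient α α' β *
      -sgn (f (i + m - 1)) (f (i + m))) =
      (side f p i * side f p (i + m) * crossSign α β α' β') * (wedge α β) ^ 2 := by
    simp only [side]
    linear_combination (-dt (p i) * sgn (f (i - 1)) (f i) * dt (p (i + m)) *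
      sgn (f (i + m - 1)) (f (i + m))) * key
  rw [e] at this
  exact pos_of_mul_pos_left this hw.le

/-- The product of the reflections spelled by a word. -/
def prodRefl (u : List Letter) : GL (Fin 2) ℤ := (u.map refl).prod

lemma prodRefl_quad_pos {u : List Letter} {b : Letter} {v : ℝ × ℝ} (hu : (u ++ [b]).IsChain (· ≠ ·))
    (hv : 0 < quad b v) : 0 < quad ((u ++ [b]).head (by simp)) (act (prodRefl u) v) := by
  induction u with
  | nil => simpa [prodRefl, act_one] using hv
  | cons a u ih =>
    simp only [prodRefl, List.map_cons, List.prod_cons, act_mul]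
    rw [List.cons_append, List.isChain_cons] at hu
    have := ih hu.2
    simp only [List.cons_append, List.head_cons]
    refine quad_refl_pos (hu.1 _ ?_) this
    exact List.head_mem_head? _

lemma exists_reduced (u : List Letter) : ∃ u' : List Letter, u'.IsChain (· ≠ ·) ∧
    prodRefl u' = prodRefl u := by
  induction u with
  | nil => exact ⟨[], List.isChain_nil, rfl⟩
  | cons a u ih =>
    obtain ⟨u', h1, h2⟩ := ih
    by_cases h : u'.head? = some a
    · obtain ⟨t, rfl⟩ := List.head?_eq_some_iff.1 h
      refine ⟨t, h1.tail, ?_⟩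
      have e : prodRefl (a :: u) = refl a * prodRefl u := by simp [prodRefl]
      rw [e, ← h2]
      simp [prodRefl, ← mul_assoc, refl_mul_self]
    · refine ⟨a :: u', ?_, ?_⟩
      · rw [List.isChain_cons]
        refine ⟨?_, h1⟩
        rintro d hd rfl
        exact h hd
      · have e : prodRefl (a :: u) = refl a * prodRefl u := by simp [prodRefl]
        rw [e, ← h2]
        simp [prodRefl]

lemma toG_Amat : toG Amat = refl .x * refl .y := by
  ext i j
  rw [toG_val]
  fin_cases i <;> fin_cases j <;> simp [Amat, refl]

lemma toG_Bmat : toG Bmat = refl .y * refl .z := by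
  ext i j
  rw [toG_val]
  fin_cases i <;> fin_cases j <;> simp [Bmat, refl]

lemma toG_Cmat : toG Cmat = refl .z * refl .x := by
  rw [Cmat, map_inv, map_mul, toG_Amat, toG_Bmat]
  simp only [mul_inv_rev, refl_inv, mul_assoc]
  rw [← mul_assoc (refl .y), refl_mul_self, one_mul]

lemma toG_pairM (a b : Letter) : toG (pairM a b) = refl a * refl b := by
  cases a <;> cases b <;> simp only [pairM, map_one, refl_mul_self, map_inv, toG_Amat, toG_Bmat,
    toG_Cmat, mul_inv_rev, refl_inv]

lemma exists_prodRefl {g : SL2Z} (hg : g ∈ Gamma) : ∃ u, toG g = prodRefl u := by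
  have hrev : ∀ u : List Letter, (prodRefl u)⁻¹ = prodRefl u.reverse := by
    intro u
    induction u with
    | nil => simp [prodRefl]
    | cons a u ih =>
      simp only [prodRefl, List.map_cons, List.prod_cons, mul_inv_rev,
        List.reverse_cons, refl_inv] at ih ⊢
      rw [ih]
      simp
  induction hg using Subgroup.closure_induction with
  | mem g hg =>
    rcases hg with rfl | rfl
    · exact ⟨[.x, .y], by simp [toG_Amat, prodRefl]⟩
    · exact ⟨[.y, .z], by simp [toG_Bmat, prodRefl]⟩
  | one => exact ⟨[], by simp [prodRefl]⟩
  | mul g h _ _ ihg ihh =>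
    obtain ⟨u, hu⟩ := ihg
    obtain ⟨v, hv⟩ := ihh
    exact ⟨u ++ v, by rw [map_mul, hu, hv]; simp [prodRefl]⟩
  | inv g _ ih =>
    obtain ⟨u, hu⟩ := ih
    exact ⟨u.reverse, by rw [map_inv, hu, hrev]⟩

lemma Axis.crossSign_pos_of_disjoint (h : Axis f p α β) (h' : Axis f' q α' β')
    (hdis : ∀ i j, p i ≠ q j) (l : ℕ) : ∀ (u : List Letter) (i j : ℤ), u.length = l →
    u.IsChain (· ≠ ·) → p i * prodRefl u = q j → 0 < crossSign α β α' β' := by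
  have hcons : ∀ a u, prodRefl (a :: u) = refl a * prodRefl u := by
    intro a u; simp [prodRefl]
  have happ : ∀ u a, prodRefl (u ++ [a]) = prodRefl u * refl a := by
    intro a u; simp [prodRefl]
  induction l with
  | zero =>
    intro u i j hl _ he
    rw [List.length_eq_zero_iff.1 hl] at he
    exact absurd (by simpa [prodRefl] using he) (hdis i j)
  | succ l ih =>
    intro u i j hl hu he
    obtain ⟨a, t, rfl⟩ : ∃ a t, u = a :: t := List.exists_cons_of_length_eq_add_one hl
    by_cases ha : a = f i
    · refine ih t (i + 1) j (by simpa using hl) hu.tail ?_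
      rw [h.step, mul_assoc, ← ha, ← hcons, he]
    by_cases ha' : a = f (i - 1)
    · refine ih t (i - 1) j (by simpa using hl) hu.tail ?_
      have := h.step' (i - 1)
      rw [sub_add_cancel] at this
      rw [this, mul_assoc, ← ha', ← hcons, he]
    obtain ⟨t', b, htb⟩ : ∃ t' b, a :: t = t' ++ [b] :=
      ⟨_, _, (List.dropLast_append_getLast (List.cons_ne_nil a t)).symm⟩
    have hl' : t'.length = l := by
      have := congrArg List.length htb
      rw [hl] at this
      simpa using this.symm
    have hu' : t'.IsChain (· ≠ ·) := by
      rw [htb] at hu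
      exact hu.left_of_append
    have he' : p i * prodRefl t' = q j * refl b := by
      rw [← he, htb, happ, mul_assoc, mul_assoc, refl_mul_self, mul_one]
    by_cases hb : b = f' j
    · exact ih t' i (j + 1) hl' hu' (by rw [he', hb, h'.step])
    by_cases hb' : b = f' (j - 1)
    · refine ih t' i (j - 1) hl' hu' ?_
      have := h'.step' (j - 1)
      rw [sub_add_cancel] at this
      rw [he', hb', this]
    have key : ∀ c v, b ≠ c → 0 < quad c (act (q j)⁻¹ v) → 0 < quad a (act (p i)⁻¹ v) := by
      intro c v hbc hv
      have hch : (a :: t ++ [c]).IsChain (· ≠ ·) := by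
        rw [List.isChain_append]
        refine ⟨hu, by simp, ?_⟩
        intro d hd e he
        rw [htb] at hd
        simp at hd he
        rw [← hd, ← he]
        exact hbc
      have := prodRefl_quad_pos hch hv
      rw [← act_mul] at this
      have e : (p i)⁻¹ = prodRefl (a :: t) * (q j)⁻¹ := by rw [← he]; group
      rw [e]
      simpa using this
    rw [← crossSign_act (p i)⁻¹]
    exact crossSign_pos_of_arc ha ha' (key _ _ hb (h'.fwd j)) (key _ _ hb' (h'.bwd j)) (h.fwd i)
      (h.bwd i)

lemma Axis.crossSign_pos (h : Axis f p α β) (h' : Axis f' q α' β')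
    (hdis : ∀ i j, p i ≠ q j) {g : SL2Z} (hg : g ∈ Gamma) (he : p 0 * toG g = q 0) :
    0 < crossSign α β α' β' := by
  obtain ⟨u, hu⟩ := exists_prodRefl hg
  obtain ⟨u', h1, h2⟩ := exists_reduced u
  exact h.crossSign_pos_of_disjoint h' hdis _ u' 0 0 rfl h1 (by rw [h2, ← hu, he])

end

section

/-- The sequence of letters together with the parity of the position. -/
def dirSeq (f : ℤ → Letter) (k : ℤ) : Letter × Bool := (f k, decide (Even k))

/-- Whether a path turns left or right between two consecutive directed edges. -/
def turn (e e' : Letter × Bool) : Bool := xor e'.2 (decide (nxt e.1 = e'.1))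

/-- Two sequences of directed edges start to agree at the positions `i` and `j`, and leave each
other on the other side. -/
def Cross (d₁ d₂ : ℤ → Letter × Bool) (i j : ℤ) : Prop :=
  d₁ i = d₂ j ∧ d₁ (i - 1) ≠ d₂ (j - 1) ∧ ∃ m : ℕ, 1 ≤ m ∧
    (∀ k : ℕ, k < m → d₁ (i + k) = d₂ (j + k)) ∧ d₁ (i + m) ≠ d₂ (j + m) ∧
    turn (d₁ (i - 1)) (d₁ i) ≠ turn (d₁ (i + m - 1)) (d₁ (i + m))

/-- A sequence of letters, read forwards or backwards. -/
def flipL (f : ℤ → Letter) (ε : Bool) (k : ℤ) : Letter := cond ε (f k) (f (-1 - k))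

/-- A path, followed forwards or backwards. -/
def flipP (p : ℤ → GL (Fin 2) ℤ) (ε : Bool) (k : ℤ) : GL (Fin 2) ℤ := p (cond ε k (-k))

variable {f f' : ℤ → Letter} {p q : ℤ → GL (Fin 2) ℤ} {α β α' β' : ℝ × ℝ}

lemma Axis.flip (h : Axis f p α β) (ε : Bool) :
    Axis (flipL f ε) (flipP p ε) (cond ε α β) (cond ε β α) := by
  cases ε
  · exact h.reverse
  · exact h

lemma Path.dt_eq (h : Path f p) (h0 : p 0 = 1) (k : ℤ) : dt (p k) = if Even k then 1 else -1 := by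
  induction k using Int.inductionOn' (b := 0) with
  | zero => simp [h0, dt_one]
  | succ k _ ih =>
    rw [h.step, dt_mul, ih, dt_refl]
    by_cases hk : Even k <;> simp [hk, parity_simps]
  | pred k _ ih =>
    have := h.step' (k - 1)
    rw [sub_add_cancel] at this
    rw [this, dt_mul, ih, dt_refl]
    by_cases hk : Even k <;> simp [hk, parity_simps]

lemma Path.side_eq (h : Path f p) (h0 : p 0 = 1) (k : ℤ) :
    side f p k = if turn (dirSeq f (k - 1)) (dirSeq f k) then -1 else 1 := by
  simp only [side, h.dt_eq h0, turn, dirSeq, sgn]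
  by_cases h1 : Even k <;> by_cases h2 : nxt (f (k - 1)) = f k <;> simp [h1, h2]

lemma exists_maximal_overlap {i j : ℤ} (h : f i = f' j) :
    (∀ k : ℕ, f (i + k) = f' (j + k)) ∨ (∀ k : ℕ, f (i - k) = f' (j - k)) ∨
    ∃ s m : ℕ, 1 ≤ m ∧ (∀ k : ℕ, k ≤ s → f (i - k) = f' (j - k)) ∧
      f (i - s - 1) ≠ f' (j - s - 1) ∧
      (∀ k : ℕ, k < m → f (i - s + k) = f' (j - s + k)) ∧ f (i - s + m) ≠ f' (j - s + m) := by
  by_cases h1 : ∀ k : ℕ, f (i + k) = f' (j + k)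
  · exact Or.inl h1
  by_cases h2 : ∀ k : ℕ, f (i - k) = f' (j - k)
  · exact Or.inr (Or.inl h2)
  right; right
  push Not at h1 h2
  have a1 := Nat.find_spec h1
  have a2 := fun k => Nat.find_min h1 (m := k)
  have b1 := Nat.find_spec h2
  have b2 := fun k => Nat.find_min h2 (m := k)
  set a := Nat.find h1
  set b := Nat.find h2
  have hb : b ≠ 0 := by
    intro hb
    rw [hb] at b1
    simp at b1
    exact b1 h
  obtain ⟨s, hs⟩ := Nat.exists_eq_succ_of_ne_zero hb
  have ha : a ≠ 0 := by
    intro ha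
    rw [ha] at a1
    simp at a1
    exact a1 h
  refine ⟨s, a + s, by omega, ?_, ?_, ?_, ?_⟩
  · intro k hk
    simpa using b2 k (by omega)
  · rw [hs] at b1
    push_cast at b1
    rwa [← sub_sub, ← sub_sub] at b1
  · intro k hk
    rcases le_or_gt s k with h3 | h3
    · have := a2 (k - s) (by omega)
      rw [Nat.cast_sub h3] at this
      push Not at this
      convert this using 2 <;> ring
    · have := b2 (s - k) (by omega)
      rw [Nat.cast_sub h3.le] at this
      push Not at this
      convert this using 2 <;> ring
  · convert a1 using 2 <;> push_cast <;> ring_nf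

lemma Path.agree_pred (h : Path f p) (h' : Path f' q) {i j : ℤ} (h0 : p i = q j) {s : ℕ}
    (hs : ∀ k : ℕ, 1 ≤ k → k ≤ s → f (i - k) = f' (j - k)) : p (i - s) = q (j - s) := by
  induction s with
  | zero => simpa using h0
  | succ s ih =>
    have e1 := h.step' (i - (s + 1 : ℕ))
    have e2 := h'.step' (j - (s + 1 : ℕ))
    rw [e1, e2, hs (s + 1) (by omega) le_rfl]
    have := ih (fun k hk hk' => hs k hk (by omega))
    push_cast
    rw [show i - (s + 1 : ℤ) + 1 = i - s by ring, show j - (s + 1 : ℤ) + 1 = j - s by ring, this]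

lemma Path.agree_succ (h : Path f p) (h' : Path f' q) {i j : ℤ} (h0 : p i = q j) {s : ℕ}
    (hs : ∀ k : ℕ, k < s → f (i + k) = f' (j + k)) : p (i + s) = q (j + s) := by
  induction s with
  | zero => simpa using h0
  | succ s ih =>
    push_cast
    rw [← add_assoc, ← add_assoc, h.step, h'.step, ih (fun k hk => hs k (by omega)),
      hs s (by omega)]

lemma eigen_snd_ne_zero {g : SL2Z} (hg : Hyperbolic g) {u : ℝ × ℝ} (hu : IsEigen (toG g) u)
    (h0 : u ≠ 0) : u.2 ≠ 0 := by
  intro h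
  have hc : ((g : Matrix (Fin 2) (Fin 2) ℤ) 1 0 : ℝ) ≠ 0 := hyperbolic_entry_ne_zero hg
  simp only [IsEigen, act, wedge, toG_val, h, mul_zero, add_zero, zero_sub, neg_eq_zero,
    mul_eq_zero, hc, false_or] at hu
  exact h0 (Prod.ext (by simpa using hu) h)

lemma linked_fixedSet_iff {g g' : SL2Z} (hg : Hyperbolic g) (hg' : Hyperbolic g')
    {u v u' v' : ℝ × ℝ} (hu : IsEigen (toG g) u) (hv : IsEigen (toG g) v)
    (hu' : IsEigen (toG g') u') (hv' : IsEigen (toG g') v') (huv : wedge u v ≠ 0)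
    (huv' : wedge u' v' ≠ 0) :
    (crossSign u v u' v' ≠ 0 →
      (Linked (fixedSet g) (fixedSet g') ↔ crossSign u v u' v' < 0)) ∧
    (fixedSet g = fixedSet g' → crossSign u v u' v' = 0) := by
  have nz : ∀ {u v : ℝ × ℝ}, wedge u v ≠ 0 → u ≠ 0 ∧ v ≠ 0 := by
    intro u v h
    constructor <;> rintro rfl <;> simp [wedge] at h
  have s1 := eigen_snd_ne_zero hg hu (nz huv).1
  have s2 := eigen_snd_ne_zero hg hv (nz huv).2
  have s3 := eigen_snd_ne_zero hg' hu' (nz huv').1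
  have s4 := eigen_snd_ne_zero hg' hv' (nz huv').2
  rw [fixedSet_eq hg s1 s2 huv hu hv, fixedSet_eq hg' s3 s4 huv' hu' hv']
  refine ⟨linked_iff_crossSign s1 s2 s3 s4 huv huv', fun h => ?_⟩
  have h3 : ((u'.1 / u'.2 : ℝ) : OnePoint ℝ) ∈
    ({((u.1 / u.2 : ℝ) : OnePoint ℝ), ((v.1 / v.2 : ℝ) : OnePoint ℝ)} : Set _) := by
    rw [h]; simp
  simp only [Set.mem_insert_iff, OnePoint.coe_eq_coe, Set.mem_singleton_iff] at h3
  rcases h3 with h3 | h3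
  · rw [div_eq_div_iff s3 s1] at h3
    have : wedge u u' = 0 := by simp only [wedge]; linarith
    simp [crossSign, this]
  · rw [div_eq_div_iff s3 s2] at h3
    have : wedge v u' = 0 := by simp only [wedge]; linarith
    simp [crossSign, this]

/-- A periodic axis of a hyperbolic element of `Γ`. -/
structure PeriodicAxis (f : ℤ → Letter) (p : ℤ → GL (Fin 2) ℤ) (α β : ℝ × ℝ) (n : ℕ)
    (v : Gamma) : Prop extends Axis f p α β where
  zero : p 0 = 1
  pos : 0 < n
  even : Even (n : ℤ)
  per : ∀ k, f (k + n) = f k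
  hv : toG v = p n
  hyp : Hyperbolic (v : SL2Z)
  eigα : IsEigen (toG v) α
  eigβ : IsEigen (toG v) β

variable {n : ℕ} {v : Gamma}

lemma IsEigen.conj {g h : GL (Fin 2) ℤ} {u : ℝ × ℝ} (hu : IsEigen g u) :
    IsEigen (h * g * h⁻¹) (act h u) := by
  rw [IsEigen, act_mul, act_inv_act, act_mul, wedge_act, hu, mul_zero]

lemma hyperbolic_conj {g : SL2Z} (hg : Hyperbolic g) (h : SL2Z) : Hyperbolic (h * g * h⁻¹) := by
  rw [Hyperbolic] at hg ⊢
  rwa [Matrix.SpecialLinearGroup.coe_mul, Matrix.trace_mul_comm,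
    ← Matrix.SpecialLinearGroup.coe_mul, inv_mul_cancel_left]

lemma hyperbolic_inv {g : SL2Z} (hg : Hyperbolic g) : Hyperbolic g⁻¹ := by
  rw [Hyperbolic, Matrix.trace_fin_two] at hg ⊢
  rw [Matrix.SpecialLinearGroup.coe_inv, Matrix.adjugate_fin_two]
  simpa [add_comm] using hg

lemma IsEigen.inv {g : GL (Fin 2) ℤ} {u : ℝ × ℝ} (hu : IsEigen g u) : IsEigen g⁻¹ u := by
  rw [IsEigen] at hu ⊢
  have := wedge_act g (act g⁻¹ u) u
  rw [act_act_inv] at this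
  have h2 : wedge u (act g u) = 0 := by
    simp only [wedge] at hu ⊢; linarith
  rw [h2] at this
  rcases dt_eq g with h | h <;> rw [h] at this <;> linarith

lemma fixedSet_inv {g : SL2Z} (hg : Hyperbolic g) {u v : ℝ × ℝ} (huv : wedge u v ≠ 0)
    (hu : IsEigen (toG g) u) (hv : IsEigen (toG g) v) : fixedSet g⁻¹ = fixedSet g := by
  have s1 := eigen_snd_ne_zero hg hu (by rintro rfl; simp [wedge] at huv)
  have s2 := eigen_snd_ne_zero hg hv (by rintro rfl; simp [wedge] at huv)
  rw [fixedSet_eq hg s1 s2 huv hu hv, fixedSet_eq (hyperbolic_inv hg) s1 s2 huv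
    (by rw [map_inv]; exact hu.inv) (by rw [map_inv]; exact hv.inv)]

lemma PeriodicAxis.flip_per (h : PeriodicAxis f p α β n v) (ε : Bool) (k : ℤ) :
    flipL f ε (k + n) = flipL f ε k := by
  cases ε
  · simp only [flipL, cond_false]
    rw [← h.per (-1 - (k + n))]
    congr 1; ring
  · exact h.per k

lemma PeriodicAxis.flip_add (h : PeriodicAxis f p α β n v) (ε : Bool) (m k : ℤ) :
    flipP p ε (k + m * n) = toG v ^ (cond ε m (-m)) * flipP p ε k := by
  cases ε
  · simp only [flipP, cond_false]
    rw [show -(k + m * n) = -k + (-m) * n by ring, h.periodic_zpow h.zero h.per, h.hv]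
  · simp only [flipP, cond_true]
    rw [h.periodic_zpow h.zero h.per, h.hv]

lemma PeriodicAxis.add (h : PeriodicAxis f p α β n v) (m k : ℤ) :
    p (k + m * n) = toG v ^ m * p k := h.flip_add true m k

lemma PeriodicAxis.flip_dirSeq_per (h : PeriodicAxis f p α β n v) (ε : Bool) (m k : ℤ) :
    dirSeq (flipL f ε) (k + m * n) = dirSeq (flipL f ε) k := by
  have h1 : flipL f ε (k + m * n) = flipL f ε k := by
    induction m using Int.inductionOn' (b := 0) with
    | zero => simp
    | succ m _ ih => rw [← ih, ← h.flip_per ε (k + m * n)]; congr 1; ring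
    | pred m _ ih => rw [← ih, ← h.flip_per ε (k + (m - 1) * n)]; congr 1; ring
  have h2 : Even (k + m * n) ↔ Even k := by
    rw [Int.even_add]
    simp [h.even.mul_left m]
  simp [dirSeq, h1, h2]

lemma PeriodicAxis.parity (h : PeriodicAxis f p α β n v) {g : SL2Z} {ε : Bool} {i j : ℤ}
    (hij : p i = toG g * flipP p ε j) : Even i ↔ Even j := by
  have := congrArg dt hij
  rw [dt_mul, dt_toG, one_mul, flipP, h.toPath.dt_eq h.zero, h.toPath.dt_eq h.zero] at this
  have e : Even (cond ε j (-j)) ↔ Even j := by cases ε <;> simp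
  by_cases h1 : Even i <;> by_cases h2 : Even j <;>
    simp only [h1, h2, e, if_true, if_false] at this ⊢
  · norm_num at this
  · norm_num at this

lemma PeriodicAxis.dirSeq_eq_iff (h : PeriodicAxis f p α β n v) {g : SL2Z} {ε : Bool} {i j : ℤ}
    (hij : p i = toG g * flipP p ε j) (k : ℤ) :
    dirSeq f (i + k) = dirSeq (flipL f ε) (j + k) ↔ f (i + k) = flipL f ε (j + k) := by
  have := h.parity hij
  simp [dirSeq, Int.even_add, this]

lemma PeriodicAxis.cross_iff (h : PeriodicAxis f p α β n v) {g : SL2Z} {ε : Bool} {i j : ℤ}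
    (hij : p i = toG g * flipP p ε j) : Cross (dirSeq f) (dirSeq (flipL f ε)) i j ↔
    f (i - 1) ≠ flipL f ε (j - 1) ∧ ∃ m : ℕ, 1 ≤ m ∧
      (∀ k : ℕ, k < m → f (i + k) = flipL f ε (j + k)) ∧ f (i + m) ≠ flipL f ε (j + m) ∧
      side f p i ≠ side f p (i + m) := by
  have e := h.dirSeq_eq_iff hij
  have e1 := e (-1)
  simp only [← sub_eq_add_neg] at e1
  simp only [Cross, ne_eq, e, e1, h.toPath.side_eq h.zero]
  have hs : ∀ a b : Bool, ((if a then (-1 : ℝ) else 1) = if b then -1 else 1) ↔ a = b := by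
    intro a b; cases a <;> cases b <;> norm_num
  constructor
  · rintro ⟨h1, h2, m, h3, h4, h5, h6⟩
    refine ⟨h2, m, h3, h4, h5, ?_⟩
    rwa [hs]
  · rintro ⟨h2, m, h3, h4, h5, h6⟩
    rw [hs] at h6
    exact ⟨by simpa using (e 0).2 (by simpa using h4 0 (by omega)), h2, m, h3, h4, h5, h6⟩

lemma PeriodicAxis.flip_translate (h : PeriodicAxis f p α β n v) (ε : Bool) (g : GL (Fin 2) ℤ) :
    Axis (flipL f ε) (fun k => g * flipP p ε k) (act g (cond ε α β)) (act g (cond ε β α)) :=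
  (h.toAxis.flip ε).translate g

lemma crossSign_cond (ε : Bool) (g : GL (Fin 2) ℤ) :
    crossSign α β (act g (cond ε α' β')) (act g (cond ε β' α')) =
      crossSign α β (act g α') (act g β') := by
  cases ε
  · exact crossSign_swap _ _ _ _
  · rfl

lemma side_sq (f : ℤ → Letter) (p : ℤ → GL (Fin 2) ℤ) (k : ℤ) : side f p k = 1 ∨ side f p k = -1
  := by
  unfold side sgn
  rcases dt_eq (p k) with h | h <;> rw [h] <;> split_ifs <;> simp

lemma PeriodicAxis.goodConj_iff (h : PeriodicAxis f p α β n v) (g : Gamma) :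
    GoodConj v g ↔ ∃ (ε : Bool) (i j : ℤ), p i = toG g * flipP p ε j ∧
      Cross (dirSeq f) (dirSeq (flipL f ε)) i j := by
  have hyp' : Hyperbolic ((g * v * g⁻¹ : Gamma) : SL2Z) := hyperbolic_conj h.hyp g
  have hw := h.wedge_ne_zero
  have hw' : wedge (act (toG g) α) (act (toG g) β) ≠ 0 := by
    rw [wedge_act, dt_toG, one_mul]; exact hw
  have ea : IsEigen (toG ((g * v * g⁻¹ : Gamma) : SL2Z)) (act (toG g) α) := by
    have := h.eigα.conj (h := toG g)
    simpa using this
  have eb : IsEigen (toG ((g * v * g⁻¹ : Gamma) : SL2Z)) (act (toG g) β) := by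
    have := h.eigβ.conj (h := toG g)
    simpa using this
  obtain ⟨hl, hfix⟩ := linked_fixedSet_iff h.hyp hyp' h.eigα h.eigβ ea eb hw hw'
  have hgood : GoodConj v g ↔
      Linked (fixedSet (v : SL2Z)) (fixedSet ((g * v * g⁻¹ : Gamma) : SL2Z)) :=
    ⟨fun h => h.2.2, fun h' => ⟨h.hyp, hyp', h'⟩⟩
  rw [hgood]
  constructor
  · intro hL
    have hne : ∃ i j, p i = toG g * p j := by
      by_contra hdis
      push Not at hdis
      have := h.toAxis.crossSign_pos (h.toAxis.translate (toG g)) hdis g.2 (by simp [h.zero])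
      exact absurd ((hl this.ne').1 hL) this.not_gt
    obtain ⟨ε, i, j, hij, hedge⟩ : ∃ (ε : Bool) (i j : ℤ), p i = toG g * flipP p ε j ∧
        f i = flipL f ε j := by
      obtain ⟨i, j, hij⟩ := hne
      have h1 := h.ne i
      have h2 := h.ne j
      by_cases c1 : f i = f j
      · exact ⟨true, i, j, hij, c1⟩
      by_cases c2 : f i = f (j - 1)
      · refine ⟨false, i, -j, by simpa [flipP] using hij, ?_⟩
        simp only [flipL, cond_false]
        rw [c2]; congr 1; ring
      by_cases c3 : f (i - 1) = f j
      · refine ⟨false, i - 1, -1 - j, ?_, ?_⟩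
        · have e1 := h.step' (i - 1)
          have e2 := h.step j
          rw [sub_add_cancel] at e1
          simp only [flipP, cond_false]
          rw [show -(-1 - j) = j + 1 by ring, e1, e2, hij, c3, mul_assoc]
        · simp only [flipL, cond_false]
          rw [c3]; congr 1; ring
      by_cases c4 : f (i - 1) = f (j - 1)
      · refine ⟨true, i - 1, j - 1, ?_, c4⟩
        have e1 := h.step' (i - 1)
        have e2 := h.step' (j - 1)
        rw [sub_add_cancel] at e1 e2
        simp only [flipP, cond_true]
        rw [e1, e2, hij, c4, mul_assoc]
      · exact absurd (eq_of_ne h2 c4 c3 (Ne.symm (Ne.symm c2)) c1) h1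
    have hq := h.flip_translate ε (toG g)
    have hunb : ∀ s : ℤ, p (i + s) = toG g * flipP p ε (j + s) → p (i + s + n) =
        toG g * flipP p ε (j + s + n) → False := by
      intro s hs hs'
      have e1 := h.add 1 (i + s)
      have e2 := h.flip_add ε 1 (j + s)
      rw [one_mul] at e1 e2
      rw [hs', e2, ← mul_assoc, hs, ← mul_assoc, mul_left_inj, zpow_one] at e1
      have e3 : ((g * v * g⁻¹ : Gamma) : SL2Z) = (v : SL2Z) ∨
          ((g * v * g⁻¹ : Gamma) : SL2Z) = (v : SL2Z)⁻¹ := by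
        cases ε
        · right
          apply toG_injective
          simp only [cond_false, zpow_neg, zpow_one] at e1
          simp only [Subgroup.coe_mul, InvMemClass.coe_inv, map_mul, map_inv]
          rw [eq_comm, inv_eq_iff_eq_inv, mul_inv_rev, mul_inv_rev, inv_inv, ← mul_assoc, e1,
            mul_inv_cancel_right]
        · left
          apply toG_injective
          simp only [cond_true, zpow_one] at e1
          simp only [Subgroup.coe_mul, InvMemClass.coe_inv, map_mul, map_inv]
          rw [e1, mul_inv_cancel_right]
      rcases e3 with e3 | e3 <;> rw [e3] at hL
      · exact not_linked_self _ hL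
      · rw [fixedSet_inv h.hyp hw h.eigα h.eigβ] at hL
        exact not_linked_self _ hL
    rcases exists_maximal_overlap hedge with hu | hu | ⟨s, m, hm, hs, h1, h2, h3⟩
    · refine (hunb 0 (by simpa using hij) ?_).elim
      have := h.toPath.agree_succ hq.toPath hij (s := n) (fun k _ => hu k)
      simpa using this
    · refine (hunb (-n) ?_ (by simpa using hij)).elim
      have := h.toPath.agree_pred hq.toPath hij (s := n) (fun k _ _ => hu k)
      simpa [sub_eq_add_neg] using this
    · have hp := h.toPath.agree_pred hq.toPath hij (fun k _ hk => hs k hk)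
      refine ⟨ε, i - s, j - s, hp, ?_⟩
      rw [h.cross_iff hp]
      refine ⟨h1, m, hm, h2, h3, fun he => ?_⟩
      have hc := h.toAxis.crossSign_side hq hm hp h1 h2 h3
      rw [crossSign_cond, ← he] at hc
      have hc' : 0 < crossSign α β (act (toG g) α) (act (toG g) β) := by
        rcases side_sq f p (i - s) with h | h <;> rw [h] at hc <;> linarith
      exact absurd ((hl hc'.ne').1 hL) hc'.not_gt
  · rintro ⟨ε, i, j, hij, hc⟩
    rw [h.cross_iff hij] at hc
    obtain ⟨h1, m, hm, h2, h3, h4⟩ := hc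
    have hc := h.toAxis.crossSign_side (h.flip_translate ε (toG g)) hm hij h1 h2 h3
    rw [crossSign_cond] at hc
    have hc' : crossSign α β (act (toG g) α) (act (toG g) β) < 0 := by
      rcases side_sq f p i with h5 | h5 <;> rcases side_sq f p (i + m) with h6 | h6 <;>
        rw [h5, h6] at hc h4 <;> first | exact absurd rfl h4 | linarith
    exact (hl hc'.ne).2 hc'

end

section

variable {f f' f₁ f₂ : ℤ → Letter} {p q q₁ q₂ : ℤ → GL (Fin 2) ℤ} {α β α₁ β₁ α₂ β₂ : ℝ × ℝ}
  {n : ℕ} {v : Gamma}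

lemma Axis.not_lt_of_start (h : Axis f p α β) (h₁ : Axis f₁ q₁ α₁ β₁) (h₂ : Axis f₂ q₂ α₂ β₂)
    {i j i' j' : ℤ} (e₁ : p i = q₁ j) (l₁ : f i = f₁ j)
    (e₂ : p i' = q₂ j') (l₂ : f i' = f₂ j') (s₂ : f (i' - 1) ≠ f₂ (j' - 1))
    (hβ : β₁ = α₂ ∨ β₁ = β₂) : ¬ i < i' := by
  intro hlt
  have b1 := h₁.bwd j
  rw [← e₁] at b1
  have key : 0 < quad (f i) (act (p i)⁻¹ β₁) := by
    rcases hβ with rfl | rfl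
    · have := h₂.fwd j'
      rw [← e₂, ← l₂] at this
      exact h.toPath.quad_pos_of_ne (h.ne i').symm this hlt
    · have := h₂.bwd j'
      rw [← e₂] at this
      exact h.toPath.quad_pos_of_ne s₂.symm this hlt
  exact h₁.ne j (l₁ ▸ eq_of_quad_pos b1 key)

lemma Cross.fst_eq {i j : ℤ} (h : Cross (dirSeq f) (dirSeq f') i j) : f i = f' j :=
  congrArg Prod.fst h.1

lemma Cross.parity {i j : ℤ} (h : Cross (dirSeq f) (dirSeq f') i j) : Even i ↔ Even j := by
  simpa [dirSeq] using congrArg Prod.snd h.1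

lemma Cross.pred_ne {i j : ℤ} (h : Cross (dirSeq f) (dirSeq f') i j) : f (i - 1) ≠ f' (j - 1) := by
  intro h'
  refine h.2.1 (Prod.ext h' ?_)
  simp only [dirSeq, Int.even_sub_one, h.parity]

lemma PeriodicAxis.cross_unique (h : PeriodicAxis f p α β n v) {g : GL (Fin 2) ℤ} {ε ε' : Bool}
    {i j i' j' : ℤ} (e : p i = g * flipP p ε j) (c : Cross (dirSeq f) (dirSeq (flipL f ε)) i j)
    (e' : p i' = g * flipP p ε' j') (c' : Cross (dirSeq f) (dirSeq (flipL f ε')) i' j') :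
    ε = ε' ∧ i = i' ∧ j = j' := by
  have a₁ := h.flip_translate ε g
  have a₂ := h.flip_translate ε' g
  have n1 : ¬ i < i' := h.toAxis.not_lt_of_start a₁ a₂ e c.fst_eq e' c'.fst_eq c'.pred_ne
    (by cases ε <;> cases ε' <;> simp)
  have n2 : ¬ i' < i := h.toAxis.not_lt_of_start a₂ a₁ e' c'.fst_eq e c.fst_eq c.pred_ne
    (by cases ε <;> cases ε' <;> simp)
  obtain rfl : i = i' := by omega
  have hε : ε = ε' := by
    by_contra hne
    have b1 := a₁.bwd j
    have b2 := a₂.fwd j'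
    rw [← e] at b1
    rw [← e', ← c'.fst_eq, c.fst_eq] at b2
    have : cond ε β α = cond ε' α β := by cases ε <;> cases ε' <;> simp_all
    rw [← this] at b2
    exact a₁.ne j (eq_of_quad_pos b1 b2)
  subst hε
  refine ⟨rfl, rfl, ?_⟩
  have := mul_left_cancel (e.symm.trans e')
  have := h.toPath.injective this
  cases ε <;> simpa using this

lemma Path.mem_gamma (h : Path f p) (h0 : p 0 = 1) (k : ℤ) :
    (if Even k then p k else p k * refl .x) ∈ Gamma.map toG := by
  have hp : ∀ a b, refl a * refl b ∈ Gamma.map toG := fun a b =>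
    ⟨pairM a b, pairM_mem a b, toG_pairM a b⟩
  have key : ∀ a (g : GL (Fin 2) ℤ) (P : Prop) [Decidable P], (if P then g else g * refl .x) ∈
    Gamma.map toG →
      (if ¬ P then g * refl a else g * refl a * refl .x) ∈ Gamma.map toG := by
    intro a g P _ hg
    by_cases hP : P
    · simp only [hP, if_true, not_true, if_false] at hg ⊢
      rw [mul_assoc]
      exact mul_mem hg (hp _ _)
    · simp only [hP, if_false, not_false_iff, if_true] at hg ⊢
      have := mul_mem hg (hp .x a)
      rwa [mul_assoc, ← mul_assoc (refl .x), refl_mul_self, one_mul] at this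
  induction k using Int.inductionOn' (b := 0) with
  | zero => simp [h0]
  | succ k _ ih =>
    have := key (f k) _ _ ih
    rw [← h.step] at this
    simpa only [Int.even_add_one] using this
  | pred k _ ih =>
    have := key (f (k - 1)) _ _ ih
    have e := h.step' (k - 1)
    rw [sub_add_cancel] at e
    rw [← e] at this
    simpa only [Int.even_sub_one] using this

lemma PeriodicAxis.exists_gamma (h : PeriodicAxis f p α β n v) (ε : Bool) {i j : ℤ}
    (hij : Even i ↔ Even j) : ∃ g : Gamma, p i = toG g * flipP p ε j := by
  have h1 := h.toPath.mem_gamma h.zero i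
  have h2 := h.toPath.mem_gamma h.zero (cond ε j (-j))
  have e : Even (cond ε j (-j)) ↔ Even j := by cases ε <;> simp
  have h3 := mul_mem h1 (inv_mem h2)
  have h4 : p i * (flipP p ε j)⁻¹ ∈ Gamma.map toG := by
    rw [flipP]
    simp only [e, ← hij] at h3
    by_cases hi : Even i
    · simpa [hi] using h3
    · simpa only [hi, if_false, mul_inv_rev, mul_assoc, mul_inv_cancel_left] using h3
  obtain ⟨g, hg, hg'⟩ := h4
  exact ⟨⟨g, hg⟩, by rw [hg', inv_mul_cancel_right]⟩

lemma Cross.congr {d₁ d₁' d₂ d₂' : ℤ → Letter × Bool} {i j i' j' : ℤ}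
    (h₁ : ∀ k, d₁ (i + k) = d₁' (i' + k)) (h₂ : ∀ k, d₂ (j + k) = d₂' (j' + k)) :
    Cross d₁ d₂ i j ↔ Cross d₁' d₂' i' j' := by
  have a1 := h₁ 0
  have b1 := h₂ 0
  have a2 := h₁ (-1)
  have b2 := h₂ (-1)
  simp only [add_zero, ← sub_eq_add_neg] at a1 a2 b1 b2
  have a3 : ∀ m : ℕ, d₁ (i + m - 1) = d₁' (i' + m - 1) := fun m => by
    have := h₁ (m - 1)
    rwa [add_sub, add_sub] at this
  simp only [Cross, a1, b1, a2, b2, a3, h₁, h₂]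

lemma PeriodicAxis.cross_add (h : PeriodicAxis f p α β n v) (ε : Bool) (i j a b : ℤ) :
    Cross (dirSeq f) (dirSeq (flipL f ε)) (i + a * n) (j + b * n) ↔
      Cross (dirSeq f) (dirSeq (flipL f ε)) i j := by
  apply Cross.congr
  · intro k
    rw [add_right_comm]
    exact h.flip_dirSeq_per true a (i + k)
  · intro k
    rw [add_right_comm]
    exact h.flip_dirSeq_per ε b (j + k)

/-- The crossings of a periodic sequence with itself and its reverse, up to periods. -/
noncomputable def crossSet (f : ℤ → Letter) (n : ℕ) : Finset (Bool × ℤ × ℤ) :=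
  (Finset.univ ×ˢ Finset.Ico 0 (n : ℤ) ×ˢ Finset.Ico 0 (n : ℤ)).filter
    fun t => Cross (dirSeq f) (dirSeq (flipL f t.1)) t.2.1 t.2.2

lemma doubleCoset_equivalence (v : Gamma) :
    Equivalence (fun h h' : {h : Gamma // GoodConj v h} =>
      ∃ m k : ℤ, (h' : Gamma) = v ^ m * (h : Gamma) * v ^ k) where
  refl h := ⟨0, 0, by simp⟩
  symm := by
    rintro h h' ⟨m, k, e⟩
    exact ⟨-m, -k, by rw [e]; group⟩
  trans := by
    rintro h h' h'' ⟨m, k, e⟩ ⟨m', k', e'⟩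
    exact ⟨m' + m, k + k', by rw [e', e, zpow_add, zpow_add]; group⟩

lemma eq_of_mem_Ico {n : ℕ} {i i' m : ℤ} (hi : 0 ≤ i ∧ i < n) (hi' : 0 ≤ i' ∧ i' < n)
    (h : i = i' + m * n) : i = i' := by
  have h1 := Int.emod_eq_of_lt hi.1 hi.2
  have h2 := Int.emod_eq_of_lt hi'.1 hi'.2
  rw [← h1, ← h2, h, Int.add_mul_emod_self_right]

lemma PeriodicAxis.sTwo_eq (h : PeriodicAxis f p α β n v) : sTwo v = (crossSet f n).card := by
  have hmem : ∀ {t}, t ∈ crossSet f n ↔ ((0 ≤ t.2.1 ∧ t.2.1 < n) ∧ 0 ≤ t.2.2 ∧ t.2.2 < n) ∧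
      Cross (dirSeq f) (dirSeq (flipL f t.1)) t.2.1 t.2.2 := by
    intro t; simp [crossSet]
  have hex : ∀ t : crossSet f n, ∃ g : Gamma, p t.1.2.1 = toG g * flipP p t.1.1 t.1.2.2 :=
    fun t => h.exists_gamma _ (hmem.1 t.2).2.parity
  choose G hG using hex
  have hgood : ∀ t, GoodConj v (G t) := fun t =>
    (h.goodConj_iff _).2 ⟨_, _, _, hG t, (hmem.1 t.2).2⟩
  rw [← Nat.card_eq_finsetCard]
  symm
  apply Nat.card_eq_of_bijective (fun t : crossSet f n => Quot.mk _ ⟨G t, hgood t⟩)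
  have hpow : ∀ m : ℤ, toG v ^ m = toG ((v ^ m : Gamma) : SL2Z) := fun m => by
    rw [Subgroup.coe_zpow, map_zpow]
  constructor
  · intro t t' ht
    obtain ⟨m, k, e⟩ := (doubleCoset_equivalence v).quot_mk_eq_iff _ _ |>.1 ht
    obtain ⟨⟨b1, b2⟩, c⟩ := hmem.1 t.2
    obtain ⟨⟨b1', b2'⟩, c'⟩ := hmem.1 t'.2
    dsimp only at e
    have e1 : p (t'.1.2.1 + (-m) * n) = toG (G t) *
        flipP p t'.1.1 (t'.1.2.2 + cond t'.1.1 k (-k) * n) := by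
      rw [h.add, h.flip_add, hG t', e]
      have : cond t'.1.1 (cond t'.1.1 k (-k)) (-cond t'.1.1 k (-k)) = k := by
        cases t'.1.1 <;> simp
      rw [this, hpow k, zpow_neg, hpow m]
      simp only [Subgroup.coe_mul, map_mul, mul_assoc, inv_mul_cancel_left]
    obtain ⟨h1, h2, h3⟩ := h.cross_unique (hG t) c e1 ((h.cross_add _ _ _ _ _).2 c')
    exact Subtype.ext (Prod.ext h1 (Prod.ext (eq_of_mem_Ico b1 b1' h2) (eq_of_mem_Ico b2 b2' h3)))
  · intro x
    obtain ⟨⟨g, hg⟩, rfl⟩ := Quot.exists_rep x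
    obtain ⟨ε, i, j, e, c⟩ := (h.goodConj_iff g).1 hg
    have hn : (0 : ℤ) < n := by exact_mod_cast h.pos
    have d1 := Int.emod_add_ediv_mul i n
    have d2 := Int.emod_add_ediv_mul j n
    rw [← d1, ← d2] at c e
    rw [h.cross_add] at c
    rw [h.add, h.flip_add] at e
    let t : crossSet f n := ⟨(ε, i % n, j % n), hmem.2 ⟨⟨⟨Int.emod_nonneg _ hn.ne',
      Int.emod_lt_of_pos _ hn⟩, Int.emod_nonneg _ hn.ne', Int.emod_lt_of_pos _ hn⟩, c⟩⟩
    refine ⟨t, Quot.sound ⟨i / n, -(cond ε (j / n) (-(j / n))), ?_⟩⟩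
    have e2 := hG t
    simp only [t] at e2
    rw [e2, ← mul_assoc, ← mul_assoc, mul_left_inj, hpow, hpow, ← map_mul, ← map_mul] at e
    have e3 : v ^ (i / n) * G t = g * v ^ (cond ε (j / n) (-(j / n))) :=
      Subtype.ext (toG_injective (by simpa using e))
    dsimp only
    rw [e3, zpow_neg, mul_inv_cancel_right]

end

section

variable {f f' : ℤ → Letter} {p q : ℤ → GL (Fin 2) ℤ} {α β : ℝ × ℝ} {n : ℕ} {v : Gamma}

/-- An `n`-periodic sequence has no period properly dividing `n`. -/
def PrimSeq (f : ℤ → Letter) (n : ℕ) : Prop :=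
  ∀ d : ℤ, 0 < d → d < n → d ∣ n → ¬ ∀ k, f (k + d) = f k

lemma per_mul {ι : Type*} {f : ℤ → ι} {n : ℤ} (h : ∀ k, f (k + n) = f k) (m k : ℤ) :
    f (k + m * n) = f k := by
  induction m using Int.inductionOn' (b := 0) with
  | zero => simp
  | succ m _ ih => rw [← ih, ← h (k + m * n)]; congr 1; ring
  | pred m _ ih => rw [← ih, ← h (k + (m - 1) * n)]; congr 1; ring

lemma PeriodicAxis.notProperPower (h : PeriodicAxis f p α β n v) (hf : PrimSeq f n) :
    NotProperPower v := by
  rintro ⟨u, k, hk, hv⟩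
  have hw := h.wedge_ne_zero
  have hcomm : toG u * toG v * (toG u)⁻¹ = toG v := by
    rw [← map_inv, ← map_mul, ← map_mul, hv]
    have : u * u ^ k * u⁻¹ = u ^ k := by rw [← pow_succ', pow_succ, mul_inv_cancel_right]
    exact congrArg toG (congrArg Subtype.val this)
  have h0 : crossSign α β (act (toG u) α) (act (toG u) β) = 0 := by
    refine (linked_fixedSet_iff h.hyp h.hyp h.eigα h.eigβ ?_ ?_ hw ?_).2 rfl
    · have := h.eigα.conj (h := toG u); rwa [hcomm] at this
    · have := h.eigβ.conj (h := toG u); rwa [hcomm] at this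
    · rw [wedge_act, dt_toG, one_mul]; exact hw
  have hx : ∃ i j, p i = toG u * p j := by
    by_contra! hdis
    exact (h.toAxis.crossSign_pos (h.toAxis.translate (toG u)) hdis u.2
      (by rw [h.zero, one_mul, mul_one])).ne' h0
  obtain ⟨i, j, hij⟩ := hx
  have hcomm' : toG v * toG u = toG u * toG v := by
    rw [eq_comm, ← mul_inv_eq_iff_eq_mul, hcomm]
  have hletter : ∀ i j, p i = toG u * p j → f i = f j := by
    intro i j hij
    refine h.toPath.letter_eq (h.toPath.translate (toG u)) h.pos hij ?_
    have e1 := h.add 1 i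
    have e2 := h.add 1 j
    rw [one_mul, zpow_one] at e1 e2
    rw [e1, e2, hij, ← mul_assoc, hcomm', mul_assoc]
  have hs : ∀ s : ℕ, p (i + s) = toG u * p (j + s) := by
    intro s
    induction s with
    | zero => simpa using hij
    | succ s ih =>
      push_cast
      rw [← add_assoc, ← add_assoc, h.step, h.step, ih, hletter _ _ ih, mul_assoc]
  have hper : ∀ s, f (s + (i - j)) = f s := by
    intro s
    have hn : (0 : ℤ) < n := by exact_mod_cast h.pos
    obtain ⟨N, hN⟩ : ∃ N : ℕ, (N : ℤ) = s - j + |s - j| * n :=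
      ⟨_, Int.toNat_of_nonneg (by nlinarith [neg_abs_le (s - j), abs_nonneg (s - j)])⟩
    have := hletter _ _ (hs N)
    rw [hN] at this
    rw [← per_mul h.per |s - j| (s + (i - j)), ← per_mul h.per |s - j| s]
    convert this using 2 <;> ring
  have hd : p (i - j) = toG u := by
    have := h.toPath.periodic h.zero hper j
    rw [add_sub_cancel, hij] at this
    exact (mul_right_cancel this).symm
  have hkd : (n : ℤ) = k * (i - j) := by
    apply h.toPath.injective
    have := h.toPath.periodic_zpow h.zero hper k 0
    rw [h.zero, mul_one, zero_add, hd] at this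
    rw [this, ← h.hv, hv]
    simp
  have hn : (0 : ℤ) < n := by exact_mod_cast h.pos
  have hk' : (2 : ℤ) ≤ k := by exact_mod_cast hk
  have hd0 : 0 < i - j := by
    rw [hkd] at hn
    exact pos_of_mul_pos_right hn (by omega)
  exact hf (i - j) hd0 (by nlinarith) (Dvd.intro_left _ hkd.symm) hper

lemma Iγ_eq {v : Gamma} (h : NotProperPower v) : Iγ v = (sTwo v / 2 : ℕ) := by
  have hex : ∃ p : Gamma × ℕ, 1 ≤ p.2 ∧ NotProperPower p.1 ∧ v = p.1 ^ p.2 :=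
    ⟨(v, 1), le_rfl, h, by simp⟩
  rw [Iγ, dif_pos hex]
  obtain ⟨h1, h2, h3⟩ := hex.choose_spec
  have h4 : hex.choose.2 = 1 := by
    by_contra hne
    exact h ⟨_, _, by omega, h3⟩
  rw [h4, pow_one] at h3
  rw [h4, ← h3]
  ring

/-- An admissible sequence: the periodic extension of a word representing a class of `𝒢`. -/
structure Adm (f : ℤ → Letter) (n : ℕ) : Prop where
  red : ∀ k, f k ≠ f (k + 1)
  per : ∀ k, f (k + n) = f k
  even : Even (n : ℤ)
  four : 4 ≤ n
  prim : PrimSeq f n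

lemma eq_of_ne_ne {a b c d : Letter} (h1 : a ≠ b) (h2 : b ≠ c) (ha : a ≠ d) (hb : b ≠ d)
    (hc : c ≠ d) : a = c := by
  cases a <;> cases b <;> cases c <;> cases d <;> simp_all

lemma Adm.exists_eq (h : Adm f n) (c : Letter) : ∃ k, f k = c := by
  by_contra! hc
  refine h.prim 2 two_pos (by have := h.four; omega) h.even.two_dvd fun k => ?_
  have h2 := h.red (k + 1)
  rw [add_assoc] at h2
  exact (eq_of_ne_ne (h.red k) h2 (hc _) (hc _) (hc _)).symm

lemma exists_mem_Ico_per {ι : Type*} {f : ℤ → ι} {n : ℤ} (hn : 0 < n) (h : ∀ k, f (k + n) = f k)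
    (a k : ℤ) : ∃ j, a ≤ j ∧ j < a + n ∧ f j = f k ∧ n ∣ k - j := by
  refine ⟨a + (k - a) % n, by have := Int.emod_nonneg (k - a) hn.ne'; omega,
    by have := Int.emod_lt_of_pos (k - a) hn; omega, ?_, ?_⟩
  · rw [← per_mul h ((k - a) / n)]
    congr 1
    have := Int.emod_add_ediv_mul (k - a) n
    linarith
  · refine ⟨(k - a) / n, ?_⟩
    have := Int.emod_add_mul_ediv (k - a) n
    linarith

lemma Adm.exists_axis (h : Adm f n) (hp : Path f p) (h0 : p 0 = 1) (hv : toG v = p n) :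
    ∃ α β, PeriodicAxis f p α β n v := by
  have hn : 0 < n := by have := h.four; omega
  obtain ⟨h1, α, β, h2, h3, h4⟩ := hp.exists_axis h0 hn h.per hv fun c => by
    obtain ⟨k, hk⟩ := h.exists_eq c
    obtain ⟨j, h1, h2, h3, -⟩ := exists_mem_Ico_per (by exact_mod_cast hn) h.per 0 k
    exact ⟨j, h1, by omega, h3.trans hk⟩
  exact ⟨α, β, ⟨h4, h0, hn, h.even, h.per, hv, h1, h2, h3⟩⟩

lemma exists_path (f : ℤ → Letter) (hf : ∀ k, f k ≠ f (k + 1)) : ∃ p, p 0 = 1 ∧ Path f p := by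
  let A : ℕ → GL (Fin 2) ℤ := fun k => Nat.rec 1 (fun k g => g * refl (f k)) k
  let B : ℕ → GL (Fin 2) ℤ := fun k => Nat.rec 1 (fun k g => g * refl (f (-(k + 1)))) k
  have hA : ∀ k, A (k + 1) = A k * refl (f k) := fun k => rfl
  have hB : ∀ k, B (k + 1) = B k * refl (f (-(k + 1))) := fun k => rfl
  refine ⟨fun k => if 0 ≤ k then A k.toNat else B (-k).toNat, rfl, hf, fun k => ?_⟩
  by_cases hk : 0 ≤ k
  · obtain ⟨m, rfl⟩ := Int.eq_ofNat_of_zero_le hk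
    rw [if_pos hk, if_pos (by omega)]
    simpa using hA m
  · obtain ⟨m, hm⟩ : ∃ m : ℕ, k = -(m + 1) := ⟨(-k - 1).toNat, by omega⟩
    have e1 : (-k).toNat = m + 1 := by omega
    rw [if_neg hk, e1, hB, ← hm, mul_assoc, refl_mul_self, mul_one]
    rcases m with _ | m
    · rw [if_pos (by omega)]
      have : (k + 1).toNat = 0 := by omega
      rw [this]; rfl
    · rw [if_neg (by omega)]
      have : (-(k + 1)).toNat = m + 1 := by omega
      rw [this]

/-- The periodic extension of a word. -/
def seqW (w : List Letter) (k : ℤ) : Letter := cget w (k % w.length).toNat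

lemma seqW_natCast (w : List Letter) (k : ℕ) : seqW w k = cget w k := by
  rw [seqW, ← Int.natCast_mod, Int.toNat_natCast, cget, cget, Nat.mod_mod]

lemma seqW_add (w : List Letter) (k : ℤ) : seqW w (k + w.length) = seqW w k := by
  rw [seqW, seqW, Int.add_emod_right]

lemma toG_phiM : ∀ w : List Letter, Even w.length → toG (phiM w) = prodRefl w
  | [], _ => by simp [phiM, prodRefl]
  | [_], h => by simp at h
  | a :: b :: t, h => by
    have := toG_phiM t (by simpa [parity_simps] using h)
    rw [phiM, map_mul, toG_pairM, this]
    simp [prodRefl, mul_assoc]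

lemma cget_of_lt {w : List Letter} {k : ℕ} (h : k < w.length) : cget w k = w[k] := by
  rw [cget, Nat.mod_eq_of_lt h, List.getD_eq_getElem _ _ h]

lemma prodRefl_eq_path {w : List Letter} (hp : Path (seqW w) p) (h0 : p 0 = 1) :
    prodRefl w = p w.length := by
  have : ∀ k ≤ w.length, prodRefl (w.take k) = p k := by
    intro k hk
    induction k with
    | zero => simp [prodRefl, h0]
    | succ k ih =>
      have hk' : k < w.length := hk
      push_cast
      rw [hp.step, ← ih hk'.le, seqW_natCast, cget_of_lt hk', List.take_add_one]
      simp [prodRefl, hk']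
  simpa using this _ le_rfl

/-- The defect of a periodic sequence. -/
noncomputable def deltaS (f : ℤ → Letter) (n : ℕ) : ℤ :=
  ((crossSet f n).card / 2 : ℕ) - (n : ℤ) / 2

lemma deltaW_eq {w : List Letter} (h : Adm (seqW w) w.length) :
    deltaW w = deltaS (seqW w) w.length := by
  obtain ⟨p, h0, hp⟩ := exists_path _ h.red
  have hv : toG (phiM w) = p w.length := by
    rw [toG_phiM w (by exact_mod_cast h.even), prodRefl_eq_path hp h0]
  obtain ⟨α, β, ha⟩ := h.exists_axis (v := ⟨phiM w, phiM_mem w⟩) hp h0 hv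
  rw [deltaW, Iw, Iγ_eq (ha.notProperPower h.prim), ha.sTwo_eq, deltaS, Lw]

end

section

variable {f f' : ℤ → Letter} {n : ℕ} {u w : List Letter}

lemma seqW_of_lt {k : ℕ} (h : k < w.length) : seqW w k = w[k] := by
  rw [seqW_natCast, cget_of_lt h]

lemma eq_of_per {ι : Type*} {f f' : ℤ → ι} {n : ℤ} (hn : 0 < n) (h : ∀ k, f (k + n) = f k)
    (h' : ∀ k, f' (k + n) = f' k) (a : ℤ) (he : ∀ k, a ≤ k → k < a + n → f k = f' k) : f = f' := by
  funext k
  obtain ⟨j, h1, h2, h3, m, hm⟩ := exists_mem_Ico_per hn h a k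
  rw [← h3, he j h1 h2, ← per_mul h' m]
  congr 1; linarith

lemma seqW_injective (hl : u.length = w.length) (h : seqW u = seqW w) : u = w := by
  refine List.ext_getElem hl fun k h1 h2 => ?_
  rw [← seqW_of_lt h1, ← seqW_of_lt h2, h]

lemma seqW_rotate (w : List Letter) (j : ℕ) (k : ℤ) : seqW (w.rotate j) k = seqW w (k + j) := by
  rcases Nat.eq_zero_or_pos w.length with h0 | h0
  · rw [List.length_eq_zero_iff] at h0
    subst h0; simp [seqW, cget]
  refine congrFun (eq_of_per (f := seqW (w.rotate j)) (f' := fun k => seqW w (k + j)) (n :=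
    w.length)
    (by exact_mod_cast h0) (fun k => ?_) (fun k => ?_) 0 fun k h1 h2 => ?_) k
  · have := seqW_add (w.rotate j) k
    rwa [List.length_rotate] at this
  · rw [add_right_comm, seqW_add]
  · obtain ⟨k, rfl⟩ := Int.eq_ofNat_of_zero_le h1
    have hk : k < (w.rotate j).length := by rw [List.length_rotate]; omega
    rw [seqW_of_lt hk, List.getElem_rotate]
    rw [← Nat.cast_add, seqW_natCast, cget, List.getD_eq_getElem _ _ (Nat.mod_lt _ h0)]

lemma seqW_reverse (w : List Letter) (k : ℤ) : seqW w.reverse k = seqW w (-1 - k) := by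
  rcases Nat.eq_zero_or_pos w.length with h0 | h0
  · rw [List.length_eq_zero_iff] at h0
    subst h0; simp [seqW, cget]
  refine congrFun (eq_of_per (f := seqW w.reverse) (f' := fun k => seqW w (-1 - k)) (n := w.length)
    (by exact_mod_cast h0) (fun k => ?_) (fun k => ?_) 0 fun k h1 h2 => ?_) k
  · have := seqW_add w.reverse k
    rwa [List.length_reverse] at this
  · rw [← seqW_add w (-1 - (k + w.length))]; congr 1; ring
  · obtain ⟨k, rfl⟩ := Int.eq_ofNat_of_zero_le h1
    have hk : k < w.reverse.length := by rw [List.length_reverse]; omega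
    rw [seqW_of_lt hk, List.getElem_reverse, ← seqW_add,
      show -1 - (k : ℤ) + w.length = ((w.length - 1 - k : ℕ) : ℤ) by omega, seqW_of_lt (by omega)]

lemma seqW_ofFn (hn : 0 < n) (h : ∀ k, f (k + n) = f k) :
    seqW (List.ofFn fun i : Fin n => f i) = f := by
  refine eq_of_per (n := n) (by exact_mod_cast hn) (fun k => ?_) h 0 fun k h1 h2 => ?_
  · have := seqW_add (List.ofFn fun i : Fin n => f i) k
    rwa [List.length_ofFn] at this
  · obtain ⟨k, rfl⟩ := Int.eq_ofNat_of_zero_le h1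
    rw [seqW_of_lt (by rw [List.length_ofFn]; omega)]
    simp

lemma wordEquiv_iff (hu : u ≠ []) (hev : Even (u.length : ℤ)) : WordEquiv u w ↔
    u.length = w.length ∧
      ∃ (ε : Bool) (c : ℤ), Even c ∧ ∀ k, seqW w k = flipL (seqW u) ε (k + c) := by
  have hpos : (0 : ℤ) < u.length := by exact_mod_cast List.length_pos_iff.2 hu
  constructor
  · rintro ⟨k, hk, rfl | rfl⟩
    · refine ⟨by simp, true, k, by exact_mod_cast (even_iff_two_dvd.2 hk), fun i => ?_⟩
      rw [seqW_rotate]; rfl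
    · refine ⟨by simp, false, k, by exact_mod_cast (even_iff_two_dvd.2 hk), fun i => ?_⟩
      rw [seqW_rotate, seqW_reverse]; rfl
  · rintro ⟨hl, ε, c, hc, h⟩
    obtain ⟨m, hm⟩ : ∃ m : ℕ, (m : ℤ) = c % u.length :=
      ⟨_, Int.toNat_of_nonneg (Int.emod_nonneg _ hpos.ne')⟩
    have hd := Int.emod_add_ediv_mul c u.length
    rw [← hm] at hd
    have hme : 2 ∣ m := by
      have : Even (m : ℤ) := by
        have e : (m : ℤ) = c - c / u.length * u.length := by linarith
        rw [e]; exact hc.sub (hev.mul_left _)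
      exact even_iff_two_dvd.1 (by exact_mod_cast this)
    refine ⟨m, hme, ?_⟩
    cases ε
    · right
      refine seqW_injective (by simp [hl]) (funext fun k => ?_)
      rw [h, seqW_rotate, seqW_reverse, flipL, cond_false, ← per_mul (seqW_add u) (c / u.length)]
      congr 1; linarith
    · left
      refine seqW_injective (by simp [hl]) (funext fun k => ?_)
      rw [h, seqW_rotate, flipL, cond_true, ← per_mul (seqW_add u) (c / u.length) (k + m)]
      congr 1; linarith

lemma primitive_iff (hw : w ≠ []) : Primitive w ↔ PrimSeq (seqW w) w.length := by
  have hpos : 0 < w.length := List.length_pos_iff.2 hw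
  constructor
  · intro h d hd0 hdn hdvd hper
    obtain ⟨d, rfl⟩ := Int.eq_ofNat_of_zero_le hd0.le
    have hd0' : 0 < d := by exact_mod_cast hd0
    obtain ⟨k, hk⟩ := Int.natCast_dvd_natCast.1 hdvd
    rw [mul_comm] at hk
    refine h ⟨List.ofFn fun i : Fin d => seqW w i, k, ?_, by simpa using hdn, 0, ?_⟩
    · by_contra! hk2
      interval_cases k
      · omega
      · simp at hk; omega
    · have e : w = List.ofFn fun i : Fin (k * d) => seqW w i := by
        refine seqW_injective (by simp [hk]) ?_
        rw [seqW_ofFn (by omega)]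
        intro i
        rw [← hk, seqW_add]
      rw [List.rotate_zero]
      conv_lhs => rw [e]
      rw [List.ofFn_mul]
      congr 1
      rw [← List.ofFn_const]
      congr 1
      funext i
      congr 1
      funext j
      push_cast
      rw [add_comm]
      exact per_mul hper i j
  · rintro h ⟨u, k, hk, hu, j, hj⟩
    have hlen : w.length = k * u.length := by
      have := congrArg List.length hj
      simpa using this
    have hu0 : 0 < u.length := by
      rcases Nat.eq_zero_or_pos u.length with h0 | h0
      · rw [h0] at hlen; omega
      · exact h0
    refine h u.length (by exact_mod_cast hu0) (by exact_mod_cast hu)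
      ⟨k, by rw [hlen]; push_cast; ring⟩ fun i => ?_
    have hrot : (w.rotate j).rotate u.length = w.rotate j := by
      rw [hj]
      obtain ⟨k, rfl⟩ : ∃ k', k = k' + 1 := ⟨k - 1, by omega⟩
      conv_lhs => rw [List.replicate_succ, List.flatten_cons, List.rotate_append_length_eq]
      rw [List.replicate_succ', List.flatten_append]
      simp
    have := congrArg (fun w => seqW w (i - j)) hrot
    simp only [seqW_rotate] at this
    convert this using 2 <;> ring

lemma inG_iff : InG w ↔ Adm (seqW w) w.length := by
  constructor
  · rintro ⟨⟨h0, h1⟩, h2, h3, h4⟩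
    refine ⟨fun k => ?_, seqW_add w, by exact_mod_cast even_iff_two_dvd.2 h3, h4,
      (primitive_iff h0).1 h2⟩
    have hpos : (0 : ℤ) < w.length := by omega
    obtain ⟨j, hj1, hj2, hj3, m, hm⟩ := exists_mem_Ico_per hpos (seqW_add w) 0 k
    obtain ⟨j, rfl⟩ := Int.eq_ofNat_of_zero_le hj1
    rw [← hj3, show k + 1 = ((j + 1 : ℕ) : ℤ) + m * w.length by push_cast; linarith,
      per_mul (seqW_add w), seqW_natCast, seqW_natCast]
    exact h1 j (by omega)
  · intro h
    have h0 : w ≠ [] := by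
      rintro rfl
      have := h.four
      simp at this
    refine ⟨⟨h0, fun i _ => ?_⟩, (primitive_iff h0).2 h.prim,
      even_iff_two_dvd.1 (by exact_mod_cast h.even), h.four⟩
    have := h.red i
    rw [seqW_natCast] at this
    rw [← seqW_natCast w (i + 1)]
    exact_mod_cast this

end

section

/-- A reduced sequence of directed edges. -/
structure DirPath (d : ℤ → Letter × Bool) : Prop where
  red : ∀ k, (d k).1 ≠ (d (k + 1)).1
  bit : ∀ k, (d (k + 1)).2 = !(d k).2

variable {d d₁ d₂ D D₁ D₂ e₁ e₂ : ℤ → Letter × Bool} {n a i j : ℤ} {c : Letter}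

lemma turn_ne_of_ne {e e' e'' : Letter × Bool} (h : e.1 ≠ e'.1) (h' : e.1 ≠ e''.1)
    (h'' : e'.1 ≠ e''.1) : turn e' e ≠ turn e'' e := by
  obtain ⟨e, b⟩ := e; obtain ⟨e', b'⟩ := e'; obtain ⟨e'', b''⟩ := e''
  cases e <;> cases e' <;> cases e'' <;> cases b <;> simp_all [turn, nxt]

lemma turn_ne_of_ne' {e e' e'' : Letter × Bool} (h : e.1 ≠ e'.1) (h' : e.1 ≠ e''.1)
    (h'' : e'.1 ≠ e''.1) (hb : e'.2 = e''.2) : turn e e' ≠ turn e e'' := by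
  obtain ⟨e, b⟩ := e; obtain ⟨e', b'⟩ := e'; obtain ⟨e'', b''⟩ := e''
  cases e <;> cases e' <;> cases e'' <;> cases b' <;> cases b'' <;> simp_all [turn, nxt]

lemma turn_eq_of_eq {e e' e'' : Letter × Bool} (h : e.1 ≠ e'.1) (h' : e.1 = e''.1)
    (hb : e''.2 = !e'.2) : turn e e' = turn e' e'' := by
  obtain ⟨e, b⟩ := e; obtain ⟨e', b'⟩ := e'; obtain ⟨e'', b''⟩ := e''
  cases e <;> cases e' <;> cases e'' <;> cases b' <;> cases b'' <;> simp_all [turn, nxt]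

lemma turn_ne_of_third {e e' e'' : Letter × Bool} (h : e.1 ≠ e'.1) (h' : e.1 ≠ e''.1)
    (h'' : e'.1 ≠ e''.1) (hb : e''.2 = !e'.2) : turn e e' ≠ turn e' e'' := by
  obtain ⟨e, b⟩ := e; obtain ⟨e', b'⟩ := e'; obtain ⟨e'', b''⟩ := e''
  cases e <;> cases e' <;> cases e'' <;> cases b' <;> cases b'' <;> simp_all [turn, nxt]

lemma DirPath.red' (h : DirPath d) (k : ℤ) : (d (k - 1)).1 ≠ (d k).1 := by
  have := h.red (k - 1)
  rwa [sub_add_cancel] at this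

lemma DirPath.bit' (h : DirPath d) (k : ℤ) : (d (k - 1)).2 = !(d k).2 := by
  have := h.bit (k - 1)
  rw [sub_add_cancel] at this
  simp [this]

lemma Cross.symm (h₁ : DirPath d₁) (h₂ : DirPath d₂) (h : Cross d₁ d₂ i j) : Cross d₂ d₁ j i := by
  obtain ⟨a1, a2, m, a3, a4, a5, a6⟩ := h
  refine ⟨a1.symm, a2.symm, m, a3, fun k hk => (a4 k hk).symm, a5.symm, ?_⟩
  have b1 := a4 (m - 1) (by omega)
  rw [Nat.cast_sub a3, Nat.cast_one, add_sub, add_sub] at b1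
  have t1 : turn (d₁ (i - 1)) (d₁ i) ≠ turn (d₂ (j - 1)) (d₁ i) := by
    refine turn_ne_of_ne (h₁.red' i).symm (a1 ▸ (h₂.red' j).symm) fun h => a2 (Prod.ext h ?_)
    rw [h₁.bit', h₂.bit', a1]
  have t2 : turn (d₁ (i + m - 1)) (d₁ (i + m)) ≠ turn (d₁ (i + m - 1)) (d₂ (j + m)) := by
    have hb : (d₁ (i + m)).2 = (d₂ (j + m)).2 := by
      have e1 := h₁.bit (i + m - 1)
      have e2 := h₂.bit (j + m - 1)
      rw [sub_add_cancel] at e1 e2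
      rw [e1, e2, b1]
    exact turn_ne_of_ne' (h₁.red' _) (b1 ▸ h₂.red' _) (fun h => a5 (Prod.ext h hb)) hb
  rw [← a1, ← b1]
  revert a6 t1 t2
  generalize turn (d₁ (i - 1)) (d₁ i) = x
  generalize turn (d₂ (j - 1)) (d₁ i) = y
  generalize turn (d₁ (i + m - 1)) (d₁ (i + m)) = z
  generalize turn (d₁ (i + m - 1)) (d₂ (j + m)) = t
  revert x y z t
  decide

/-- The sequence `D` of period `n + 2` is obtained from the sequence `d` of period `n` by expansion
at the longest interval without the letter `c`, which starts at `-1` and has length `a + 1`. -/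
structure DirExp (n a : ℤ) (c : Letter) (d D : ℤ → Letter × Bool) : Prop where
  path : DirPath d
  path' : DirPath D
  per : ∀ k, d (k + n) = d k
  per' : ∀ k, D (k + (n + 2)) = D k
  agree : ∀ k, -1 ≤ k → k < n + a → D k = d k
  run : ∀ k, -1 ≤ k → k < a → (d k).1 ≠ c
  before : (d (-2)).1 = c
  after : (d a).1 = c
  longest : ∀ q, (∀ k : ℕ, k ≤ a → (d (q + k)).1 ≠ c) → n ∣ q + 1
  one_le : 1 ≤ a
  two_le : 2 ≤ n

lemma Cross.of_window {B : ℤ} (h₁ : ∀ k, i - 1 ≤ k → k ≤ i + B → e₁ k = d₁ k)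
    (h₂ : ∀ k, j - 1 ≤ k → k ≤ j + B → e₂ k = d₂ k)
    (hk : ∃ k : ℕ, k ≤ B ∧ d₁ (i + k) ≠ d₂ (j + k)) (h : Cross d₁ d₂ i j) : Cross e₁ e₂ i j := by
  obtain ⟨a1, a2, m, a3, a4, a5, a6⟩ := h
  obtain ⟨k, hk, hk'⟩ := hk
  have hm : m ≤ k := by
    by_contra! hm
    exact hk' (a4 k hm)
  refine ⟨?_, ?_, m, a3, fun l hl => ?_, ?_, ?_⟩
  · rwa [h₁ _ (by omega) (by omega), h₂ _ (by omega) (by omega)]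
  · rwa [h₁ _ (by omega) (by omega), h₂ _ (by omega) (by omega)]
  · rw [h₁ _ (by omega) (by omega), h₂ _ (by omega) (by omega)]
    exact a4 l hl
  · rwa [h₁ _ (by omega) (by omega), h₂ _ (by omega) (by omega)]
  · rwa [h₁ _ (by omega) (by omega), h₁ _ (by omega) (by omega), h₁ _ (by omega) (by omega),
      h₁ _ (by omega) (by omega)]

namespace DirExp

lemma run_period (E : DirExp n a c d D) (k : ℤ) (h : n - 1 ≤ k) (h' : k < n + a) : (d k).1 ≠ c := by
  have := E.per (k - n)
  rw [sub_add_cancel] at this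
  rw [this]
  exact E.run _ (by omega) (by omega)

lemma eq_of_agree (E₁ : DirExp n a c d₁ D₁) (E₂ : DirExp n a c d₂ D₂) (hj : 0 ≤ j) (hji : j ≤ i)
    (hi : i < n) (h : ∀ k : ℕ, i + k ≤ n + a - 1 → d₁ (i + k) = d₂ (j + k)) :
    i = j ∧ d₁ (-1) = d₂ (-1) := by
  have h1 : n ∣ (j + n - 1 - i) + 1 := by
    refine E₂.longest _ fun k hk => ?_
    have := h (n - 1 - i + k).toNat (by omega)
    rw [Int.toNat_of_nonneg (by omega)] at this
    rw [show j + n - 1 - i + k = j + (n - 1 - i + k) by ring, ← this]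
    exact E₁.run_period _ (by omega) (by omega)
  have h2 : i = j := by
    obtain ⟨t, ht⟩ := h1
    have : j - i = (t - 1) * n := by linarith
    rcases lt_trichotomy t 1 with h | h | h
    · nlinarith
    · rw [h] at this; omega
    · nlinarith
  refine ⟨h2, ?_⟩
  have := h (n - 1 - i).toNat (by have := E₁.one_le; omega)
  rw [Int.toNat_of_nonneg (by omega), ← h2] at this
  rw [← E₁.per, ← E₂.per]
  convert this using 2 <;> ring

lemma exists_ne (E₁ : DirExp n a c d₁ D₁) (E₂ : DirExp n a c d₂ D₂)
    (H : d₁ = d₂ ∨ d₁ (-1) ≠ d₂ (-1)) (hi : 0 ≤ i) (hi' : i < n) (hj : 0 ≤ j) (hj' : j < n)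
    (hne : d₁ (i - 1) ≠ d₂ (j - 1)) :
    ∃ k : ℕ, k ≤ n + a - 1 - max i j ∧ d₁ (i + k) ≠ d₂ (j + k) := by
  by_contra! h
  have key : i = j ∧ d₁ (-1) = d₂ (-1) := by
    rcases le_total j i with hle | hle
    · exact eq_of_agree E₁ E₂ hj hle hi' fun k hk => h k (by rw [max_eq_left hle]; omega)
    · have := eq_of_agree E₂ E₁ hi hle hj' fun k hk => (h k (by rw [max_eq_right hle]; omega)).symm
      exact ⟨this.1.symm, this.2.symm⟩
  obtain ⟨rfl, h1⟩ := key
  rcases H with rfl | H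
  · exact hne rfl
  · exact H h1

lemma cross_iff (E₁ : DirExp n a c d₁ D₁) (E₂ : DirExp n a c d₂ D₂)
    (H : d₁ = d₂ ∨ d₁ (-1) ≠ d₂ (-1)) (hi : 0 ≤ i) (hi' : i < n) (hj : 0 ≤ j) (hj' : j < n) :
    Cross d₁ d₂ i j ↔ Cross D₁ D₂ i j := by
  have w1 : ∀ k, i - 1 ≤ k → k ≤ i + (n + a - 1 - max i j) → D₁ k = d₁ k :=
    fun k hk hk' => E₁.agree k (by omega) (by omega)
  have w2 : ∀ k, j - 1 ≤ k → k ≤ j + (n + a - 1 - max i j) → D₂ k = d₂ k :=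
    fun k hk hk' => E₂.agree k (by omega) (by omega)
  constructor
  · intro h
    exact h.of_window w1 w2 (exists_ne E₁ E₂ H hi hi' hj hj' h.2.1)
  · intro h
    have hne := h.2.1
    have ha := E₁.one_le
    rw [w1 _ (by omega) (by omega), w2 _ (by omega) (by omega)] at hne
    obtain ⟨k, hk, hk'⟩ := exists_ne E₁ E₂ H hi hi' hj hj' hne
    refine h.of_window (fun k h h' => (w1 k h h').symm) (fun k h h' => (w2 k h h').symm) ⟨k, hk, ?_⟩
    rwa [w1 _ (by omega) (by omega), w2 _ (by omega) (by omega)]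

lemma run' (E : DirExp n a c d D) {k : ℤ} (h : n - 1 ≤ k) (h' : k ≤ n + a + 1) : (D k).1 ≠ c := by
  have h1 := E.one_le
  rcases lt_or_ge k (n + a) with h2 | h2
  · rw [E.agree k (by have := E.two_le; omega) h2]
    exact E.run_period k h h2
  · have := E.per' (k - (n + 2))
    rw [sub_add_cancel] at this
    rw [this, E.agree _ (by omega) (by have := E.two_le; omega)]
    exact E.run _ (by omega) (by omega)

lemma before' (E : DirExp n a c d D) : (D (n - 2)).1 = c := by
  have h1 := E.one_le
  rw [E.agree _ (by have := E.two_le; omega) (by omega), ← E.before, ← E.per (-2)]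
  congr 2; ring

lemma after' (E : DirExp n a c d D) : (D (n + a + 2)).1 = c := by
  have h1 := E.one_le
  have h2 := E.two_le
  rw [show n + a + 2 = a + (n + 2) by ring, E.per', E.agree _ (by omega) (by omega), E.after]

lemma longest' (E : DirExp n a c d D) (hj : 0 ≤ j) (hj' : j < n + 2) (h : (D (j - 1)).1 = c)
    (h' : ∀ k : ℕ, k ≤ a → (D (j + k)).1 ≠ c) : j = n - 1 := by
  have h1 := E.one_le
  have h2 := E.two_le
  rcases le_or_gt j (n - 1) with h3 | h3
  · have : n ∣ j + 1 := E.longest j fun k hk => by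
      rw [← E.agree _ (by omega) (by omega)]
      exact h' k hk
    have := Int.le_of_dvd (by omega) this
    omega
  · exact absurd h (E.run' (by omega) (by omega))

lemma step_two (E : DirExp n a c d D) {k : ℤ} (h : n - 1 ≤ k) (h' : k + 2 ≤ n + a + 1) :
    D (k + 2) = D k := by
  have b1 := E.path'.bit k
  have b2 := E.path'.bit (k + 1)
  have r1 := E.path'.red k
  have r2 := E.path'.red (k + 1)
  rw [add_assoc, one_add_one_eq_two] at b2 r2
  refine Prod.ext (eq_of_ne_ne r1 r2 (E.run' h (by omega)) (E.run' (by omega) (by omega))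
    (E.run' (by omega) h')).symm ?_
  rw [b2, b1, Bool.not_not]

lemma turn_const (E : DirExp n a c d D) {k : ℤ} (m : ℕ) (h : n - 1 ≤ k)
    (h' : k + m + 1 ≤ n + a + 1) : turn (D (k + m)) (D (k + m + 1)) = turn (D k) (D (k + 1)) := by
  induction m with
  | zero => simp
  | succ m ih =>
    rw [← ih (by omega)]
    push_cast
    rw [← add_assoc]
    refine (turn_eq_of_eq (E.path'.red _) ?_ (E.path'.bit _)).symm
    rw [add_assoc (k + m), one_add_one_eq_two, E.step_two (by omega) (by push_cast at h'; omega)]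

lemma eq_of_cross (E₁ : DirExp n a c d₁ D₁) (E₂ : DirExp n a c d₂ D₂) (H : D₁ n ≠ D₂ (n - 1))
    (hi : i = n ∨ i = n + 1) (hj : 0 ≤ j) (hj' : j < n + 2) (h : Cross D₁ D₂ i j) :
    i = n + 1 ∧ j = n - 1 := by
  have ha := E₁.one_le
  obtain ⟨a1, a2, m, a3, a4, a5, a6⟩ := h
  have h1 : (D₂ (j - 1)).1 = c := by
    by_contra hc
    refine a2 (Prod.ext (eq_of_ne_ne (E₁.path'.red' i) (a1 ▸ (E₂.path'.red' j).symm)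
      (E₁.run' (by omega) (by omega)) (E₁.run' (by omega) (by omega)) hc) ?_)
    rw [E₁.path'.bit', E₂.path'.bit', a1]
  by_cases h2 : ∀ k : ℕ, k ≤ a → (D₂ (j + k)).1 ≠ c
  · have h3 := E₂.longest' hj hj' h1 h2
    refine ⟨hi.resolve_left ?_, h3⟩
    rintro rfl
    rw [h3] at a1
    exact H a1
  · exfalso
    push Not at h2
    obtain ⟨k, hk, hk'⟩ := h2
    have hm : m ≤ k := by
      by_contra! hm
      rw [← a4 k hm] at hk'
      exact E₁.run' (by omega) (by omega) hk'
    have := E₁.turn_const (k := i - 1) m (by omega) (by omega)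
    apply a6
    rw [sub_add_cancel] at this
    rw [← this]
    congr 2 <;> ring

lemma cross_self (E : DirExp n a c d D) : Cross D D (n + 1) (n - 1) := by
  have ha := E.one_le
  refine ⟨?_, ?_, (a + 1).toNat, by omega, fun k hk => ?_, ?_, ?_⟩
  · rw [← E.step_two (k := n - 1) (by omega) (by omega)]; congr 1; ring
  · intro h
    have h2 := E.before'
    rw [show n - 1 - 1 = n - 2 by ring] at h
    rw [← h] at h2
    exact E.run' (by omega) (by omega) h2
  · rw [← E.step_two (k := n - 1 + k) (by omega) (by omega)]; congr 1; ring
  · rw [Int.toNat_of_nonneg (by omega)]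
    intro h
    have h2 := E.after'
    rw [show n + 1 + (a + 1) = n + a + 2 by ring] at h
    rw [h] at h2
    exact E.run' (by omega) (by omega) h2
  · have h1 := E.turn_const (k := n) a.toNat (by omega) (by omega)
    rw [Int.toNat_of_nonneg (by omega)] at h1 ⊢
    rw [show n + 1 - 1 = n by ring, ← h1, show n + 1 + (a + 1) - 1 = n + a + 1 by ring,
      show n + 1 + (a + 1) = n + a + 1 + 1 by ring]
    refine turn_ne_of_third (E.path'.red _) ?_ (E.path'.red _) (E.path'.bit _)
    rw [add_assoc, add_assoc, one_add_one_eq_two, ← add_assoc, E.after']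
    exact E.run' (by omega) (by omega)

end DirExp

/-- The number of crossings of two periodic sequences, up to periods. -/
noncomputable def crossCard (d₁ d₂ : ℤ → Letter × Bool) (n : ℤ) : ℕ :=
  ((Finset.Ico 0 n ×ˢ Finset.Ico 0 n).filter fun t => Cross d₁ d₂ t.1 t.2).card

lemma DirExp.crossCard_self (E : DirExp n a c d D) :
    crossCard D D (n + 2) = crossCard d d n + 2 := by
  have ha := E.one_le
  have hn := E.two_le
  have hne : ((n + 1, n - 1) : ℤ × ℤ) ≠ (n - 1, n + 1) := by
    intro h
    have := congrArg Prod.fst h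
    dsimp at this
    omega
  have H : D n ≠ D (n - 1) := fun h => E.path'.red' n (by rw [h])
  rw [crossCard, crossCard, ← Finset.card_pair hne, ← Finset.card_union_of_disjoint]
  · congr 1
    ext ⟨i, j⟩
    simp only [Finset.mem_filter, Finset.mem_product, Finset.mem_Ico, Finset.mem_union,
      Finset.mem_insert, Prod.mk.injEq, Finset.mem_singleton]
    constructor
    · rintro ⟨⟨⟨h1, h2⟩, h3, h4⟩, h⟩
      by_cases hi : i = n ∨ i = n + 1
      · exact Or.inr (Or.inl (E.eq_of_cross E H hi h3 h4 h))
      by_cases hj : j = n ∨ j = n + 1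
      · exact Or.inr (Or.inr (E.eq_of_cross E H hj h1 h2 (h.symm E.path' E.path')).symm)
      exact Or.inl ⟨⟨⟨h1, by omega⟩, h3, by omega⟩,
        (E.cross_iff E (Or.inl rfl) h1 (by omega) h3 (by omega)).2 h⟩
    · rintro (⟨⟨⟨h1, h2⟩, h3, h4⟩, h⟩ | ⟨rfl, rfl⟩ | ⟨rfl, rfl⟩)
      · exact ⟨⟨⟨h1, by omega⟩, h3, by omega⟩, (E.cross_iff E (Or.inl rfl) h1 h2 h3 h4).1 h⟩
      · exact ⟨⟨⟨by omega, by omega⟩, by omega, by omega⟩, E.cross_self⟩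
      · exact ⟨⟨⟨by omega, by omega⟩, by omega, by omega⟩, E.cross_self.symm E.path' E.path'⟩
  · rw [Finset.disjoint_left]
    rintro ⟨i, j⟩ h h'
    simp only [Finset.mem_filter, Finset.mem_product, Finset.mem_Ico,
      Finset.mem_insert, Prod.mk.injEq, Finset.mem_singleton] at h h'
    omega

lemma DirExp.crossCard_of_ne (E₁ : DirExp n a c d₁ D₁) (E₂ : DirExp n a c d₂ D₂)
    (H : d₁ (-1) ≠ d₂ (-1)) (H₁ : d₁ 0 ≠ d₂ (-1)) (H₂ : d₂ 0 ≠ d₁ (-1)) :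
    crossCard D₁ D₂ (n + 2) = crossCard d₁ d₂ n := by
  have ha := E₁.one_le
  have hn := E₁.two_le
  have p1 : D₁ n = d₁ 0 := by
    rw [E₁.agree _ (by omega) (by omega)]; simpa using E₁.per 0
  have p2 : D₂ n = d₂ 0 := by
    rw [E₂.agree _ (by omega) (by omega)]; simpa using E₂.per 0
  have q1 : D₁ (n - 1) = d₁ (-1) := by
    rw [E₁.agree _ (by omega) (by omega), ← E₁.per (-1)]; congr 1; ring
  have q2 : D₂ (n - 1) = d₂ (-1) := by
    rw [E₂.agree _ (by omega) (by omega), ← E₂.per (-1)]; congr 1; ring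
  have r1 : D₁ (n + 1) = d₁ (-1) := by
    rw [← q1, ← E₁.step_two (k := n - 1) (by omega) (by omega)]; congr 1; ring
  have r2 : D₂ (n + 1) = d₂ (-1) := by
    rw [← q2, ← E₂.step_two (k := n - 1) (by omega) (by omega)]; congr 1; ring
  have G₁ : D₁ n ≠ D₂ (n - 1) := by rwa [p1, q2]
  have G₂ : D₂ n ≠ D₁ (n - 1) := by rwa [p2, q1]
  rw [crossCard, crossCard]
  congr 1
  ext ⟨i, j⟩
  simp only [Finset.mem_filter, Finset.mem_product, Finset.mem_Ico]
  constructor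
  · rintro ⟨⟨⟨h1, h2⟩, h3, h4⟩, h⟩
    by_cases hi : i = n ∨ i = n + 1
    · obtain ⟨rfl, rfl⟩ := E₁.eq_of_cross E₂ G₁ hi h3 h4 h
      exact absurd (r1.symm.trans (h.1.trans q2)) H
    by_cases hj : j = n ∨ j = n + 1
    · obtain ⟨rfl, rfl⟩ := E₂.eq_of_cross E₁ G₂ hj h1 h2 (h.symm E₁.path' E₂.path')
      exact absurd (q1.symm.trans (h.1.trans r2)) H
    exact ⟨⟨⟨h1, by omega⟩, h3, by omega⟩,
      (E₁.cross_iff E₂ (Or.inr H) h1 (by omega) h3 (by omega)).2 h⟩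
  · rintro ⟨⟨⟨h1, h2⟩, h3, h4⟩, h⟩
    exact ⟨⟨⟨h1, by omega⟩, h3, by omega⟩, (E₁.cross_iff E₂ (Or.inr H) h1 h2 h3 h4).1 h⟩

end

section

variable {f f' : ℤ → Letter} {n : ℕ} {v : Gamma} {w : List Letter}

lemma prodRefl_reverse (w : List Letter) : prodRefl w.reverse = (prodRefl w)⁻¹ := by
  rw [prodRefl, prodRefl, List.prod_inv_reverse, List.map_reverse, List.map_map]
  congr 2
  exact List.map_congr_left fun a _ => (refl_inv a).symm

lemma phiM_reverse (hw : Even w.length) : phiM w.reverse = (phiM w)⁻¹ :=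
  toG_injective <| by
    rw [map_inv, toG_phiM _ hw, toG_phiM _ (by rwa [List.length_reverse]), prodRefl_reverse]

lemma entry_inv (g : SL2Z) : entry g⁻¹ 0 0 = entry g 1 1 ∧ entry g⁻¹ 0 1 = -entry g 0 1 ∧
    entry g⁻¹ 1 0 = -entry g 1 0 ∧ entry g⁻¹ 1 1 = entry g 0 0 := by
  simp [entry, Matrix.SpecialLinearGroup.coe_inv, Matrix.adjugate_fin_two]

lemma fixedSet_inv_eq (g : SL2Z) : fixedSet g⁻¹ = fixedSet g := by
  obtain ⟨h1, h2, h3, h4⟩ := entry_inv g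
  ext p
  induction p using OnePoint.rec with
  | infty =>
    have (g : SL2Z) : mobius g OnePoint.infty = if entry g 1 0 = 0 then OnePoint.infty
      else OnePoint.some (entry g 0 0 / entry g 1 0) := rfl
    simp only [fixedSet, Set.mem_ofPred_eq, this, h3, neg_eq_zero]
    split_ifs <;> simp
  | coe p =>
    simp only [fixedSet, Set.mem_ofPred_eq, mobius_coe_eq_iff, IsEigen, act, wedge, toG_val]
    simp only [entry] at h1 h2 h3 h4
    rw [h1, h2, h3, h4]
    constructor <;> intro h <;> linarith

lemma hyperbolic_inv_iff (g : SL2Z) : Hyperbolic g⁻¹ ↔ Hyperbolic g :=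
  ⟨fun h => inv_inv g ▸ hyperbolic_inv h, hyperbolic_inv⟩

lemma goodConj_inv (v h : Gamma) : GoodConj v⁻¹ h ↔ GoodConj v h := by
  have : h * v⁻¹ * h⁻¹ = (h * v * h⁻¹)⁻¹ := by group
  rw [GoodConj, GoodConj, this, Subgroup.coe_inv, Subgroup.coe_inv, fixedSet_inv_eq,
    fixedSet_inv_eq,
    hyperbolic_inv_iff, hyperbolic_inv_iff]

lemma sTwo_inv (v : Gamma) : sTwo v⁻¹ = sTwo v := by
  refine Nat.card_congr (Quot.congr (Equiv.subtypeEquivRight (goodConj_inv v)) fun h h' => ?_)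
  constructor
  · rintro ⟨m, k, h⟩
    exact ⟨-m, -k, by simpa using h⟩
  · rintro ⟨m, k, h⟩
    exact ⟨-m, -k, by simpa using h⟩

lemma NotProperPower.inv (h : NotProperPower v) : NotProperPower v⁻¹ := by
  rintro ⟨u, k, hk, hv⟩
  exact h ⟨u⁻¹, k, hk, by rw [inv_pow, ← hv, inv_inv]⟩

lemma Adm.reverse (h : Adm f n) : Adm (fun k => f (-1 - k)) n where
  red k := by
    have := (h.red (-1 - (k + 1))).symm
    rwa [show -1 - (k + 1) + 1 = -1 - k by ring] at this
  per k := by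
    rw [← h.per]; congr 1; ring
  even := h.even
  four := h.four
  prim d h1 h2 h3 h4 := h.prim d h1 h2 h3 fun k => by
    have := h4 (-1 - k - d)
    simp only at this
    convert this.symm using 2 <;> ring

lemma deltaS_reverse (h : Adm f n) : deltaS (fun k => f (-1 - k)) n = deltaS f n := by
  have h0 : 0 < n := by have := h.four; omega
  let w : List Letter := List.ofFn fun i : Fin n => f i
  have hw : seqW w = f := seqW_ofFn h0 h.per
  have hl : w.length = n := by simp [w]
  have hw' : seqW w.reverse = fun k => f (-1 - k) := by
    funext k; rw [seqW_reverse, hw]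
  have hA : Adm (seqW w) w.length := by rwa [hw, hl]
  have hA' : Adm (seqW w.reverse) w.reverse.length := by
    rw [hw', List.length_reverse, hl]; exact h.reverse
  have e1 := deltaW_eq hA
  have e2 := deltaW_eq hA'
  rw [hw, hl] at e1
  rw [hw', List.length_reverse, hl] at e2
  rw [← e1, ← e2, deltaW, deltaW, Lw, Lw, List.length_reverse]
  congr 1
  obtain ⟨p, h0, hp⟩ := exists_path _ hA.red
  have hev : Even w.length := by exact_mod_cast hA.even
  have hv : toG (phiM w) = p w.length := by rw [toG_phiM w hev, prodRefl_eq_path hp h0]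
  obtain ⟨α, β, ha⟩ := hA.exists_axis (v := ⟨phiM w, phiM_mem w⟩) hp h0 hv
  have hP := ha.notProperPower hA.prim
  have : (⟨phiM w.reverse, phiM_mem _⟩ : Gamma) = (⟨phiM w, phiM_mem w⟩ : Gamma)⁻¹ :=
    Subtype.ext (phiM_reverse hev)
  rw [Iw, Iw, this, Iγ_eq hP, Iγ_eq (NotProperPower.inv hP), sTwo_inv]

end

section

variable {f f' : ℤ → Letter} {n : ℕ} {d₁ d₂ d₁' d₂' : ℤ → Letter × Bool}

/-- The same sequence of edges, with the directions changed if `b` holds. -/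
def flipBit (b : Bool) (e : Letter × Bool) : Letter × Bool := (e.1, xor b e.2)

lemma flipBit_inj {b : Bool} {e e' : Letter × Bool} : flipBit b e = flipBit b e' ↔ e = e' := by
  simp [flipBit, Prod.ext_iff]

lemma turn_flipBit (b : Bool) (e e' : Letter × Bool) :
    turn (flipBit b e) (flipBit b e') = xor b (turn e e') :=
  Bool.xor_assoc _ _ _

lemma cross_flipBit (b : Bool) (i j : ℤ) :
    Cross (fun k => flipBit b (d₁ k)) (fun k => flipBit b (d₂ k)) i j ↔ Cross d₁ d₂ i j := by
  simp [Cross, flipBit_inj, turn_flipBit]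

/-- Any two crossings in `[0, n)²` and its translates correspond to each other. -/
lemma crossCard_eq_of_bij {n s t : ℤ} (hn : 0 < n) (h₁ : ∀ k, d₁ (k + n) = d₁ k)
    (h₂ : ∀ k, d₂ (k + n) = d₂ k)
    (h : ∀ i j, Cross d₁' d₂' i j ↔ Cross d₁ d₂ (i + s) (j + t)) :
    crossCard d₁' d₂' n = crossCard d₁ d₂ n := by
  have hmod : ∀ i j, Cross d₁ d₂ (i % n) (j % n) ↔ Cross d₁ d₂ i j := fun i j => by
    apply Cross.congr <;> intro k
    · rw [← per_mul h₁ (i / n)]; congr 1; linarith [Int.emod_add_mul_ediv i n]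
    · rw [← per_mul h₂ (j / n)]; congr 1; linarith [Int.emod_add_mul_ediv j n]
  refine Finset.card_bij' (fun x _ => ((x.1 + s) % n, (x.2 + t) % n))
    (fun x _ => ((x.1 - s) % n, (x.2 - t) % n)) ?_ ?_ ?_ ?_
  · rintro ⟨i, j⟩ hx
    simp only [Finset.mem_filter, Finset.mem_product, Finset.mem_Ico] at hx ⊢
    exact ⟨⟨⟨Int.emod_nonneg _ hn.ne', Int.emod_lt_of_pos _ hn⟩,
      Int.emod_nonneg _ hn.ne', Int.emod_lt_of_pos _ hn⟩, (hmod _ _).2 ((h _ _).1 hx.2)⟩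
  · rintro ⟨i, j⟩ hx
    simp only [Finset.mem_filter, Finset.mem_product, Finset.mem_Ico] at hx ⊢
    refine ⟨⟨⟨Int.emod_nonneg _ hn.ne', Int.emod_lt_of_pos _ hn⟩,
      Int.emod_nonneg _ hn.ne', Int.emod_lt_of_pos _ hn⟩, (h _ _).2 ((hmod _ _).1 ?_)⟩
    rw [Int.emod_add_emod, Int.emod_add_emod, sub_add_cancel, sub_add_cancel, hmod]
    exact hx.2
  · rintro ⟨i, j⟩ hx
    simp only [Finset.mem_filter, Finset.mem_product, Finset.mem_Ico] at hx
    simp only [Int.emod_sub_emod, add_sub_cancel_right, Prod.mk.injEq]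
    exact ⟨Int.emod_eq_of_lt hx.1.1.1 hx.1.1.2, Int.emod_eq_of_lt hx.1.2.1 hx.1.2.2⟩
  · rintro ⟨i, j⟩ hx
    simp only [Finset.mem_filter, Finset.mem_product, Finset.mem_Ico] at hx
    simp only [Int.emod_add_emod, sub_add_cancel, Prod.mk.injEq]
    exact ⟨Int.emod_eq_of_lt hx.1.1.1 hx.1.1.2, Int.emod_eq_of_lt hx.1.2.1 hx.1.2.2⟩

lemma crossCard_shift {n : ℤ} (hn : 0 < n) (h₁ : ∀ k, d₁ (k + n) = d₁ k)
    (h₂ : ∀ k, d₂ (k + n) = d₂ k) (b : Bool) (s t : ℤ) :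
    crossCard (fun k => flipBit b (d₁ (k + s))) (fun k => flipBit b (d₂ (k + t))) n =
      crossCard d₁ d₂ n :=
  crossCard_eq_of_bij (s := s) (t := t) hn h₁ h₂ fun i j => by
    rw [cross_flipBit b (d₁ := fun k => d₁ (k + s)) (d₂ := fun k => d₂ (k + t))]
    exact Cross.congr (fun k => congrArg d₁ (by ring)) (fun k => congrArg d₂ (by ring))

lemma crossSet_card (f : ℤ → Letter) (n : ℕ) : (crossSet f n).card =
    crossCard (dirSeq f) (dirSeq f) n +
      crossCard (dirSeq f) (dirSeq fun k => f (-1 - k)) n := by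
  rw [crossSet, Finset.card_filter, Finset.sum_product, Fintype.sum_bool, crossCard, crossCard,
    Finset.card_filter, Finset.card_filter]
  rfl

lemma dirSeq_per (h : Adm f n) (k : ℤ) : dirSeq f (k + n) = dirSeq f k := by
  simp [dirSeq, h.per, Int.even_add, h.even]

lemma dirSeq_shift (f : ℤ → Letter) (s k : ℤ) :
    dirSeq (fun k => f (k + s)) k = flipBit (decide (¬Even s)) (dirSeq f (k + s)) := by
  simp only [dirSeq, flipBit, Int.even_add, Prod.mk.injEq, true_and]
  by_cases h1 : Even k <;> by_cases h2 : Even s <;> simp [h1, h2]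

lemma Adm.shift (h : Adm f n) (s : ℤ) : Adm (fun k => f (k + s)) n where
  red k := by
    have := h.red (k + s)
    rwa [add_right_comm] at this
  per k := by
    rw [← h.per (k + s), add_right_comm]
  even := h.even
  four := h.four
  prim d h1 h2 h3 h4 := h.prim d h1 h2 h3 fun k => by
    have := h4 (k - s)
    simp only at this
    rwa [add_right_comm, sub_add_cancel] at this

lemma deltaS_shift (h : Adm f n) (s : ℤ) : deltaS (fun k => f (k + s)) n = deltaS f n := by
  have hn : (0 : ℤ) < n := by have := h.four; omega
  have e1 : dirSeq (fun k => f (k + s)) =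
      fun k => flipBit (decide (¬Even s)) (dirSeq f (k + s)) := funext (dirSeq_shift f s)
  have e2 : dirSeq (fun k => f (-1 - k + s)) =
      fun k => flipBit (decide (¬Even s)) (dirSeq (fun k => f (-1 - k)) (k + -s)) := by
    have := dirSeq_shift (fun k => f (-1 - k)) (-s)
    simp only [even_neg] at this
    rw [← funext this]
    funext k
    congr 1
    funext k
    congr 1; ring
  rw [deltaS, deltaS, crossSet_card, crossSet_card, e1, e2,
    crossCard_shift hn (dirSeq_per h) (dirSeq_per h),
    crossCard_shift hn (dirSeq_per h) (dirSeq_per h.reverse)]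

end

section

variable {f f' F F' : ℤ → Letter} {n : ℕ} {c c' : Letter} {i i' l l' : ℤ}

/-- An interval of length at least `l` without the letter `c` starts at `i`. -/
def Long (f : ℤ → Letter) (c : Letter) (i l : ℤ) : Prop :=
  f (i - 1) = c ∧ ∀ x, i ≤ x → x < i + l → f x ≠ c

/-- The sequence `F` is obtained from `f` by expansion at the longest interval without the
letter `c`, which starts at `i` and has length `l`. -/
structure IsExp (f F : ℤ → Letter) (n : ℕ) (c : Letter) (i l : ℤ) : Prop where
  adm : Adm f n
  per' : ∀ k, F (k + (n + 2)) = F k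
  long : Long f c i l
  after_eq : f (i + l) = c
  two_le : 2 ≤ l
  unique : ∀ j, Long f c j l → (n : ℤ) ∣ j - i
  agree : ∀ x, i - n ≤ x → x < i + l → F x = f x

lemma Adm.pos (h : Adm f n) : (0 : ℤ) < n := by have := h.four; omega

lemma Adm.apply_of_dvd (h : Adm f n) {x y : ℤ} (hxy : (n : ℤ) ∣ x - y) : f x = f y := by
  obtain ⟨m, hm⟩ := hxy
  rw [← per_mul h.per m y]
  congr 1; linarith

lemma Adm.exists_start (h : Adm f n) {q : ℤ} (hq : ∀ x, q ≤ x → x < q + l → f x ≠ c) :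
    ∃ j ≤ q, Long f c j (l + (q - j)) := by
  obtain ⟨k, hk⟩ := h.exists_eq c
  obtain ⟨p, -, h2, h3, -⟩ := exists_mem_Ico_per h.pos h.per (q - n) k
  obtain ⟨j, ⟨hj1, hj2⟩, hj3⟩ := Int.exists_greatest_of_bdd (P := fun j => j < q ∧ f j = c)
    ⟨q, fun z hz => hz.1.le⟩ ⟨p, by omega, h3.trans hk⟩
  refine ⟨j + 1, by omega, by rwa [add_sub_cancel_right], fun x hx1 hx2 hx3 => ?_⟩
  rcases lt_or_ge x q with hx | hx
  · have := hj3 x ⟨hx, hx3⟩; omega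
  · exact hq x hx (by omega) hx3

lemma Long.congr {m p q r : ℤ} (h : ∀ x, p ≤ x → x ≤ r → F x = f x) (hp : p < q)
    (hr : ∃ y, q ≤ y ∧ y ≤ r ∧ f y = c) : Long F c q m ↔ Long f c q m := by
  have key : ∀ {f F : ℤ → Letter}, (∀ x, p ≤ x → x ≤ r → F x = f x) →
      (∃ y, q ≤ y ∧ y ≤ r ∧ f y = c) → Long f c q m → Long F c q m := by
    rintro f F h ⟨y, h1, h2, h3⟩ h4
    have h5 : q + m ≤ y := by
      by_contra h5
      exact h4.2 y h1 (by omega) h3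
    refine ⟨by rw [h _ (by omega) (by omega), h4.1], fun x hx1 hx2 => ?_⟩
    rw [h x (by omega) (by omega)]
    exact h4.2 x hx1 hx2
  refine ⟨key (fun x h1 h2 => (h x h1 h2).symm) ?_, key h hr⟩
  obtain ⟨y, h1, h2, h3⟩ := hr
  exact ⟨y, h1, h2, by rwa [h y (by omega) h2]⟩

lemma Long.primSeq (h : Long f c i l) (hu : ∀ j, Long f c j l → (n : ℤ) ∣ j - i) : PrimSeq f n := by
  intro d h1 h2 _ h4
  have := hu (i + d) ⟨by rw [← h.1, ← h4 (i - 1)]; exact congrArg f (by ring), fun x hx1 hx2 => by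
    rw [← sub_add_cancel x d, h4]
    exact h.2 _ (by omega) (by omega)⟩
  rw [add_sub_cancel_left] at this
  exact absurd (Int.le_of_dvd h1 this) (by omega)

lemma Long.mono (h : Long f c i l) (hl : l' ≤ l) : Long f c i l' :=
  ⟨h.1, fun x h1 h2 => h.2 x h1 (by omega)⟩

lemma IsExp.dvd_of_forall_ne (E : IsExp f F n c i l) {q : ℤ}
    (hq : ∀ x, q ≤ x → x < q + l → f x ≠ c) : (n : ℤ) ∣ q - i := by
  obtain ⟨j, hj, hjl⟩ := E.adm.exists_start hq
  have hd := E.unique j (hjl.mono (by omega))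
  have h1 : f (j + l) = c := by
    rw [← E.after_eq]; exact E.adm.apply_of_dvd (by convert hd using 1; ring)
  have h2 : q ≤ j := by
    by_contra h
    exact hjl.2 (j + l) (by have := E.two_le; omega) (by omega) h1
  rwa [le_antisymm hj h2] at hd

lemma IsExp.lt (E : IsExp f F n c i l) : l < n := by
  by_contra h
  refine E.long.2 (i - 1 + n) (by have := E.adm.pos; omega) (by omega) ?_
  rw [E.adm.per, E.long.1]

lemma eq_add_two (hf : ∀ k, f k ≠ f (k + 1)) {x : ℤ} (h : f x ≠ c) (h' : f (x + 1) ≠ c)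
    (h'' : f (x + 2) ≠ c) : f (x + 2) = f x := by
  have h2 := hf (x + 1)
  rw [add_assoc, one_add_one_eq_two] at h2
  exact (eq_of_ne_ne (hf x) h2 h h' h'').symm

lemma IsExp.agree' (E : IsExp f F n c i l) {x : ℤ} (h : i + 2 ≤ x) (h' : x < i + n + l + 2) :
    F x = f (x - 2) := by
  have h1 := E.agree (x - (n + 2)) (by omega) (by omega)
  have h2 := E.per' (x - (n + 2))
  rw [sub_add_cancel] at h2
  rw [h2, h1, ← E.adm.per]
  exact congrArg f (by ring)

lemma IsExp.long' (E : IsExp f F n c i l) : Long F c i (l + 2) := by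
  have hl := E.two_le
  have hn := E.adm.pos
  refine ⟨by rw [E.agree _ (by omega) (by omega), E.long.1], fun x h1 h2 => ?_⟩
  rcases lt_or_ge x (i + l) with h | h
  · rw [E.agree x (by omega) h]; exact E.long.2 x h1 h
  · rw [E.agree' (by omega) (by omega)]; exact E.long.2 _ (by omega) (by omega)

lemma IsExp.after_eq' (E : IsExp f F n c i l) : F (i + l + 2) = c := by
  have hl := E.two_le
  have hn := E.adm.pos
  rw [E.agree' (by omega) (by omega), add_sub_cancel_right, E.after_eq]

lemma IsExp.red' (E : IsExp f F n c i l) (k : ℤ) : F k ≠ F (k + 1) := by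
  have hl := E.two_le
  have hn := E.adm.pos
  obtain ⟨j, h1, h2, h3, m, h4⟩ := exists_mem_Ico_per (n := n + 2) (by omega) E.per' (i - n) k
  rw [show k + 1 = j + 1 + m * (n + 2) by linarith, per_mul E.per', ← h3, E.agree j h1 (by omega)]
  rcases lt_or_ge (j + 1) (i + 2) with h | h
  · rw [E.agree (j + 1) (by omega) (by omega)]
    exact E.adm.red j
  · have : j + 1 - 2 = i := by omega
    rw [E.agree' h (by omega), this, show j = i + 1 by omega]
    exact (E.adm.red i).symm

lemma IsExp.long_iff (E : IsExp f F n c i l) {m q : ℤ} (h : i - n < q) (h' : q < i) :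
    Long F c q m ↔ Long f c q m :=
  Long.congr (fun x h1 h2 => E.agree x h1 (show x < i + l by have := E.two_le; omega)) h
    ⟨i - 1, by omega, le_refl _, E.long.1⟩

lemma IsExp.not_long (E : IsExp f F n c i l) {m q : ℤ} (h : i < q) (h' : q ≤ i + 2) :
    ¬ Long F c q m := fun hq =>
  E.long'.2 (q - 1) (by omega) (by have := E.two_le; omega) hq.1

lemma exists_mem_Ioc_dvd {n : ℤ} (hn : 0 < n) (a q : ℤ) :
    ∃ j, a < j ∧ j ≤ a + n ∧ n ∣ q - j := by
  obtain ⟨j, h1, h2, -, h3⟩ := exists_mem_Ico_per (f := fun _ : ℤ => ()) hn (fun _ => rfl) (a + 1) q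
  exact ⟨j, by omega, by omega, h3⟩

lemma long_congr_of_dvd {n : ℤ} (hf : ∀ k, f (k + n) = f k) {m q q' : ℤ} (h : n ∣ q' - q) :
    Long f c q' m ↔ Long f c q m := by
  obtain ⟨p, hp⟩ := h
  have key : ∀ x, f (x + (q' - q)) = f x := fun x => by rw [hp, mul_comm, per_mul hf]
  refine and_congr ?_ ⟨fun H x h1 h2 => ?_, fun H x h1 h2 => ?_⟩
  · rw [← key (q - 1)]; ring_nf
  · rw [← key]; exact H _ (by omega) (by omega)
  · have := H (x - (q' - q)) (by omega) (by omega)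
    rwa [← key, sub_add_cancel] at this

lemma IsExp.unique' (E : IsExp f F n c i l) (j : ℤ) (hj : Long F c j (l + 2)) :
    ((n + 2 : ℕ) : ℤ) ∣ j - i := by
  have hn := E.adm.pos
  push_cast
  obtain ⟨q, h1, h2, h3⟩ := exists_mem_Ioc_dvd (n := n + 2) (by omega) (i - n) j
  rw [long_congr_of_dvd E.per' h3] at hj
  rcases lt_trichotomy q i with h | h | h
  · have := E.unique q (((E.long_iff h1 h).1 hj).mono (by omega))
    rw [dvd_sub_comm] at this
    exact absurd (Int.le_of_dvd (by omega) this) (by omega)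
  · rwa [h] at h3
  · exact absurd hj (E.not_long h (by omega))

lemma IsExp.adm' (E : IsExp f F n c i l) : Adm F (n + 2) where
  red := E.red'
  per := E.per'
  even := by push_cast; exact E.adm.even.add even_two
  four := by have := E.adm.four; omega
  prim := E.long'.primSeq E.unique'

lemma eq_ite_of_forall_ne (hf : ∀ k, f k ≠ f (k + 1)) (h : ∀ x, i ≤ x → x < i + l → f x ≠ c)
    (m : ℕ) (hm : m < l) : f (i + m) = if Even m then f i else f (i + 1) := by
  induction m using Nat.twoStepInduction with
  | zero => simp
  | one => simp
  | more m ih _ =>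
    push_cast at hm ⊢
    rw [← add_assoc, eq_add_two hf (h _ (by omega) (by omega)) (h _ (by omega) (by omega))
      (h _ (by omega) (by omega)), ih (by omega)]
    simp [Nat.even_add]

lemma dirPath_dirSeq (hf : ∀ k, f k ≠ f (k + 1)) : DirPath (dirSeq f) :=
  ⟨hf, fun k => by simp only [dirSeq, Int.even_add_one, decide_not]⟩

lemma DirPath.comp_add {d : ℤ → Letter × Bool} (h : DirPath d) (t : ℤ) :
    DirPath fun k => d (k + t) :=
  ⟨fun k => by simpa [add_right_comm] using h.red (k + t),
    fun k => by simpa [add_right_comm] using h.bit (k + t)⟩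

lemma IsExp.dirExp (E : IsExp f F n c (n - 1) l) : DirExp n (l - 1) c (dirSeq f) (dirSeq F) where
  path := dirPath_dirSeq E.adm.red
  path' := dirPath_dirSeq E.adm'.red
  per := dirSeq_per E.adm
  per' := by simpa using dirSeq_per E.adm'
  agree k h1 h2 := by rw [dirSeq, dirSeq, E.agree k (by omega) (by omega)]
  run k h1 h2 := by
    rw [← dirSeq_per E.adm]
    exact E.long.2 _ (by omega) (by omega)
  before := by
    rw [← E.long.1, ← dirSeq_per E.adm, dirSeq]
    exact congrArg f (by ring)
  after := by
    rw [← E.after_eq, ← dirSeq_per E.adm, dirSeq]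
    exact congrArg f (by ring)
  longest q h := by
    have := E.dvd_of_forall_ne (q := q) fun x h1 h2 => by
      obtain ⟨k, rfl⟩ : ∃ k : ℕ, x = q + k := ⟨(x - q).toNat, by omega⟩
      exact h k (by omega)
    obtain ⟨m, hm⟩ := this
    exact ⟨m + 1, by linarith⟩
  one_le := by have := E.two_le; omega
  two_le := by have := E.adm.four; omega

lemma IsExp.dirExp_reverse (E : IsExp f F n c (n - 1) l) : DirExp n (l - 1) c
    (fun y => dirSeq (fun k => f (-1 - k)) (y + (2 - n - l)))
    (fun y => dirSeq (fun k => F (-1 - k)) (y + (2 - n - l))) where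
  path := (dirPath_dirSeq E.adm.reverse.red).comp_add _
  path' := (dirPath_dirSeq E.adm'.reverse.red).comp_add _
  per k := by
    rw [add_right_comm, dirSeq_per E.adm.reverse]
  per' k := by
    rw [add_right_comm]; exact dirSeq_per E.adm'.reverse _
  agree k h1 h2 := by simp only [dirSeq]; rw [E.agree _ (by omega) (by omega)]
  run k h1 h2 := E.long.2 _ (by omega) (by omega)
  before := by
    rw [← E.after_eq]; exact congrArg f (by ring)
  after := by
    rw [← E.long.1]; exact congrArg f (by ring)
  longest q h := by
    have := E.dvd_of_forall_ne (q := n - 2 - q) fun x h1 h2 => by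
      obtain ⟨k, hk⟩ : ∃ k : ℕ, x = n - 2 - q + l - 1 - k :=
        ⟨(n - 2 - q + l - 1 - x).toNat, by omega⟩
      have h3 := h k (by omega)
      simp only [dirSeq] at h3
      rwa [show -1 - (q + k + (2 - n - l)) = x by omega] at h3
    obtain ⟨m, hm⟩ := this
    exact ⟨-m, by linarith⟩
  one_le := by have := E.two_le; omega
  two_le := by have := E.adm.four; omega

lemma IsExp.shift (E : IsExp f F n c i l) (s : ℤ) :
    IsExp (fun k => f (k + s)) (fun k => F (k + s)) n c (i - s) l where
  adm := E.adm.shift s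
  per' k := by rw [add_right_comm, E.per']
  long := ⟨by rw [← E.long.1]; exact congrArg f (by ring), fun x h1 h2 => E.long.2 _ (by omega)
    (by omega)⟩
  after_eq := by rw [← E.after_eq]; exact congrArg f (by ring)
  two_le := E.two_le
  unique j hj := by
    have := E.unique (j + s) ⟨by rw [← hj.1]; exact congrArg f (by ring), fun x h1 h2 => by
      have := hj.2 (x - s) (by omega) (by omega)
      simpa using this⟩
    convert this using 1; ring
  agree x h1 h2 := E.agree _ (by omega) (by omega)

lemma IsExp.deltaS_eq (E : IsExp f F n c i l) : deltaS F (n + 2) = deltaS f n := by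
  wlog hi : i = n - 1 generalizing f F i
  · rw [← deltaS_shift E.adm' (i - (n - 1)), ← deltaS_shift E.adm (i - (n - 1))]
    exact this (E.shift _) (by ring)
  subst hi
  have h1 := E.dirExp.crossCard_self
  have hl := E.two_le
  have halt := eq_ite_of_forall_ne (i := -1) (l := l) (c := c) E.adm.red fun x h1 h2 => by
    rw [← E.adm.per]; exact E.long.2 _ (by omega) (by omega)
  obtain ⟨m, rfl⟩ : ∃ m : ℕ, l = m + 2 := ⟨(l - 2).toNat, by omega⟩
  have ha1 := halt (m + 1) (by omega)
  have ha2 := halt m (by omega)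
  have hne := E.adm.red (-1)
  rw [show (-1 : ℤ) + 1 = 0 by ring] at *
  rw [show (-1 : ℤ) + (m + 1 : ℕ) = m by push_cast; ring, ← E.adm.per] at ha1
  simp only [Nat.even_add_one] at ha1
  rw [← E.adm.per] at ha2
  have key := E.dirExp.crossCard_of_ne E.dirExp_reverse
  simp only [dirSeq] at key
  rw [show (-1 : ℤ) - (-1 + (2 - n - (m + 2))) = m + n by ring, ha1,
    show (-1 : ℤ) - (0 + (2 - n - (m + 2))) = -1 + m + n by ring, ha2] at key
  have h2 : crossCard (dirSeq F) (fun y => dirSeq (fun k => F (-1 - k)) (y + (2 - n - (m + 2))))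
      (n + 2) = crossCard (dirSeq f)
      (fun y => dirSeq (fun k => f (-1 - k)) (y + (2 - n - (m + 2)))) n := by
    apply key <;> by_cases hm : Even m <;>
      simp [hm, hne, hne.symm, Int.even_add, Int.even_sub, E.adm.even]
  have s1 := crossCard_shift E.adm.pos (dirSeq_per E.adm) (dirSeq_per E.adm.reverse) false 0
    (2 - n - (m + 2))
  have s2 := crossCard_shift E.adm'.pos (dirSeq_per E.adm') (dirSeq_per E.adm'.reverse) false 0
    (2 - n - (m + 2))
  simp only [flipBit, Bool.false_xor, add_zero, Prod.mk.eta] at s1 s2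
  change crossCard (dirSeq f) _ _ = _ at s1
  change crossCard (dirSeq F) _ _ = _ at s2
  rw [deltaS, deltaS, crossSet_card, crossSet_card, ← s1, ← s2]
  push_cast
  rw [h1, h2]
  obtain ⟨p, hp⟩ := E.adm.even
  omega

end

section

variable {f f' F F' : ℤ → Letter} {n : ℕ} {c c' : Letter} {i i' l l' : ℤ}

/-- The sequence has a longest interval without `c`, up to periods, and every other such interval
is shorter by more than `2 * k`. -/
def Wide (f : ℤ → Letter) (n : ℕ) (c : Letter) (k : ℕ) : Prop :=
  ∃ q m : ℤ, 2 ≤ m ∧ Long f c q (m + 2 * k) ∧ ∀ j, Long f c j m → (n : ℤ) ∣ j - q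

lemma Adm.wide_iff (h : Adm f n) (a : ℤ) {k : ℕ} : Wide f n c k ↔
    ∃ q m : ℤ, a < q ∧ q ≤ a + n ∧ 2 ≤ m ∧ Long f c q (m + 2 * k) ∧
      ∀ j, a < j → j ≤ a + n → Long f c j m → j = q := by
  constructor
  · rintro ⟨q, m, h1, h2, h3⟩
    obtain ⟨p, hp1, hp2, hp3⟩ := exists_mem_Ioc_dvd h.pos a q
    refine ⟨p, m, hp1, hp2, h1, (long_congr_of_dvd h.per hp3).1 h2, fun j hj1 hj2 hj3 => ?_⟩
    have h4 := (h3 j hj3).add hp3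
    rw [sub_add_sub_cancel] at h4
    exact Int.eq_of_sub_eq_zero (Int.eq_zero_of_abs_lt_dvd h4 (by rw [abs_lt]; omega))
  · rintro ⟨q, m, h1, h2, h3, h4, h5⟩
    refine ⟨q, m, h3, h4, fun j hj => ?_⟩
    obtain ⟨p, hp1, hp2, hp3⟩ := exists_mem_Ioc_dvd h.pos a j
    rw [long_congr_of_dvd h.per hp3] at hj
    rwa [h5 p hp1 hp2 hj] at hp3

lemma Wide.mono {k k' : ℕ} (h : Wide f n c k) (hk : k' ≤ k) : Wide f n c k' := by
  obtain ⟨q, m, h1, h2, h3⟩ := h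
  exact ⟨q, m, h1, h2.mono (by omega), h3⟩

lemma Long.lt (h : Adm f n) (hl : Long f c i l) : l < n := by
  by_contra hn
  refine hl.2 (i - 1 + n) (by have := h.pos; omega) (by omega) ?_
  rw [h.per, hl.1]

lemma Wide.lt (h : Adm f n) {k : ℕ} (hw : Wide f n c k) : k < n := by
  obtain ⟨q, m, h1, h2, h3⟩ := hw
  have := h2.lt h
  omega

lemma IsExp.wide (E : IsExp f F n c i l) : Wide f n c 0 :=
  ⟨i, l, E.two_le, by simpa using E.long, E.unique⟩

lemma IsExp.le_of_long (E : IsExp f F n c i l) {m : ℤ} (h : Long f c i m) : m ≤ l := by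
  by_contra hm
  exact h.2 (i + l) (by have := E.two_le; omega) (by omega) E.after_eq

lemma IsExp.le_of_long' (E : IsExp f F n c i l) {m : ℤ} (h : Long F c i m) : m ≤ l + 2 := by
  by_contra hm
  refine h.2 (i + (l + 2)) (by have := E.two_le; omega) (by omega) ?_
  rw [← add_assoc, E.after_eq']

lemma IsExp.wide_succ_iff (E : IsExp f F n c i l) {k : ℕ} :
    Wide F (n + 2) c (k + 1) ↔ Wide f n c k := by
  have hl := E.two_le
  have hn := E.adm.pos
  rw [E.adm'.wide_iff (i - n), E.adm.wide_iff (i - n)]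
  push_cast
  constructor
  · rintro ⟨q, m, h1, h2, h3, h4, h5⟩
    have hq : q ≤ i := by
      by_contra h
      exact E.not_long (by omega) (by omega) h4
    refine ⟨q, m, h1, by omega, h3, ?_, fun j hj1 hj2 hj3 => h5 j hj1 (by omega) ?_⟩
    · rcases hq.lt_or_eq with hq | rfl
      · exact ((E.long_iff h1 hq).1 h4).mono (by omega)
      · have := E.le_of_long' h4
        exact E.long.mono (by omega)
    · rcases lt_or_eq_of_le (show j ≤ i by omega) with hj | rfl
      · exact (E.long_iff hj1 hj).2 hj3
      · have := E.le_of_long hj3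
        exact E.long'.mono (by omega)
  · rintro ⟨q, m, h1, h2, h3, h4, h5⟩
    have hq : q = i := by
      rcases lt_or_eq_of_le (show q ≤ i by omega) with hq | hq
      · have hm : l ≤ m := by
          by_contra hm
          exact hq.ne' (h5 i (by omega) (by omega) (E.long.mono (by omega)))
        have := E.unique q (h4.mono (by omega))
        rw [dvd_sub_comm] at this
        exact absurd (Int.le_of_dvd (by omega) this) (by omega)
      · exact hq
    subst hq
    have hm := E.le_of_long h4
    refine ⟨q, m, h1, by omega, h3, E.long'.mono (by omega), fun j hj1 hj2 hj3 => ?_⟩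
    rcases lt_trichotomy j q with hj | hj | hj
    · exact h5 j hj1 (by omega) ((E.long_iff hj1 hj).1 hj3)
    · exact hj
    · exact absurd hj3 (E.not_long hj (by omega))

lemma IsExp.wide_iff_of_ne (E : IsExp f F n c i l) (hc : c' ≠ c) {k : ℕ} :
    Wide F (n + 2) c' k ↔ Wide f n c' k := by
  have hl := E.two_le
  have hn := E.adm.pos
  have hex : ∃ y, i ≤ y ∧ y ≤ i + 1 ∧ f y = c' := by
    by_cases h : f i = c'
    · exact ⟨i, le_rfl, by omega, h⟩
    · refine ⟨i + 1, by omega, le_rfl, ?_⟩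
      by_contra h'
      have h1 := E.long.2 i le_rfl (by omega)
      have h2 := E.long.2 (i + 1) (by omega) (by omega)
      exact E.adm.red i (eq_of_ne_ne h (Ne.symm h') h1 hc h2)
  have hiff : ∀ q m, i - n < q → q ≤ i → (Long F c' q m ↔ Long f c' q m) := fun q m h1 h2 => by
    obtain ⟨y, hy1, hy2, hy3⟩ := hex
    exact Long.congr (fun x h1 h2 => E.agree x h1 (by omega)) h1 ⟨y, by omega, hy2, hy3⟩
  have hnot : ∀ q m, 2 ≤ m → i < q → q ≤ i + 2 → ¬ Long F c' q m := fun q m hm h1 h2 h => by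
    have h3 := eq_add_two E.red' (x := q - 1) (c := c) (E.long'.2 _ (by omega) (by omega))
      (E.long'.2 _ (by omega) (by omega)) (E.long'.2 _ (by omega) (by omega))
    rw [h.1] at h3
    exact h.2 _ (by omega) (by omega) h3
  rw [E.adm'.wide_iff (i - n), E.adm.wide_iff (i - n)]
  push_cast
  constructor
  · rintro ⟨q, m, h1, h2, h3, h4, h5⟩
    have hq : q ≤ i := by
      by_contra h
      exact hnot q _ (by omega) (by omega) (by omega) h4
    exact ⟨q, m, h1, by omega, h3, (hiff q _ h1 hq).1 h4, fun j hj1 hj2 hj3 =>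
      h5 j hj1 (by omega) ((hiff j m hj1 (by omega)).2 hj3)⟩
  · rintro ⟨q, m, h1, h2, h3, h4, h5⟩
    refine ⟨q, m, h1, by omega, h3, (hiff q _ h1 (by omega)).2 h4, fun j hj1 hj2 hj3 => ?_⟩
    have hj : j ≤ i := by
      by_contra h
      exact hnot j m h3 (by omega) (by omega) hj3
    exact h5 j hj1 (by omega) ((hiff j m hj1 hj).1 hj3)

end

section

variable {f f' F F' : ℤ → Letter} {n : ℕ} {c c' : Letter} {i i' l l' : ℤ}

/-- Two sequences agree up to an even shift and the corresponding reversal. -/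
def SeqEquiv (f f' : ℤ → Letter) : Prop :=
  ∃ (ε : Bool) (s : ℤ), Even s ∧ ∀ k, f' k = flipL f ε (k + s)

lemma SeqEquiv.symm (h : SeqEquiv f f') : SeqEquiv f' f := by
  obtain ⟨ε, s, hs, h⟩ := h
  cases ε
  · refine ⟨false, s, hs, fun k => ?_⟩
    simp only [flipL, cond_false, h]
    exact congrArg f (by ring)
  · refine ⟨true, -s, hs.neg, fun k => ?_⟩
    simp only [flipL, cond_true, h]
    exact congrArg f (by ring)

lemma SeqEquiv.trans {f'' : ℤ → Letter} (h : SeqEquiv f f') (h' : SeqEquiv f' f'') :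
    SeqEquiv f f'' := by
  obtain ⟨ε, s, hs, h⟩ := h
  obtain ⟨ε', s', hs', h'⟩ := h'
  cases ε <;> cases ε' <;> simp only [flipL, cond_true, cond_false] at h h'
  · refine ⟨true, s' - s, hs'.sub hs, fun k => ?_⟩
    simp only [flipL, cond_true, h', h]
    exact congrArg f (by ring)
  · refine ⟨false, s' + s, hs'.add hs, fun k => ?_⟩
    simp only [flipL, cond_false, h', h]
    exact congrArg f (by ring)
  · refine ⟨false, s' - s, hs'.sub hs, fun k => ?_⟩
    simp only [flipL, cond_false, h', h]
    exact congrArg f (by ring)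
  · refine ⟨true, s' + s, hs'.add hs, fun k => ?_⟩
    simp only [flipL, cond_true, h', h]
    exact congrArg f (by ring)

lemma SeqEquiv.adm (h : SeqEquiv f f') (hf : Adm f n) : Adm f' n := by
  obtain ⟨ε, s, hs, h⟩ := h
  obtain rfl : f' = fun k => flipL f ε (k + s) := funext h
  cases ε
  · exact hf.reverse.shift s
  · exact hf.shift s

lemma SeqEquiv.deltaS_eq (h : SeqEquiv f f') (hf : Adm f n) : deltaS f' n = deltaS f n := by
  obtain ⟨ε, s, hs, h⟩ := h
  obtain rfl : f' = fun k => flipL f ε (k + s) := funext h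
  cases ε
  · exact (deltaS_shift hf.reverse s).trans (deltaS_reverse hf)
  · exact deltaS_shift hf s

lemma IsExp.reverse (E : IsExp f F n c i l) :
    IsExp (fun k => f (-1 - k)) (fun k => F (1 - k)) n c (-i - l) l where
  adm := E.adm.reverse
  per' k := by rw [← E.per']; exact congrArg F (by ring)
  long := ⟨by rw [← E.after_eq]; exact congrArg f (by ring), fun x h1 h2 => E.long.2 _ (by omega)
    (by omega)⟩
  after_eq := by rw [← E.long.1]; exact congrArg f (by ring)
  two_le := E.two_le
  unique j hj := by
    obtain ⟨m, hm⟩ := E.dvd_of_forall_ne (q := -j - l) fun x h1 h2 => by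
      have := hj.2 (-1 - x) (by omega) (by omega)
      simpa using this
    exact ⟨-m, by linarith⟩
  agree x h1 h2 := by
    rw [E.agree' (by omega) (by omega)]
    exact congrArg f (by ring)

lemma IsExp.flip (E : IsExp f F n c i l) (ε : Bool) (s : ℤ) : ∃ i',
    IsExp (fun k => flipL f ε (k + s)) (fun k => flipL F ε (k + s - cond ε 0 2)) n c i' l := by
  cases ε
  · refine ⟨-i - l - s, ?_⟩
    convert E.reverse.shift s using 2 with k
    · rfl
    · simp only [flipL, cond_false]
      exact congrArg F (by ring)
  · refine ⟨i - s, ?_⟩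
    convert E.shift s using 2 with k
    · rfl
    · simp only [flipL, cond_true]
      exact congrArg F (by ring)

lemma IsExp.exists_of_equiv (E : IsExp f F n c i l) (h : SeqEquiv f f') :
    ∃ F' i', IsExp f' F' n c i' l ∧ SeqEquiv F F' := by
  obtain ⟨ε, s, hs, h⟩ := h
  obtain rfl : f' = fun k => flipL f ε (k + s) := funext h
  obtain ⟨i', E'⟩ := E.flip ε s
  refine ⟨_, i', E', ε, s - cond ε 0 2, hs.sub (by cases ε <;> simp), fun k => ?_⟩
  exact congrArg (flipL F ε) (by ring)

lemma IsExp.exists_of_equiv' (E : IsExp f F n c i l) (h : SeqEquiv F F') :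
    ∃ f' i', IsExp f' F' n c i' l ∧ SeqEquiv f f' := by
  obtain ⟨ε, s, hs, h⟩ := h
  obtain rfl : F' = fun k => flipL F ε (k + s) := funext h
  obtain ⟨i', E'⟩ := E.flip ε (s + cond ε 0 2)
  refine ⟨_, i', ?_, ε, s + cond ε 0 2, hs.add (by cases ε <;> simp), fun k => rfl⟩
  convert E' using 3
  ring

lemma IsExp.length_eq (E : IsExp f F n c i l) (E' : IsExp f F' n c i' l') : l = l' := by
  have key : ∀ {F F' : ℤ → Letter} {i i' l l' : ℤ}, IsExp f F n c i l → IsExp f F' n c i' l' →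
      l' ≤ l := fun {F F' i i' l l'} E E' => by
    by_contra! h
    exact h.not_ge (E.le_of_long ((long_congr_of_dvd E.adm.per (E.unique i' (E'.long.mono h.le))).1
      E'.long))
  exact le_antisymm (key E' E) (key E E')

lemma IsExp.equiv_right (E : IsExp f F n c i l) (E' : IsExp f F' n c i' l') : SeqEquiv F F' := by
  obtain rfl := E.length_eq E'
  obtain ⟨m, hm⟩ := E.unique i' E'.long
  refine ⟨true, -(n * m), (E.adm.even.mul_right m).neg, congrFun ?_⟩
  refine eq_of_per (n := n + 2) (by have := E.adm.pos; omega) E'.per' (fun k => ?_) (i' - n)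
    fun k h1 h2 => ?_
  · rw [add_right_comm]; exact E.per' _
  · have := E.two_le
    simp only [flipL, cond_true]
    rw [E'.agree k (by omega) (by omega), E.agree _ (by omega) (by omega), mul_comm, ← neg_mul,
      per_mul E.adm.per]

lemma IsExp.equiv_left (E : IsExp f F n c i l) (E' : IsExp f' F n c i' l') : SeqEquiv f f' := by
  have key : ∀ {f f' : ℤ → Letter} {i i' l l' : ℤ}, IsExp f F n c i l → IsExp f' F n c i' l' →
      l' ≤ l := fun {f f' i i' l l'} E E' => by
    by_contra! h
    have := E.le_of_long' ((long_congr_of_dvd E.adm'.per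
      (E.unique' i' (E'.long'.mono (by omega)))).1 E'.long')
    omega
  obtain rfl := le_antisymm (key E' E) (key E E')
  obtain ⟨m, hm⟩ := E.unique' i' E'.long'
  push_cast at hm
  refine ⟨true, -((n + 2) * m), ((E.adm.even.add even_two).mul_right m).neg, congrFun ?_⟩
  refine eq_of_per E.adm.pos E'.adm.per (fun k => ?_) (i' - n) fun k h1 h2 => ?_
  · rw [add_right_comm]; exact E.adm.per _
  · have := E.two_le
    simp only [flipL, cond_true]
    rw [← E'.agree k (by omega) (by omega), ← E.agree _ (by omega) (by omega), mul_comm, ← neg_mul,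
      per_mul E.per']

end

section

variable {f f' F F' : ℤ → Letter} {n : ℕ} {c c' : Letter} {i i' l l' : ℤ}

lemma Long.exists_maximal (h : Adm f n) (hl : Long f c i l) :
    ∃ l' ≥ l, Long f c i l' ∧ f (i + l') = c := by
  have h1 := hl.lt h
  obtain ⟨p, ⟨hp1, hp2⟩, hp3⟩ := Int.exists_least_of_bdd (P := fun p => l ≤ p ∧ f (i + p) = c)
    ⟨l, fun z hz => hz.1⟩ ⟨n - 1, by omega, by rw [← hl.1, ← h.per (i - 1)]; congr 1; ring⟩
  refine ⟨p, hp1, ⟨hl.1, fun x hx1 hx2 hx3 => ?_⟩, hp2⟩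
  rcases lt_or_ge x (i + l) with hx | hx
  · exact hl.2 x hx1 hx hx3
  · have := hp3 (x - i) ⟨by omega, by rwa [add_sub_cancel]⟩
    omega

lemma Long.le_of_apply_eq (h : Long f c i l) (h' : f (i + l') = c) (hl' : 0 ≤ l') : l ≤ l' := by
  by_contra hlt
  exact h.2 _ (by omega) (by omega) h'

lemma Wide.reverse (h : Adm f n) {k : ℕ} (hw : Wide f n c k) :
    Wide (fun x => f (-1 - x)) n c k := by
  obtain ⟨q, m, h1, h2, h3⟩ := hw
  obtain ⟨p, hp1, hp2, hp3⟩ := h2.exists_maximal h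
  have hrev : ∀ {j p : ℤ}, Long f c j p → f (j + p) = c → Long (fun x => f (-1 - x)) c (-j - p) p :=
    fun {j p} h h' => ⟨by rw [← h']; exact congrArg f (by ring), fun x hx1 hx2 =>
      h.2 _ (by omega) (by omega)⟩
  refine ⟨-q - p, m, h1, (hrev hp2 hp3).mono hp1, fun j hj => ?_⟩
  have hc : f (-j) = c := by rw [← hj.1]; exact congrArg f (by ring)
  obtain ⟨i, hi1, hi2⟩ := h.exists_start (c := c) (q := -j - m) (l := m) fun x hx1 hx2 => by
    simpa using hj.2 (-1 - x) (by omega) (by omega)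
  have hd := h3 i (hi2.mono (by omega))
  have e1 := hi2.le_of_apply_eq (l' := p) (by
    rw [← hp3]; exact h.apply_of_dvd (by convert hd using 1; ring)) (by omega)
  have e2 := ((long_congr_of_dvd h.per hd).2 hp2).le_of_apply_eq (l' := -j - i)
    (by rwa [add_sub_cancel]) (by omega)
  obtain ⟨t, ht⟩ := hd
  exact ⟨-t, by linarith⟩

lemma Wide.shift {k : ℕ} (hw : Wide f n c k) (s : ℤ) : Wide (fun x => f (x + s)) n c k := by
  obtain ⟨q, m, h1, h2, h3⟩ := hw
  have key : ∀ {j p : ℤ}, Long (fun x => f (x + s)) c (j - s) p ↔ Long f c j p := fun {j p} => by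
    refine and_congr (by ring_nf) ⟨fun H x hx1 hx2 => ?_, fun H x hx1 hx2 =>
      H _ (by omega) (by omega)⟩
    simpa using H (x - s) (by omega) (by omega)
  refine ⟨q - s, m, h1, key.2 h2, fun j hj => ?_⟩
  have := h3 (j + s) (key.1 (by simpa using hj))
  convert this using 1; ring

lemma SeqEquiv.wide_iff (h : SeqEquiv f f') (hf : Adm f n) {k : ℕ} :
    Wide f' n c k ↔ Wide f n c k := by
  have key : ∀ {f f' : ℤ → Letter}, SeqEquiv f f' → Adm f n → Wide f n c k → Wide f' n c k := by
    intro f f' h hf hw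
    obtain ⟨ε, s, hs, h⟩ := h
    obtain rfl : f' = fun k => flipL f ε (k + s) := funext h
    cases ε
    · exact (hw.reverse hf).shift s
    · exact hw.shift s
  exact ⟨key h.symm (h.adm hf), key h hf⟩

/-- The sequence of period `n` which agrees with `f` on `[a, a + n)`. -/
def repeatSeq (f : ℤ → Letter) (a n : ℤ) (x : ℤ) : Letter := f (a + (x - a) % n)

lemma repeatSeq_per (f : ℤ → Letter) (a n k : ℤ) : repeatSeq f a n (k + n) = repeatSeq f a n k := by
  rw [repeatSeq, repeatSeq, show k + n - a = k - a + n by ring, Int.add_emod_right]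

lemma repeatSeq_of_mem {a n x : ℤ} (h : a ≤ x) (h' : x < a + n) : repeatSeq f a n x = f x := by
  rw [repeatSeq, Int.emod_eq_of_lt (by omega) (by omega), add_sub_cancel]

lemma Adm.exists_isExp (h : Adm f n) (hw : Wide f n c 0) : ∃ F i l, IsExp f F n c i l := by
  obtain ⟨q, m, h1, h2, h3⟩ := hw
  obtain ⟨l, hl1, hl2, hl3⟩ := h2.exists_maximal h
  push_cast at hl1
  have hl := hl2.lt h
  have hp := h.pos
  refine ⟨repeatSeq f (q - n) (n + 2), q, l, h, repeatSeq_per _ _ _, hl2, hl3, by omega,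
    fun j hj => h3 j (hj.mono (by omega)), fun x hx1 hx2 => ?_⟩
  rcases lt_or_ge x (q + 2) with hx | hx
  · exact repeatSeq_of_mem hx1 (by omega)
  · rw [← sub_add_cancel x (n + 2), repeatSeq_per, repeatSeq_of_mem (by omega) (by omega),
      ← h.per, sub_add_cancel]
    have := eq_add_two h.red (x := x - 2) (hl2.2 _ (by omega) (by omega))
      (hl2.2 _ (by omega) (by omega)) (hl2.2 _ (by omega) (by omega))
    rw [sub_add_cancel] at this
    rw [this]
    exact congrArg f (by ring)

lemma Adm.exists_isExp_of_wide_one {N : ℕ} (h : Adm F N) (hw : Wide F N c 1) :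
    ∃ n f i l, N = n + 2 ∧ IsExp f F n c i l := by
  obtain ⟨q, m, h1, h2, h3⟩ := hw
  obtain ⟨L, hL1, hL2, hL3⟩ := h2.exists_maximal h
  push_cast at hL1
  have hL := hL2.lt h
  obtain ⟨n, rfl⟩ : ∃ n, N = n + 2 := ⟨N - 2, by omega⟩
  obtain ⟨l, rfl⟩ : ∃ l, L = l + 2 := ⟨L - 2, by ring⟩
  push_cast at hL h3
  have hper : ∀ k, F (k + (n + 2)) = F k := by exact_mod_cast h.per
  have hev : Even (n : ℤ) := by simpa [Int.even_add] using h.even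
  have hn : 4 ≤ n := by
    obtain ⟨t, ht⟩ := hev
    omega
  set f := repeatSeq F (q - n) n with hf
  have hf1 : ∀ x, q - n ≤ x → x < q + l → f x = F x := fun x hx1 hx2 => by
    rcases lt_or_ge x q with hx | hx
    · exact repeatSeq_of_mem hx1 (by omega)
    · have e : f x = F (x - n) := by
        rw [← sub_add_cancel x n, hf, repeatSeq_per, repeatSeq_of_mem (by omega) (by omega),
          sub_add_cancel]
      rw [e, ← hper, ← eq_add_two h.red (hL2.2 x (by omega) (by omega))
        (hL2.2 _ (by omega) (by omega)) (hL2.2 _ (by omega) (by omega))]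
      exact congrArg F (by ring)
  have hlong : Long f c q l := ⟨by rw [hf1 _ (by omega) (by omega), hL2.1], fun x hx1 hx2 => by
    rw [hf1 x (by omega) hx2]; exact hL2.2 x hx1 (by omega)⟩
  have hfper : ∀ k, f (k + n) = f k := repeatSeq_per F _ _
  have hu : ∀ j, Long f c j l → (n : ℤ) ∣ j - q := fun j hj => by
    obtain ⟨p, hp1, hp2, hp3⟩ := exists_mem_Ioc_dvd (n := n) (by omega) (q - n) j
    rw [long_congr_of_dvd hfper hp3] at hj
    rcases lt_or_eq_of_le (show p ≤ q by omega) with hp | rfl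
    · have := h3 p (((Long.congr (p := q - n) (r := q - 1) (fun x hx1 hx2 => hf1 x hx1 (by omega))
        hp1 ⟨q - 1, by omega, le_rfl, hL2.1⟩).1 hj).mono (by omega))
      rw [dvd_sub_comm] at this
      exact absurd (Int.le_of_dvd (by omega) this) (by omega)
    · exact hp3
  refine ⟨n, f, q, l, rfl, ⟨fun k => ?_, hfper, hev, hn, hlong.primSeq hu⟩, hper, hlong, ?_,
    by omega, hu, fun x hx1 hx2 => (hf1 x hx1 hx2).symm⟩
  · obtain ⟨j, hj1, hj2, hj3, t, ht⟩ := exists_mem_Ico_per (n := n) (by omega) hfper (q - n) k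
    rw [show k + 1 = j + 1 + t * n by linarith, per_mul hfper, ← hj3, hf1 j hj1 (by omega),
      hf1 _ (by omega) (by omega)]
    exact h.red j
  · rw [← sub_add_cancel (q + l) n, hfper, hf1 _ (by omega) (by omega), ← hL3, ← hper]
    exact congrArg F (by ring)

end

section

variable {f : ℤ → Letter} {n : ℕ} {c c' : Letter} {i i' l l' : ℤ} {w : List Letter}

/-- A maximal interval without the letter `c`, of length `l ≥ 2`, starts at `i`. -/
def Gap (f : ℤ → Letter) (c : Letter) (i l : ℤ) : Prop :=
  2 ≤ l ∧ Long f c i l ∧ f (i + l) = c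

lemma Gap.length_unique (h : Gap f c i l) (h' : Gap f c i l') : l = l' :=
  le_antisymm (h.2.1.le_of_apply_eq h'.2.2 (by have := h'.1; omega))
    (h'.2.1.le_of_apply_eq h.2.2 (by have := h.1; omega))

lemma Gap.eq_of_ne (hf : ∀ k, f k ≠ f (k + 1)) (h : Gap f c i l) (h1 : f i ≠ c')
    (h2 : f (i + 1) ≠ c') : c = c' := by
  have hl := h.1
  exact eq_of_ne_ne (h.2.1.2 i le_rfl (by omega)).symm h1
    (h.2.1.2 (i + 1) (by omega) (by omega)).symm (hf i) h2.symm

lemma Gap.letter_unique (hf : ∀ k, f k ≠ f (k + 1)) (h : Gap f c i l) (h' : Gap f c' i l') :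
    c = c' :=
  have hl := h'.1
  h.eq_of_ne hf (h'.2.1.2 i le_rfl (by omega)) (h'.2.1.2 (i + 1) (by omega) (by omega))

lemma Adm.wide_iff_gap (h : Adm f n) {k : ℕ} : Wide f n c k ↔
    ∃ i l : ℕ, i < n ∧ 2 + 2 * k ≤ l ∧ Gap f c i l ∧
      ∀ i' l' : ℕ, i' < n → Gap f c i' l' → i' ≠ i → l' + 2 * k < l := by
  rw [h.wide_iff (-1)]
  constructor
  · rintro ⟨q, m, h1, h2, h3, h4, h5⟩
    obtain ⟨l, hl1, hl2, hl3⟩ := h4.exists_maximal h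
    lift q to ℕ using (by omega)
    lift l to ℕ using (by omega)
    refine ⟨q, l, by omega, by omega, ⟨by omega, hl2, hl3⟩, fun i' l' hi hg hne => ?_⟩
    by_contra hlt
    exact hne (by exact_mod_cast h5 i' (by omega) (by omega) (hg.2.1.mono (by omega)))
  · rintro ⟨i, l, h1, h2, h3, h4⟩
    refine ⟨i, l - 2 * k, by omega, by omega, by omega, by simpa using h3.2.1,
      fun j hj1 hj2 hj3 => ?_⟩
    obtain ⟨l', hl1, hl2, hl3⟩ := hj3.exists_maximal h
    lift j to ℕ using (by omega)
    lift l' to ℕ using (by omega)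
    by_contra hne
    have := h4 j l' (by omega) ⟨by omega, hl2, hl3⟩ (by exact_mod_cast hne)
    omega

lemma exists_eq_compl_of_card {T : Finset Letter} (h : T.card = 2) : ∃ c, ∀ a, a ∈ T ↔ a ≠ c := by
  obtain ⟨c, hc⟩ := Finset.card_eq_one.1 (show Tᶜ.card = 1 by rw [Finset.card_compl, h]; rfl)
  refine ⟨c, fun a => ?_⟩
  rw [ne_eq, ← Finset.mem_singleton, ← hc, Finset.mem_compl, not_not]

lemma exists_card_eq_two (c : Letter) : ∃ T : Finset Letter, T.card = 2 ∧ ∀ a, a ∈ T ↔ a ≠ c :=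
  ⟨{c}ᶜ, by rw [Finset.card_compl]; rfl, by simp⟩

lemma exists_card_two_iff {p m : ℕ} :
    (∃ T : Finset Letter, T.card = 2 ∧ ∀ j, j < m → cget w (p + j) ∈ T) ↔
      ∃ c, ∀ j, j < m → seqW w (p + j) ≠ c := by
  constructor
  · rintro ⟨T, hT, h⟩
    obtain ⟨c, hc⟩ := exists_eq_compl_of_card hT
    exact ⟨c, fun j hj => by rw [← Nat.cast_add, seqW_natCast]; exact (hc _).1 (h j hj)⟩
  · rintro ⟨c, h⟩
    obtain ⟨T, hT, hc⟩ := exists_card_eq_two c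
    exact ⟨T, hT, fun j hj => by rw [hc, ← seqW_natCast, Nat.cast_add]; exact h j hj⟩

lemma runAt_iff (h : Adm (seqW w) w.length) {i len : ℕ} :
    RunAt w i len ↔ i < w.length ∧ ∃ c, Gap (seqW w) c i len := by
  rw [RunAt]
  simp only [exists_card_two_iff]
  have hn := h.pos
  have hpre : ∀ x, seqW w ((i + w.length - 1 : ℕ) + x) = seqW w (i - 1 + x) := fun x => by
    rw [← seqW_add w (i - 1 + x)]
    congr 1; omega
  simp only [hpre]
  constructor
  · rintro ⟨h1, h2, h3, ⟨c, h4⟩, h5, h6⟩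
    refine ⟨h1, c, by omega, ⟨?_, fun x hx1 hx2 => ?_⟩, ?_⟩
    · by_contra hne
      refine h6 ⟨c, fun j hj => ?_⟩
      rcases j with _ | j
      · simpa using hne
      · convert h4 j (by omega) using 2
        push_cast; ring
    · obtain ⟨j, rfl⟩ : ∃ j : ℕ, x = i + j := ⟨(x - i).toNat, by omega⟩
      exact h4 j (by omega)
    · by_contra hne
      refine h5 ⟨c, fun j hj => ?_⟩
      rcases Nat.lt_succ_iff_lt_or_eq.1 hj with hj | rfl
      · exact h4 j hj
      · exact hne
  · rintro ⟨h1, c, hg⟩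
    have hl := hg.1
    have hlt := hg.2.1.lt h
    refine ⟨h1, by omega, by omega, ⟨c, fun j hj => hg.2.1.2 _ (by omega) (by omega)⟩, ?_, ?_⟩
    · rintro ⟨d, hd⟩
      obtain rfl := hg.eq_of_ne h.red (by simpa using hd 0 (by omega))
        (by simpa using hd 1 (by omega))
      exact hd len (by omega) hg.2.2
    · rintro ⟨d, hd⟩
      obtain rfl := hg.eq_of_ne h.red (by simpa using hd 1 (by omega))
        (by convert hd 2 (by omega) using 2; push_cast; ring)
      exact hd 0 (by omega) (by simpa using hg.2.1.1)

lemma mem_runType (h : Adm (seqW w) w.length) {i len : ℕ} (hg : Gap (seqW w) c i len) (a : Letter) :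
    a ∈ runType w i ↔ a ≠ c := by
  have hl := hg.1
  have h1 := hg.2.1.2 i le_rfl (by omega)
  have h2 := hg.2.1.2 (i + 1) (by omega) (by omega)
  have h3 := h.red i
  rw [runType, Finset.mem_insert, Finset.mem_singleton, ← seqW_natCast, ← seqW_natCast]
  push_cast
  constructor
  · rintro (rfl | rfl) <;> assumption
  · intro ha
    by_contra! hne
    exact ha (hg.eq_of_ne h.red hne.1.symm hne.2.symm).symm

lemma runType_eq_iff (h : Adm (seqW w) w.length) {i len i' len' : ℕ} (hg : Gap (seqW w) c i len)
    (hg' : Gap (seqW w) c' i' len') : runType w i' = runType w i ↔ c' = c := by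
  simp only [Finset.ext_iff, mem_runType h hg, mem_runType h hg']
  refine ⟨fun H => ?_, fun H => by simp [H]⟩
  simpa [eq_comm] using (H c).not

lemma motifCond_iff (h : Adm (seqW w) w.length) :
    MotifCond w ↔ ∀ c, ¬ Wide (seqW w) w.length c 1 := by
  simp only [h.wide_iff_gap]
  constructor
  · rintro hm c ⟨i, l, h1, h2, h3, h4⟩
    obtain ⟨i', l', h5, h6, h7, h8⟩ := hm i l ((runAt_iff h).2 ⟨h1, c, h3⟩) (by omega)
    obtain ⟨h9, c', h10⟩ := (runAt_iff h).1 h5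
    obtain rfl := (runType_eq_iff h h3 h10).1 h6
    have := h4 i' l' h9 h10 h7
    omega
  · intro H i l hr h4
    obtain ⟨h1, c, h2⟩ := (runAt_iff h).1 hr
    by_contra! hc
    refine H c ⟨i, l, h1, h4, h2, fun i' l' h5 h6 h7 => ?_⟩
    exact hc i' l' ((runAt_iff h).2 ⟨h5, c, h6⟩) ((runType_eq_iff h h2 h6).2 rfl) h7

lemma distinguishedRun_iff (h : Adm (seqW w) w.length) {i l : ℕ} :
    DistinguishedRun w i l ↔ ∃ c, i < w.length ∧ Gap (seqW w) c i l ∧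
      ∀ i' l' : ℕ, i' < w.length → Gap (seqW w) c i' l' → i' ≠ i → l' < l := by
  rw [DistinguishedRun, runAt_iff h]
  constructor
  · rintro ⟨⟨h1, c, h2⟩, h3⟩
    exact ⟨c, h1, h2, fun i' l' h4 h5 => h3 i' l' ((runAt_iff h).2 ⟨h4, c, h5⟩)
      ((runType_eq_iff h h2 h5).2 rfl)⟩
  · rintro ⟨c, h1, h2, h3⟩
    refine ⟨⟨h1, c, h2⟩, fun i' l' h4 h5 => ?_⟩
    obtain ⟨h6, c', h7⟩ := (runAt_iff h).1 h4
    obtain rfl := (runType_eq_iff h h2 h7).1 h5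
    exact h3 i' l' h6 h7

lemma rank_eq (h : Adm (seqW w) w.length) :
    rank w = Nat.card {c // Wide (seqW w) w.length c 0} := by
  have hex : ∀ c : {c // Wide (seqW w) w.length c 0}, ∃ p : ℕ × ℕ, p.1 < w.length ∧
      Gap (seqW w) c p.1 p.2 ∧
      ∀ i' l' : ℕ, i' < w.length → Gap (seqW w) c i' l' → i' ≠ p.1 → l' < p.2 := fun c => by
    obtain ⟨i, l, h1, h2, h3, h4⟩ := h.wide_iff_gap.1 c.2
    exact ⟨(i, l), h1, h3, h4⟩
  choose p hp1 hp2 hp3 using hex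
  refine (Nat.card_eq_of_bijective (fun c => ⟨p c, (distinguishedRun_iff h).2
    ⟨c, hp1 c, hp2 c, hp3 c⟩⟩) ⟨fun c c' hcc => ?_, ?_⟩).symm
  · have h1 : p c = p c' := congrArg Subtype.val hcc
    have h2 := hp2 c'
    rw [← h1] at h2
    exact Subtype.ext ((hp2 c).letter_unique h.red h2)
  · rintro ⟨⟨i, l⟩, hd⟩
    obtain ⟨c, h1, h2, h3⟩ := (distinguishedRun_iff h).1 hd
    have h4 : Wide (seqW w) w.length c 0 := h.wide_iff_gap.2 ⟨i, l, h1, by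
      have := h2.1; omega, h2, h3⟩
    refine ⟨⟨c, h4⟩, Subtype.ext ?_⟩
    have h5 := hp2 ⟨c, h4⟩
    by_cases hi : i = (p ⟨c, h4⟩).1
    · rw [← hi] at h5
      exact Prod.ext hi.symm (by exact_mod_cast h5.length_unique h2)
    · have h6 := hp3 ⟨c, h4⟩ i l h1 h2 hi
      have h7 := h3 _ _ (hp1 ⟨c, h4⟩) h5 (Ne.symm hi)
      omega

end

section

variable {f f' F F' : ℤ → Letter} {n : ℕ} {c c' : Letter} {i l : ℤ}

/-- Half the number of letters by which the longest interval without `c` exceeds all others,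
rounded up. -/
noncomputable def excess (f : ℤ → Letter) (n : ℕ) (c : Letter) : ℕ := sInf {k | ¬ Wide f n c k}

lemma Adm.lt_excess_iff (h : Adm f n) {k : ℕ} : k < excess f n c ↔ Wide f n c k := by
  have hne : {k | ¬ Wide f n c k}.Nonempty := ⟨n, fun hw => (hw.lt h).false⟩
  constructor
  · intro hk
    simpa using Nat.notMem_of_lt_sInf hk
  · intro hk
    by_contra! hlt
    exact Nat.sInf_mem hne (hk.mono hlt)

lemma SeqEquiv.excess_eq (h : SeqEquiv f f') (hf : Adm f n) : excess f' n c = excess f n c :=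
  eq_of_forall_lt_iff fun k => by rw [(h.adm hf).lt_excess_iff, hf.lt_excess_iff, h.wide_iff hf]

lemma IsExp.excess_eq (E : IsExp f F n c i l) : excess F (n + 2) c = excess f n c + 1 :=
  eq_of_forall_lt_iff fun k => by
    rcases k with _ | k
    · simpa [E.adm'.lt_excess_iff] using (E.wide_succ_iff.2 E.wide).mono zero_le_one
    · rw [E.adm'.lt_excess_iff, E.wide_succ_iff, Nat.succ_lt_succ_iff, E.adm.lt_excess_iff]

lemma IsExp.excess_eq_of_ne (E : IsExp f F n c i l) (h : c' ≠ c) :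
    excess F (n + 2) c' = excess f n c' :=
  eq_of_forall_lt_iff fun k => by
    rw [E.adm'.lt_excess_iff, E.wide_iff_of_ne h, E.adm.lt_excess_iff]

lemma adm_seqW (w : GWord) : Adm (seqW w.1) w.1.length := inG_iff.1 w.2

lemma gEquiv_iff {u v : GWord} :
    GEquiv u v ↔ u.1.length = v.1.length ∧ SeqEquiv (seqW u.1) (seqW v.1) :=
  wordEquiv_iff (fun h => by have := (adm_seqW u).four; simp [h] at this) (adm_seqW u).even

lemma SeqEquiv.refl (f : ℤ → Letter) : SeqEquiv f f := ⟨true, 0, by simp, fun k => by simp [flipL]⟩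

lemma gEquiv_equivalence : Equivalence GEquiv where
  refl _ := gEquiv_iff.2 ⟨rfl, .refl _⟩
  symm h := gEquiv_iff.2 ⟨(gEquiv_iff.1 h).1.symm, (gEquiv_iff.1 h).2.symm⟩
  trans h h' := gEquiv_iff.2 ⟨(gEquiv_iff.1 h).1.trans (gEquiv_iff.1 h').1,
    (gEquiv_iff.1 h).2.trans (gEquiv_iff.1 h').2⟩

lemma mk_eq_iff {u v : GWord} :
    (Quot.mk GEquiv u : GClass) = Quot.mk GEquiv v ↔
      u.1.length = v.1.length ∧ SeqEquiv (seqW u.1) (seqW v.1) := by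
  rw [← gEquiv_iff, Quot.eq, gEquiv_equivalence.eqvGen_iff]

lemma mk_crep (A : GClass) : Quot.mk GEquiv (crep A) = A := (Quot.exists_rep A).choose_spec

lemma Adm.exists_gWord (h : Adm f n) : ∃ w : GWord, seqW w.1 = f ∧ w.1.length = n := by
  have h1 := seqW_ofFn (by have := h.four; omega) h.per
  refine ⟨⟨List.ofFn fun i : Fin n => f i, inG_iff.2 ?_⟩, h1, List.length_ofFn⟩
  rwa [h1, List.length_ofFn]

/-- The excess of the longest run avoiding `c`, for a class. -/
noncomputable def classExcess (c : Letter) (A : GClass) : ℕ :=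
  excess (seqW (crep A).1) (crep A).1.length c

lemma crep_equiv {A : GClass} {w : GWord} (h : Quot.mk GEquiv w = A) :
    w.1.length = (crep A).1.length ∧ SeqEquiv (seqW w.1) (seqW (crep A).1) :=
  mk_eq_iff.1 (h.trans (mk_crep A).symm)

lemma classExcess_eq {A : GClass} {w : GWord} (h : Quot.mk GEquiv w = A) :
    classExcess c A = excess (seqW w.1) w.1.length c := by
  obtain ⟨h1, h2⟩ := crep_equiv h
  rw [classExcess, ← h1, h2.excess_eq (adm_seqW w)]

lemma Lw_crep {A : GClass} {w : GWord} (h : Quot.mk GEquiv w = A) : Lw (crep A).1 = Lw w.1 := by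
  rw [Lw, Lw, (crep_equiv h).1]

lemma deltaW_crep {A : GClass} {w : GWord} (h : Quot.mk GEquiv w = A) :
    deltaW (crep A).1 = deltaW w.1 := by
  obtain ⟨h1, h2⟩ := crep_equiv h
  rw [deltaW_eq (adm_seqW (crep A)), deltaW_eq (adm_seqW w), ← h1, h2.deltaS_eq (adm_seqW w)]

lemma motifCond_iff_excess (w : GWord) :
    MotifCond w.1 ↔ ∀ c, excess (seqW w.1) w.1.length c ≤ 1 := by
  simp only [motifCond_iff (adm_seqW w), ← (adm_seqW w).lt_excess_iff, not_lt]

lemma motifCond_iff_class {A : GClass} {w : GWord} (h : Quot.mk GEquiv w = A) :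
    MotifCond w.1 ↔ ∀ c, classExcess c A ≤ 1 := by
  simp only [motifCond_iff_excess, classExcess_eq h]

lemma rank_crep (A : GClass) : rank (crep A).1 =
    (Finset.univ.filter fun c => 0 < classExcess c A).card := by
  rw [rank_eq (adm_seqW (crep A)), ← Fintype.card_subtype, ← Nat.card_eq_fintype_card]
  simp only [classExcess, (adm_seqW (crep A)).lt_excess_iff]

/-- The class `B` is obtained from `A` by expansion at its longest run avoiding `c`. -/
def ClassExp (c : Letter) (A B : GClass) : Prop :=
  ∃ (w v : GWord) (i l : ℤ), Quot.mk GEquiv w = A ∧ Quot.mk GEquiv v = B ∧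
    v.1.length = w.1.length + 2 ∧ IsExp (seqW w.1) (seqW v.1) w.1.length c i l

variable {A A' B B' : GClass}

lemma ClassExp.excess_eq (h : ClassExp c A B) : classExcess c B = classExcess c A + 1 := by
  obtain ⟨w, v, i, l, h1, h2, h3, E⟩ := h
  rw [classExcess_eq h1, classExcess_eq h2, h3, E.excess_eq]

lemma ClassExp.excess_eq_of_ne (h : ClassExp c A B) (hc : c' ≠ c) :
    classExcess c' B = classExcess c' A := by
  obtain ⟨w, v, i, l, h1, h2, h3, E⟩ := h
  rw [classExcess_eq h1, classExcess_eq h2, h3, E.excess_eq_of_ne hc]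

lemma ClassExp.excess_pos (h : ClassExp c A B) : 0 < classExcess c A := by
  obtain ⟨w, v, i, l, h1, h2, h3, E⟩ := h
  rw [classExcess_eq h1, E.adm.lt_excess_iff]
  exact E.wide

lemma ClassExp.Lw_eq (h : ClassExp c A B) : Lw (crep B).1 = Lw (crep A).1 + 1 := by
  obtain ⟨w, v, i, l, h1, h2, h3, E⟩ := h
  rw [Lw_crep h1, Lw_crep h2, Lw, Lw, h3]
  push_cast
  omega

lemma ClassExp.deltaW_eq (h : ClassExp c A B) : deltaW (crep B).1 = deltaW (crep A).1 := by
  obtain ⟨w, v, i, l, h1, h2, h3, E⟩ := h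
  rw [deltaW_crep h1, deltaW_crep h2, Pants.deltaW_eq (adm_seqW w), Pants.deltaW_eq (adm_seqW v),
    h3, E.deltaS_eq]

lemma exists_classExp (h : 0 < classExcess c A) : ∃ B, ClassExp c A B := by
  rw [classExcess, (adm_seqW (crep A)).lt_excess_iff] at h
  obtain ⟨F, i, l, E⟩ := (adm_seqW (crep A)).exists_isExp h
  obtain ⟨v, rfl, hv⟩ := E.adm'.exists_gWord
  exact ⟨Quot.mk _ v, crep A, v, i, l, mk_crep A, rfl, hv, E⟩

lemma exists_classExp' (h : 1 < classExcess c B) : ∃ A, ClassExp c A B := by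
  rw [classExcess, (adm_seqW (crep B)).lt_excess_iff] at h
  obtain ⟨n, f, i, l, hn, E⟩ := (adm_seqW (crep B)).exists_isExp_of_wide_one h
  obtain ⟨w, rfl, rfl⟩ := E.adm.exists_gWord
  exact ⟨Quot.mk _ w, w, crep B, i, l, rfl, mk_crep B, hn, E⟩

lemma ClassExp.right_unique (h : ClassExp c A B) (h' : ClassExp c A B') : B = B' := by
  obtain ⟨w, v, i, l, rfl, rfl, h3, E⟩ := h
  obtain ⟨w', v', i', l', h1, rfl, h3', E'⟩ := h'
  obtain ⟨hl, he⟩ := mk_eq_iff.1 h1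
  rw [hl] at E'
  obtain ⟨F, j, E'', hF⟩ := E'.exists_of_equiv he
  exact mk_eq_iff.2 ⟨by omega, (E.equiv_right E'').trans hF.symm⟩

lemma ClassExp.left_unique (h : ClassExp c A B) (h' : ClassExp c A' B) : A = A' := by
  obtain ⟨w, v, i, l, rfl, rfl, h3, E⟩ := h
  obtain ⟨w', v', i', l', rfl, h2, h3', E'⟩ := h'
  obtain ⟨hl, he⟩ := mk_eq_iff.1 h2
  have hw : w'.1.length = w.1.length := by omega
  rw [hw] at E'
  obtain ⟨f, j, E'', hf⟩ := E'.exists_of_equiv' he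
  exact mk_eq_iff.2 ⟨hw.symm, (E.equiv_left E'').trans hf.symm⟩

end

section

variable {c : Letter} {A A' B B' : GClass} {k k' : ℕ} {e e' : Letter → ℕ}

/-- The class `B` is obtained from `A` by `k` successive expansions at runs avoiding `c`. -/
def ClassExpIter (c : Letter) : ℕ → GClass → GClass → Prop
  | 0, A, B => A = B
  | k + 1, A, B => ∃ C, ClassExpIter c k A C ∧ ClassExp c C B

lemma ClassExpIter.spec (h : ClassExpIter c k A B) :
    (classExcess c B = classExcess c A + k ∧ (k = 0 ∨ 0 < classExcess c A) ∧
      Lw (crep B).1 = Lw (crep A).1 + k ∧ deltaW (crep B).1 = deltaW (crep A).1) ∧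
      ∀ c' ≠ c, classExcess c' B = classExcess c' A := by
  induction k generalizing B with
  | zero => obtain rfl := h; simp
  | succ k ih =>
    obtain ⟨C, h1, h2⟩ := h
    obtain ⟨⟨i1, i2, i3, i4⟩, i5⟩ := ih h1
    have e1 := h2.excess_eq
    have e2 := h2.excess_pos
    have e3 := h2.Lw_eq
    refine ⟨⟨by omega, by omega, by push_cast; omega, h2.deltaW_eq.trans i4⟩, fun c' hc => ?_⟩
    rw [h2.excess_eq_of_ne hc, i5 c' hc]

lemma ClassExpIter.right_unique (h : ClassExpIter c k A B) (h' : ClassExpIter c k A B') :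
    B = B' := by
  induction k generalizing B B' with
  | zero => exact h.symm.trans h'
  | succ k ih =>
    obtain ⟨C, h1, h2⟩ := h
    obtain ⟨C', h1', h2'⟩ := h'
    obtain rfl := ih h1 h1'
    exact h2.right_unique h2'

lemma ClassExpIter.left_unique (h : ClassExpIter c k A B) (h' : ClassExpIter c k A' B) :
    A = A' := by
  induction k generalizing B with
  | zero => exact h.trans h'.symm
  | succ k ih =>
    obtain ⟨C, h1, h2⟩ := h
    obtain ⟨C', h1', h2'⟩ := h'
    obtain rfl := h2.left_unique h2'
    exact ih h1 h1'

lemma exists_classExpIter (h : k = 0 ∨ 0 < classExcess c A) : ∃ B, ClassExpIter c k A B := by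
  induction k with
  | zero => exact ⟨A, rfl⟩
  | succ k ih =>
    obtain ⟨C, hC⟩ := ih (by omega)
    have := hC.spec.1.1
    obtain ⟨B, hB⟩ := exists_classExp (c := c) (A := C) (by omega)
    exact ⟨B, C, hC, hB⟩

lemma exists_classExpIter' (h : k = 0 ∨ k < classExcess c B) : ∃ A, ClassExpIter c k A B := by
  induction k generalizing B with
  | zero => exact ⟨B, rfl⟩
  | succ k ih =>
    obtain ⟨C, hC⟩ := exists_classExp' (c := c) (B := B) (by omega)
    have := hC.excess_eq
    obtain ⟨A, hA⟩ := ih (B := C) (by omega)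
    exact ⟨A, C, hA, hC⟩

/-- The class `B` is obtained from `A` by `e c` expansions at runs avoiding `c`, for each `c`. -/
def MultiExp (e : Letter → ℕ) (A B : GClass) : Prop :=
  ∃ P Q, ClassExpIter .x (e .x) A P ∧ ClassExpIter .y (e .y) P Q ∧ ClassExpIter .z (e .z) Q B

lemma MultiExp.spec (h : MultiExp e A B) :
    (∀ c, classExcess c B = classExcess c A + e c ∧ (e c = 0 ∨ 0 < classExcess c A)) ∧
      Lw (crep B).1 = Lw (crep A).1 + (∑ c, e c : ℕ) ∧
      deltaW (crep B).1 = deltaW (crep A).1 := by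
  obtain ⟨P, Q, h1, h2, h3⟩ := h
  obtain ⟨⟨a1, a2, a3, a4⟩, a5⟩ := h1.spec
  obtain ⟨⟨b1, b2, b3, b4⟩, b5⟩ := h2.spec
  obtain ⟨⟨c1, c2, c3, c4⟩, c5⟩ := h3.spec
  have hsum : ∑ c, e c = e .x + e .y + e .z := by
    rw [show (Finset.univ : Finset Letter) = {.x, .y, .z} from rfl]
    simp [add_assoc]
  refine ⟨fun c => ?_, by rw [hsum]; push_cast; omega, by omega⟩
  have := a5 .y (by decide)
  have := a5 .z (by decide)
  have := b5 .x (by decide)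
  have := b5 .z (by decide)
  have := c5 .x (by decide)
  have := c5 .y (by decide)
  cases c <;> omega

lemma MultiExp.right_unique (h : MultiExp e A B) (h' : MultiExp e A B') : B = B' := by
  obtain ⟨P, Q, h1, h2, h3⟩ := h
  obtain ⟨P', Q', h1', h2', h3'⟩ := h'
  obtain rfl := h1.right_unique h1'
  obtain rfl := h2.right_unique h2'
  exact h3.right_unique h3'

lemma MultiExp.left_unique (h : MultiExp e A B) (h' : MultiExp e A' B) : A = A' := by
  obtain ⟨P, Q, h1, h2, h3⟩ := h
  obtain ⟨P', Q', h1', h2', h3'⟩ := h'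
  obtain rfl := h3.left_unique h3'
  obtain rfl := h2.left_unique h2'
  exact h1.left_unique h1'

lemma exists_multiExp (h : ∀ c, e c = 0 ∨ 0 < classExcess c A) : ∃ B, MultiExp e A B := by
  obtain ⟨P, hP⟩ := exists_classExpIter (h .x)
  obtain ⟨Q, hQ⟩ := exists_classExpIter (c := .y) (k := e .y) (A := P)
    (by rw [hP.spec.2 _ (by decide)]; exact h _)
  obtain ⟨B, hB⟩ := exists_classExpIter (c := .z) (k := e .z) (A := Q)
    (by rw [hQ.spec.2 _ (by decide), hP.spec.2 _ (by decide)]; exact h _)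
  exact ⟨B, P, Q, hP, hQ, hB⟩

lemma exists_multiExp' (h : ∀ c, e c = 0 ∨ e c < classExcess c B) : ∃ A, MultiExp e A B := by
  obtain ⟨Q, hQ⟩ := exists_classExpIter' (h .z)
  obtain ⟨P, hP⟩ := exists_classExpIter' (c := .y) (k := e .y) (B := Q)
    (by rw [← hQ.spec.2 _ (by decide)]; exact h _)
  obtain ⟨A, hA⟩ := exists_classExpIter' (c := .x) (k := e .x) (B := P)
    (by rw [← hP.spec.2 _ (by decide), ← hQ.spec.2 _ (by decide)]; exact h _)
  exact ⟨A, P, Q, hA, hP, hQ⟩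

/-- The classes of motifs with defect `δ` and length at most `L`. -/
def motifClasses (δ L : ℤ) : Set GClass :=
  {A | (∀ c, classExcess c A ≤ 1) ∧ deltaW (crep A).1 = δ ∧ Lw (crep A).1 ≤ L}

lemma motifClasses_eq (δ L : ℤ) : {A : GClass | ∃ w : GWord, Quot.mk GEquiv w = A ∧
    MotifCond w.1 ∧ deltaW w.1 = δ ∧ Lw w.1 ≤ L} = motifClasses δ L := by
  ext A
  constructor
  · rintro ⟨w, h1, h2, h3, h4⟩
    exact ⟨(motifCond_iff_class h1).1 h2, (deltaW_crep h1).trans h3, (Lw_crep h1).trans_le h4⟩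
  · rintro ⟨h1, h2, h3⟩
    exact ⟨crep A, mk_crep A, (motifCond_iff_class (mk_crep A)).2 h1, h2, h3⟩

lemma finite_Lw_le (L : ℤ) : {A : GClass | Lw (crep A).1 ≤ L}.Finite := by
  refine ((List.finite_length_le Letter (2 * L + 1).toNat).subset ?_).of_finite_image
    (f := fun A => (crep A).1) fun A _ A' _ h => ?_
  · rintro _ ⟨A, hA, rfl⟩
    simp only [Set.mem_ofPred_eq, Lw] at hA ⊢
    omega
  · rw [← mk_crep A, ← mk_crep A', Subtype.ext h]

/-- The number of ways to distribute `s` expansions among the letters of positive excess. -/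
noncomputable def expansions (A : GClass) (s : ℕ) : Finset (Letter →₀ ℕ) :=
  (Finset.univ.filter fun c => 0 < classExcess c A).finsuppAntidiag s

lemma mem_expansions {s : ℕ} {e : Letter →₀ ℕ} :
    e ∈ expansions A s ↔ ∑ c, e c = s ∧ ∀ c, e c = 0 ∨ 0 < classExcess c A := by
  rw [expansions, Finset.mem_finsuppAntidiag']
  have : (e.support ⊆ Finset.univ.filter fun c => 0 < classExcess c A) ↔
      ∀ c, e c = 0 ∨ 0 < classExcess c A := by
    simp [Finset.subset_iff, or_iff_not_imp_left]
  rw [this, Finsupp.sum_fintype _ _ fun _ => rfl]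

lemma card_expansions (A : GClass) {s : ℤ} (hs : 0 ≤ s) : ((expansions A s.toNat).card : ℤ) =
    binC (s + (rank (crep A).1 : ℤ) - 1) ((rank (crep A).1 : ℤ) - 1) := by
  rw [expansions, Finset.card_finsuppAntidiag_nat_eq_choose, ← rank_crep]
  generalize rank (crep A).1 = r
  lift s to ℕ using hs
  rw [binC, Int.toNat_natCast]
  rcases r with _ | r
  · rcases s with _ | s
    · simp
    · simp
  · rw [if_neg (by omega), if_pos (by omega)]
    congr 1
    rw [show (s + ((r + 1 : ℕ) : ℤ) - 1).toNat = s + r by omega,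
      show (((r + 1 : ℕ) : ℤ) - 1).toNat = r by omega, show r + 1 + s - 1 = s + r by omega,
      Nat.choose_symm_add]

lemma Ncount_eq (δ L : ℤ) : Ncount δ L =
    Nat.card (Σ A : motifClasses δ L, expansions A.1 (L - Lw (crep A.1).1).toNat) := by
  have hex : ∀ p : Σ A : motifClasses δ L, expansions A.1 (L - Lw (crep A.1).1).toNat,
      ∃ B, MultiExp p.2.1 p.1.1 B := fun p => exists_multiExp (mem_expansions.1 p.2.2).2
  choose Φ hΦ using hex
  have hL : ∀ p, Lw (crep (Φ p)).1 = L := fun p => by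
    rw [(hΦ p).spec.2.1, (mem_expansions.1 p.2.2).1]
    have := p.1.2.2.2
    omega
  refine (Nat.card_eq_of_bijective (fun p => ⟨Φ p, crep (Φ p), mk_crep _, hL p,
    (hΦ p).spec.2.2.trans p.1.2.2.1⟩) ⟨?_, ?_⟩).symm
  · rintro ⟨⟨A, hA⟩, e, he⟩ ⟨⟨A', hA'⟩, e', he'⟩ h
    have h0 : Φ ⟨⟨A, hA⟩, e, he⟩ = Φ ⟨⟨A', hA'⟩, e', he'⟩ := congrArg Subtype.val h
    have h1 : MultiExp e A _ := hΦ ⟨⟨A, hA⟩, e, he⟩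
    have h2 : MultiExp e' A' _ := hΦ ⟨⟨A', hA'⟩, e', he'⟩
    rw [← h0] at h2
    obtain rfl : e = e' := Finsupp.ext fun c => by
      have := h1.spec.1 c
      have := h2.spec.1 c
      have := hA.1 c
      have := hA'.1 c
      omega
    obtain rfl := h1.left_unique h2
    rfl
  · rintro ⟨B, w, hw, hL, hδ⟩
    obtain ⟨A, hA⟩ := exists_multiExp' (B := B) (e := fun c => classExcess c B - 1)
      fun c => by omega
    obtain ⟨s1, s2, s3⟩ := hA.spec
    rw [Lw_crep hw, hL] at s2
    rw [deltaW_crep hw, hδ] at s3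
    have hAm : A ∈ motifClasses δ L := ⟨fun c => by have := s1 c; omega, s3.symm, by omega⟩
    refine ⟨⟨⟨A, hAm⟩, Finsupp.equivFunOnFinite.symm fun c => classExcess c B - 1,
      mem_expansions.2 ⟨?_, fun c => (s1 c).2⟩⟩, Subtype.ext ((hΦ _).right_unique hA)⟩
    simp only [Finsupp.equivFunOnFinite_symm_apply_apply]
    omega

end

end Pants

theorem almost_simple_geodesics_stmt2 :
    ∀ δ L : ℤ,
      (Ncount δ L : ℤ) =
        ∑ᶠ c ∈ {c : GClass | ∃ w : GWord, Quot.mk GEquiv w = c ∧ MotifCond w.1 ∧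
            deltaW w.1 = δ ∧ Lw w.1 ≤ L},
          binC (L - Lw (crep c).1 + (rank (crep c).1 : ℤ) - 1) ((rank (crep c).1 : ℤ) - 1) := by
  intro δ L
  have : Finite (Pants.motifClasses δ L) :=
    ((Pants.finite_Lw_le L).subset fun A hA => hA.2.2).to_subtype
  have := Fintype.ofFinite (Pants.motifClasses δ L)
  rw [Pants.Ncount_eq, Nat.card_sigma, Pants.motifClasses_eq, ← finsum_set_coe_eq_finsum_mem,
    finsum_eq_sum_of_fintype, Nat.cast_sum]
  refine Finset.sum_congr rfl fun A _ => ?_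
  rw [Nat.card_eq_fintype_card, Fintype.card_coe,
    Pants.card_expansions _ (sub_nonneg.2 A.2.2.2)]
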